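/- arXiv:2411.04084 — 5 statements merged into one kernel-verified Lean document; each statement's English description precedes it below -/
import Mathlib

section
/- (Theorem 1.1(i) on ℍ³.) For every α with 0 ≤ α < 1/4, every R > 0 and every q ∈ [1, ∞], there is no constant C > 0 such that ‖S*g‖_{L^q(B_R)} ≤ C ‖g‖_{H^α} holds for all even Schwartz functions g : ℝ → ℂ. -/
open MeasureTheory Filter Set ENNReal

noncomputable section

/-- The Schrödinger propagator on `ℍ³` applied to an even Schwartz function `g`
(the spherical Fourier transform of the radial initial data). -/
def Sprop (g : ℝ → ℂ) (t s : ℝ) : ℂ :=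
  ∫ l in Set.Ioi (0 : ℝ),
    ((Real.sin (l * s) / (l * Real.sinh s) : ℝ) : ℂ)
      * Complex.exp (Complex.I * ((t * (l ^ 2 + 1) : ℝ) : ℂ))
      * g l * ((l : ℂ) ^ 2)

/-- The Schrödinger maximal function `S* g (s) = sup_{0<t<1} |S_t g (s)|`. -/
def Sstar (g : ℝ → ℂ) (s : ℝ) : ℝ :=
  ⨆ t : Set.Ioo (0 : ℝ) 1, ‖Sprop g (t : ℝ) s‖

/-- The fractional Sobolev norm `‖g‖_{H^α}` on `ℍ³`. -/
def sobNorm (α : ℝ) (g : ℝ → ℂ) : ℝ :=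
  (∫ l in Set.Ioi (0 : ℝ), (l ^ 2 + 1) ^ α * ‖g l‖ ^ 2 * l ^ 2) ^ ((1 : ℝ) / 2)

/-- The measure `sinh²(s) ds` on the geodesic ball `B_R` (radial coordinates). -/
def ballMeasure (R : ℝ) : Measure ℝ :=
  (volume.restrict (Set.Ioo 0 R)).withDensity (fun s => ENNReal.ofReal (Real.sinh s ^ 2))

end


theorem exists_bump : ∃ ψ : ℝ → ℝ, ContDiff ℝ (⊤ : ℕ∞) ψ ∧ (∀ x, 0 ≤ ψ x) ∧ (∀ x, ψ x ≤ 1) ∧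
    (∀ x, 1 ≤ |x| → ψ x = 0) ∧ 0 < ∫ x, ψ x := by
  let b : ContDiffBump (0 : ℝ) := ⟨1 / 2, 1, by norm_num, by norm_num⟩
  refine ⟨b, b.contDiff, fun x => b.nonneg, fun x => b.le_one, fun x hx => ?_, b.integral_pos⟩
  apply b.zero_of_le_dist
  simpa [Real.dist_eq] using hx

/-- The phase `e^{ix}`. -/
noncomputable def ph (x : ℝ) : ℂ := Complex.exp ((x : ℂ) * Complex.I)

theorem norm_ph (x : ℝ) : ‖ph x‖ = 1 := Complex.norm_exp_ofReal_mul_I x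

theorem ph_cont : Continuous ph := by unfold ph; fun_prop

theorem ph_add (x y : ℝ) : ph (x + y) = ph x * ph y := by
  unfold ph; rw [← Complex.exp_add]; congr 1; push_cast; ring

theorem ph_deriv (f : ℝ → ℝ) (f' x : ℝ) (hf : HasDerivAt f f' x) :
    HasDerivAt (fun y => ph (f y)) (Complex.I * f' * ph (f x)) x := by
  unfold ph
  have := ((hf.ofReal_comp).mul_const Complex.I).cexp
  convert this using 1; ring

section
variable {ψ : ℝ → ℝ}

theorem psi_hcs (hs : ∀ x, 1 ≤ |x| → ψ x = 0) : HasCompactSupport ψ := by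
  apply HasCompactSupport.intro (isCompact_Icc (a := -1) (b := 1))
  intro x hx
  apply hs
  by_contra h
  push Not at h
  exact hx ⟨(abs_lt.1 h).1.le, (abs_lt.1 h).2.le⟩

theorem psi_int (hc : ContDiff ℝ (⊤ : ℕ∞) ψ) (hs : ∀ x, 1 ≤ |x| → ψ x = 0) :
    Integrable ψ :=
  hc.continuous.integrable_of_hasCompactSupport (psi_hcs hs)

theorem dpsi_int (hc : ContDiff ℝ (⊤ : ℕ∞) ψ) (hs : ∀ x, 1 ≤ |x| → ψ x = 0) :
    Integrable (deriv ψ) :=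
  (hc.continuous_deriv (by norm_cast)).integrable_of_hasCompactSupport (psi_hcs hs).deriv

theorem int_cont_mul (hc : ContDiff ℝ (⊤ : ℕ∞) ψ) (hs : ∀ x, 1 ≤ |x| → ψ x = 0)
    (F : ℝ → ℂ) (hF : Continuous F) : Integrable (fun x => F x * (ψ x : ℂ)) := by
  apply Continuous.integrable_of_hasCompactSupport
  · exact hF.mul (Complex.continuous_ofReal.comp hc.continuous)
  · apply HasCompactSupport.mul_left
    exact (psi_hcs hs).comp_left (g := fun x : ℝ => (x : ℂ)) (by simp)

theorem osc_bound (hc : ContDiff ℝ (⊤ : ℕ∞) ψ) (h0 : ∀ x, 0 ≤ ψ x)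
    (hs : ∀ x, 1 ≤ |x| → ψ x = 0) (k s : ℝ) (hk : 0 < k) (hs0 : 0 < s) (hs1 : s ≤ 1) :
    ‖∫ x, ph (k * x) * ph (x ^ 2 * s / 2) * (ψ x : ℂ)‖ ≤
      ((∫ x, ψ x) + ∫ x, |deriv ψ x|) / k := by
  have hdψ : ∀ x, HasDerivAt ψ (deriv ψ x) x := fun x =>
    (hc.differentiable (by simp)).differentiableAt.hasDerivAt
  have hdc : Continuous (deriv ψ) := hc.continuous_deriv (by norm_cast)
  have hpc := ph_cont
  have hψc := hc.continuous
  set u : ℝ → ℂ := fun x => ph (x ^ 2 * s / 2) * (ψ x : ℂ) with hu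
  set u' : ℝ → ℂ := fun x => (Complex.I * ((x * s : ℝ) : ℂ) * ph (x ^ 2 * s / 2)) * (ψ x : ℂ)
    + ph (x ^ 2 * s / 2) * ((deriv ψ x : ℝ) : ℂ) with hu'
  set v : ℝ → ℂ := fun x => ph (k * x) / (Complex.I * k) with hv
  have hkc : (Complex.I * (k : ℂ)) ≠ 0 := by simp [hk.ne']
  have hdu : ∀ x, HasDerivAt u (u' x) x := by
    intro x
    refine HasDerivAt.mul ?_ (hdψ x).ofReal_comp
    apply ph_deriv
    have := ((hasDerivAt_pow 2 x).mul_const s).div_const 2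
    refine this.congr_deriv ?_
    push_cast; ring
  have hdv : ∀ x, HasDerivAt v (ph (k * x)) x := by
    intro x
    have := (ph_deriv (fun y => k * y) k x (by simpa using (hasDerivAt_id x).const_mul k)).div_const
      (Complex.I * k)
    exact this.congr_deriv (mul_div_cancel_left₀ _ hkc)
  have hucs : HasCompactSupport u := by
    apply HasCompactSupport.mul_left
    exact (psi_hcs hs).comp_left (g := fun x : ℝ => (x : ℂ)) (by simp)
  have hu'cs : HasCompactSupport u' := by
    apply HasCompactSupport.add
    · apply HasCompactSupport.mul_left
      exact (psi_hcs hs).comp_left (g := fun x : ℝ => (x : ℂ)) (by simp)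
    · apply HasCompactSupport.mul_left
      exact (psi_hcs hs).deriv.comp_left (g := fun x : ℝ => (x : ℂ)) (by simp)
  have huc : Continuous u := by fun_prop
  have hu'c : Continuous u' := by fun_prop
  have hvc : Continuous v := by fun_prop
  have key := integral_mul_deriv_eq_deriv_mul_of_integrable (u := u) (v := v) (u' := u')
    (v' := fun x => ph (k * x)) (fun x _ => hdu x) (fun x _ => hdv x)
    ((huc.mul (by fun_prop)).integrable_of_hasCompactSupport hucs.mul_right)
    ((hu'c.mul hvc).integrable_of_hasCompactSupport hu'cs.mul_right)
    ((huc.mul hvc).integrable_of_hasCompactSupport hucs.mul_right)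
  have e : (∫ x, ph (k * x) * ph (x ^ 2 * s / 2) * (ψ x : ℂ)) = ∫ x, u x * ph (k * x) := by
    congr 1; ext x; simp only [hu]; ring
  rw [e, key, norm_neg, ← integral_add (psi_int hc hs) (dpsi_int hc hs).abs, ← integral_div]
  refine norm_integral_le_of_norm_le
    (((psi_int hc hs).add (dpsi_int hc hs).abs).div_const k) (Eventually.of_forall fun x => ?_)
  have hv1 : ‖v x‖ = 1 / k := by simp [hv, norm_ph, abs_of_pos hk]
  rw [norm_mul, hv1, mul_one_div]
  gcongr
  simp only [hu']
  refine (norm_add_le _ _).trans ?_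
  rw [norm_mul, norm_mul, norm_mul, norm_mul, norm_ph, Complex.norm_I, Complex.norm_real,
    Complex.norm_real, Complex.norm_real]
  simp only [Real.norm_eq_abs, one_mul, mul_one]
  gcongr
  rw [abs_of_nonneg (h0 x)]
  by_cases hx : 1 ≤ |x|
  · simp [hs x hx]
  · push Not at hx
    have : |x * s| ≤ 1 := by
      rw [abs_mul, abs_of_pos hs0]
      nlinarith [abs_nonneg x]
    nlinarith [h0 x]

theorem main_bound (hc : ContDiff ℝ (⊤ : ℕ∞) ψ) (h0 : ∀ x, 0 ≤ ψ x)
    (hs : ∀ x, 1 ≤ |x| → ψ x = 0) (s : ℝ) (hs0 : 0 < s) (hs1 : s ≤ 1) :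
    (∫ x, ψ x) / 2 ≤ ‖∫ x, ph (x ^ 2 * s / 2) * (ψ x : ℂ)‖ := by
  have hpc := ph_cont
  refine le_trans ?_ (Complex.re_le_norm _)
  have hi := int_cont_mul hc hs (fun x => ph (x ^ 2 * s / 2)) (by fun_prop)
  have := integral_re hi
  simp only [RCLike.re_to_complex] at this
  rw [← this, ← integral_div]
  apply integral_mono ((psi_int hc hs).div_const 2) hi.re
  intro x
  have e : (ph (x ^ 2 * s / 2) * (ψ x : ℂ)).re = Real.cos (x ^ 2 * s / 2) * ψ x := by
    rw [Complex.re_mul_ofReal, ph, Complex.exp_ofReal_mul_I_re]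
  simp only [RCLike.re_to_complex, e]
  by_cases hx : 1 ≤ |x|
  · simp [hs x hx]
  · push Not at hx
    have hx2 : x ^ 2 ≤ 1 := by rw [← sq_abs]; nlinarith [abs_nonneg x]
    have h2 := Real.one_sub_sq_div_two_le_cos (x := x ^ 2 * s / 2)
    have h3 : x ^ 2 * s / 2 ≤ 1 / 2 := by nlinarith [sq_nonneg x]
    have h4 : 0 ≤ x ^ 2 * s / 2 := by positivity
    have : 1 / 2 ≤ Real.cos (x ^ 2 * s / 2) := by nlinarith
    nlinarith [h0 x]

theorem pert_bound (hc : ContDiff ℝ (⊤ : ℕ∞) ψ) (h0 : ∀ x, 0 ≤ ψ x)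
    (hs : ∀ x, 1 ≤ |x| → ψ x = 0) (F : ℝ → ℂ) (hF : Continuous F) (hF1 : ∀ x, ‖F x‖ = 1)
    (M : ℝ) (hM : 0 < M) :
    ‖(∫ x, F x * (1 + x / M : ℝ) * (ψ x : ℂ)) - ∫ x, F x * (ψ x : ℂ)‖ ≤ (∫ x, ψ x) / M := by
  rw [← integral_sub (int_cont_mul hc hs (fun x => F x * (1 + x / M : ℝ)) (by fun_prop))
    (int_cont_mul hc hs F hF), ← integral_div]
  refine norm_integral_le_of_norm_le ((psi_int hc hs).div_const M)
    (Eventually.of_forall fun x => ?_)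
  have e : F x * (1 + x / M : ℝ) * (ψ x : ℂ) - F x * (ψ x : ℂ)
      = F x * ((x / M * ψ x : ℝ) : ℂ) := by push_cast; ring
  rw [e, norm_mul, hF1, one_mul, Complex.norm_real, Real.norm_eq_abs]
  by_cases hx : 1 ≤ |x|
  · simp [hs x hx]
  · push Not at hx
    rw [abs_mul, abs_div, abs_of_pos hM, abs_of_nonneg (h0 x), div_mul_eq_mul_div]
    gcongr
    nlinarith [h0 x]

end

/-- The wave packet (even). -/
noncomputable def packet (ψ : ℝ → ℝ) (M x : ℝ) : ℂ :=
  ((ψ ((x - M ^ 2) / M) + ψ ((-x - M ^ 2) / M) : ℝ) : ℂ)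

theorem packet_neg (ψ : ℝ → ℝ) (M x : ℝ) : packet ψ M (-x) = packet ψ M x := by
  simp only [packet, neg_neg, add_comm]

section
variable {ψ : ℝ → ℝ}

theorem packet_pos (hs : ∀ x, 1 ≤ |x| → ψ x = 0) (M x : ℝ) (hM : 2 ≤ M) (hx : 0 ≤ x) :
    packet ψ M x = (ψ ((x - M ^ 2) / M) : ℂ) := by
  have : ψ ((-x - M ^ 2) / M) = 0 := by
    apply hs
    rw [abs_div, abs_of_pos (by linarith : 0 < M), le_div_iff₀ (by linarith), le_abs]
    right; nlinarith
  simp [packet, this]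

theorem psi_zero (hs : ∀ x, 1 ≤ |x| → ψ x = 0) (M x : ℝ) (hM : 2 ≤ M) (hx : x ≤ 0) :
    ψ ((x - M ^ 2) / M) = 0 := by
  apply hs
  rw [abs_div, abs_of_pos (by linarith : 0 < M), le_div_iff₀ (by linarith), le_abs]
  right; nlinarith

theorem packet_hcs (hs : ∀ x, 1 ≤ |x| → ψ x = 0) (M : ℝ) (hM : 2 ≤ M) :
    HasCompactSupport (packet ψ M) := by
  apply HasCompactSupport.intro (isCompact_Icc (a := -(M ^ 2 + M)) (b := M ^ 2 + M))
  have hp : ∀ x, M ^ 2 + M < x → packet ψ M x = 0 := by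
    intro x hx
    rw [packet_pos hs M x hM (by nlinarith), hs]
    · simp
    · rw [abs_div, abs_of_pos (by linarith : 0 < M), le_div_iff₀ (by linarith), le_abs]
      left; linarith
  intro x hx
  by_cases h : M ^ 2 + M < x
  · exact hp x h
  · rw [← packet_neg]
    apply hp
    by_contra h'
    exact hx ⟨by linarith, by linarith⟩

theorem packet_cd (hc : ContDiff ℝ (⊤ : ℕ∞) ψ) (M : ℝ) :
    ContDiff ℝ (⊤ : ℕ∞) (packet ψ M) := by
  unfold packet
  apply Complex.ofRealCLM.contDiff.comp
  apply ContDiff.add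
  · exact hc.comp ((contDiff_id.sub contDiff_const).div_const M)
  · exact hc.comp ((contDiff_id.neg.sub contDiff_const).div_const M)

theorem Sprop_packet (hc : ContDiff ℝ (⊤ : ℕ∞) ψ)
    (hs : ∀ x, 1 ≤ |x| → ψ x = 0) (M s : ℝ) (hM : 2 ≤ M) :
    ∃ θ₁ θ₂ : ℝ, Sprop (packet ψ M) (s / (2 * M ^ 2)) s =
      (M ^ 3 / Real.sinh s : ℝ) / (2 * Complex.I) *
       (ph θ₁ * (∫ x, ph (2 * M * s * x) * ph (x ^ 2 * s / 2) * (1 + x / M : ℝ) * (ψ x : ℂ))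
        - ph θ₂ * (∫ x, ph (x ^ 2 * s / 2) * (1 + x / M : ℝ) * (ψ x : ℂ))) := by
  have hpc := ph_cont
  have hM0 : M ≠ 0 := by linarith
  set t := s / (2 * M ^ 2) with ht
  refine ⟨M ^ 2 * s + M ^ 2 * s / 2 + t, - M ^ 2 * s / 2 + t, ?_⟩
  set f : ℝ → ℂ := fun l => (1 / Real.sinh s : ℝ) * (Real.sin (l * s) : ℝ) *
    ph (t * (l ^ 2 + 1)) * (l : ℂ) * (ψ ((l - M ^ 2) / M) : ℂ) with hf
  have e1 : Sprop (packet ψ M) t s = ∫ l, f l := by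
    rw [← setIntegral_eq_integral_of_forall_compl_eq_zero (s := Ioi 0)]
    · unfold Sprop
      refine setIntegral_congr_fun measurableSet_Ioi fun l hl => ?_
      have hl : 0 < l := hl
      have hl' : (l : ℂ) ≠ 0 := by exact_mod_cast hl.ne'
      simp only [hf, packet_pos hs M l hM hl.le, ph, mul_comm Complex.I]
      push_cast
      by_cases hsh : Complex.sinh (s : ℂ) = 0
      · simp [hsh]
      field_simp
    · intro l hl
      simp only [hf, psi_zero hs M l hM (by simpa using hl)]
      simp
  have e2 : ∫ l, f l = (M : ℂ) * ∫ x, f (M ^ 2 + M * x) := by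
    have := Measure.integral_comp_mul_left (fun y => f (M ^ 2 + y)) M
    rw [this, integral_add_left_eq_self f, abs_of_pos (by positivity), Complex.real_smul]
    have : (M : ℂ) ≠ 0 := by exact_mod_cast hM0
    push_cast; field_simp
  rw [e1, e2, ← integral_const_mul, ← integral_const_mul, ← integral_const_mul,
    ← integral_sub, ← integral_const_mul]
  · congr 1; ext x
    have hd : (M ^ 2 + M * x - M ^ 2) / M = x := by field_simp; ring
    simp only [hf, hd]
    have a1 : ph (M ^ 2 * s + M ^ 2 * s / 2 + t) * ph (2 * M * s * x) * ph (x ^ 2 * s / 2)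
       = ph ((M ^ 2 + M * x) * s) * ph (t * ((M ^ 2 + M * x) ^ 2 + 1)) := by
      rw [← ph_add, ← ph_add, ← ph_add]; congr 1; rw [ht]; field_simp; ring
    have a2 : ph (- M ^ 2 * s / 2 + t) * ph (x ^ 2 * s / 2)
       = ph (-((M ^ 2 + M * x) * s)) * ph (t * ((M ^ 2 + M * x) ^ 2 + 1)) := by
      rw [← ph_add, ← ph_add]; congr 1; rw [ht]; field_simp; ring
    have a3 : ((Real.sin ((M ^ 2 + M * x) * s) : ℝ) : ℂ) =
        (ph ((M ^ 2 + M * x) * s) - ph (-((M ^ 2 + M * x) * s))) / (2 * Complex.I) := by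
      generalize (M ^ 2 + M * x) * s = y
      simp only [ph, Complex.ofReal_sin, Complex.sin]
      push_cast
      field_simp
      simp only [Complex.I_sq]; ring
    have a4 : (M : ℂ) * ((M ^ 2 + M * x : ℝ) : ℂ) = (M ^ 3 : ℝ) * (1 + x / M : ℝ) := by
      norm_cast; field_simp
    have a5 : ((M ^ 3 / Real.sinh s : ℝ) : ℂ) = (M ^ 3 : ℝ) * (1 / Real.sinh s : ℝ) := by
      norm_cast; ring
    rw [a3, a5]
    linear_combination (1 / Real.sinh s : ℝ) * ((ph ((M ^ 2 + M * x) * s) - ph (-((M ^ 2 + M * x) * s))) / (2 * Complex.I)) * ph (t * ((M ^ 2 + M * x) ^ 2 + 1)) * (ψ x : ℂ) * a4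
      - (M ^ 3 : ℝ) * (1 / Real.sinh s : ℝ) / (2 * Complex.I) * (1 + x / M : ℝ) * (ψ x : ℂ) * (a1 - a2)
  · exact (int_cont_mul hc hs (fun x => ph (2 * M * s * x) * ph (x ^ 2 * s / 2) * (1 + x / M : ℝ))
      (by fun_prop)).const_mul _
  · exact (int_cont_mul hc hs (fun x => ph (x ^ 2 * s / 2) * (1 + x / M : ℝ))
      (by fun_prop)).const_mul _

theorem Sprop_lower (hc : ContDiff ℝ (⊤ : ℕ∞) ψ) (h0 : ∀ x, 0 ≤ ψ x)
    (hs : ∀ x, 1 ≤ |x| → ψ x = 0) (M s a : ℝ) (hM : 2 ≤ M) (ha : 0 < a) (has : a ≤ s)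
    (hs1 : s ≤ 1) :
    M ^ 3 / (2 * Real.sinh 1) * ((∫ x, ψ x) / 2 - 2 * (∫ x, ψ x) / M
      - ((∫ x, ψ x) + ∫ x, |deriv ψ x|) / (2 * M * a)) ≤
      max 0 ‖Sprop (packet ψ M) (s / (2 * M ^ 2)) s‖ := by
  have hpc := ph_cont
  have hs0 : 0 < s := by linarith
  obtain ⟨θ₁, θ₂, h⟩ := Sprop_packet hc hs M s hM
  set J := ∫ x, ψ x
  set K := ∫ x, |deriv ψ x|
  have hJ : 0 ≤ J := integral_nonneg h0
  have hK : 0 ≤ K := integral_nonneg fun x => abs_nonneg _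
  rw [h, norm_mul]
  have b1 := osc_bound hc h0 hs (2 * M * s) s (by positivity) hs0 hs1
  have b2 := main_bound hc h0 hs s hs0 hs1
  have b3 := pert_bound hc h0 hs (fun x => ph (2 * M * s * x) * ph (x ^ 2 * s / 2))
    (by fun_prop) (fun x => by simp [norm_ph]) M (by linarith)
  have b4 := pert_bound hc h0 hs (fun x => ph (x ^ 2 * s / 2))
    (by fun_prop) (fun x => by simp [norm_ph]) M (by linarith)
  set P := ∫ x, ph (2 * M * s * x) * ph (x ^ 2 * s / 2) * (1 + x / M : ℝ) * (ψ x : ℂ)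
  set Q := ∫ x, ph (x ^ 2 * s / 2) * (1 + x / M : ℝ) * (ψ x : ℂ)
  set P0 := ∫ x, ph (2 * M * s * x) * ph (x ^ 2 * s / 2) * (ψ x : ℂ)
  set Q0 := ∫ x, ph (x ^ 2 * s / 2) * (ψ x : ℂ)
  have c1 : ‖P‖ ≤ ‖P0‖ + J / M := by
    have := norm_add_le P0 (P - P0); rw [add_sub_cancel] at this; linarith
  have c2 : ‖Q0‖ - J / M ≤ ‖Q‖ := by
    have := norm_sub_norm_le Q0 Q; rw [norm_sub_rev] at this; linarith
  have c3 : ‖Q‖ - ‖P‖ ≤ ‖ph θ₁ * P - ph θ₂ * Q‖ := by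
    have := norm_sub_norm_le (ph θ₂ * Q) (ph θ₁ * P)
    rw [norm_sub_rev, norm_mul, norm_mul, norm_ph, norm_ph, one_mul, one_mul] at this
    exact this
  have c4 : (J + K) / (2 * M * s) ≤ (J + K) / (2 * M * a) := by gcongr
  have hn : ‖((M ^ 3 / Real.sinh s : ℝ) : ℂ) / (2 * Complex.I)‖ = M ^ 3 / (2 * Real.sinh s) := by
    rw [norm_div, Complex.norm_real, norm_mul, Complex.norm_I, Real.norm_eq_abs, abs_of_pos
      (div_pos (by positivity) (Real.sinh_pos_iff.2 hs0))]
    simp; ring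
  rw [hn]
  have hle : J / 2 - 2 * J / M - (J + K) / (2 * M * a) ≤ ‖ph θ₁ * P - ph θ₂ * Q‖ := by
    have : 2 * J / M = J / M + J / M := by ring
    linarith
  have hsp := Real.sinh_pos_iff.2 hs0
  have hss : Real.sinh s ≤ Real.sinh 1 := Real.sinh_le_sinh.2 hs1
  have hM3 : 0 < M ^ 3 := by positivity
  refine le_trans ?_ (le_max_right _ _)
  calc _ ≤ M ^ 3 / (2 * Real.sinh 1) * ‖ph θ₁ * P - ph θ₂ * Q‖ := by
        have : 0 < Real.sinh 1 := by linarith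
        gcongr
    _ ≤ _ := by gcongr

theorem Sstar_ge (hc : ContDiff ℝ (⊤ : ℕ∞) ψ)
    (hs : ∀ x, 1 ≤ |x| → ψ x = 0) (M s t : ℝ) (hM : 2 ≤ M) (ht : t ∈ Ioo (0 : ℝ) 1) :
    ‖Sprop (packet ψ M) t s‖ ≤ Sstar (packet ψ M) s := by
  unfold Sstar
  refine le_ciSup (f := fun t : Ioo (0 : ℝ) 1 => ‖Sprop (packet ψ M) (t : ℝ) s‖) ?_ ⟨t, ht⟩
  refine ⟨∫ l in Ioi (0 : ℝ), |1 / Real.sinh s| * ‖(packet ψ M l) * (l : ℂ)‖, ?_⟩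
  rintro _ ⟨t, rfl⟩
  simp only [Sprop]
  apply norm_integral_le_of_norm_le
  · apply Integrable.integrableOn
    apply Integrable.const_mul
    apply Integrable.norm
    apply Continuous.integrable_of_hasCompactSupport
    · exact (packet_cd hc M).continuous.mul (by fun_prop)
    · exact (packet_hcs hs M hM).mul_right
  · refine (ae_restrict_iff' measurableSet_Ioi).2 (Eventually.of_forall fun l hl => ?_)
    have hl : 0 < l := hl
    rw [norm_mul, norm_mul, norm_mul, mul_comm Complex.I, Complex.norm_exp_ofReal_mul_I,
      Complex.norm_real, norm_pow, Complex.norm_real, norm_mul, Complex.norm_real,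
      Real.norm_eq_abs, Real.norm_eq_abs, abs_div, abs_mul, abs_div, abs_one]
    have hsin := Real.abs_sin_le_one (l * s)
    have hl0 : |l| ≠ 0 := by simpa using hl.ne'
    have : |Real.sin (l * s)| / (|l| * |Real.sinh s|) * 1 * ‖packet ψ M l‖ * |l| ^ 2
       = |Real.sin (l * s)| / |Real.sinh s| * (‖packet ψ M l‖ * |l|) := by
      rw [mul_comm |l|, div_mul_eq_div_div]; field_simp
    rw [this]
    gcongr

theorem sob_le (α : ℝ) (hα : 0 ≤ α) (h0 : ∀ x, 0 ≤ ψ x)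
    (h1 : ∀ x, ψ x ≤ 1)
    (hs : ∀ x, 1 ≤ |x| → ψ x = 0) (M : ℝ) (hM : 2 ≤ M) :
    sobNorm α (packet ψ M) ≤ (8 * 5 ^ α) ^ ((1 : ℝ) / 2) * M ^ (2 * α + 5 / 2) := by
  have hM0 : 0 < M := by linarith
  have key : (∫ l in Ioi (0 : ℝ), (l ^ 2 + 1) ^ α * ‖packet ψ M l‖ ^ 2 * l ^ 2)
      ≤ (5 * M ^ 4) ^ α * (2 * M ^ 2) ^ 2 * (2 * M) := by
    have : (5 * M ^ 4) ^ α * (2 * M ^ 2) ^ 2 * (2 * M) =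
        ∫ l, (Icc (M ^ 2 - M) (M ^ 2 + M)).indicator
          (fun _ => (5 * M ^ 4) ^ α * (2 * M ^ 2) ^ 2) l := by
      rw [integral_indicator measurableSet_Icc, setIntegral_const]
      rw [Real.volume_real_Icc_of_le (by linarith), smul_eq_mul]; ring
    rw [this, ← integral_indicator measurableSet_Ioi]
    have hind : ∀ l, (Ioi (0 : ℝ)).indicator
        (fun l => (l ^ 2 + 1) ^ α * ‖packet ψ M l‖ ^ 2 * l ^ 2) l ≤
        (Icc (M ^ 2 - M) (M ^ 2 + M)).indicator
          (fun _ => (5 * M ^ 4) ^ α * (2 * M ^ 2) ^ 2) l := by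
      intro l
      by_cases hl : 0 < l
      · rw [indicator_of_mem (show l ∈ Ioi (0 : ℝ) from hl)]
        rw [packet_pos hs M l hM hl.le, Complex.norm_real, Real.norm_eq_abs, abs_of_nonneg (h0 _)]
        by_cases hm : l ∈ Icc (M ^ 2 - M) (M ^ 2 + M)
        · rw [indicator_of_mem hm]
          have hl2 : l ≤ 2 * M ^ 2 := by nlinarith [hm.2]
          have hp2 : ψ ((l - M ^ 2) / M) ^ 2 ≤ 1 := pow_le_one₀ (h0 _) (h1 _)
          have hl4 : l ^ 2 + 1 ≤ 5 * M ^ 4 := by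
            have : l ^ 2 ≤ (2 * M ^ 2) ^ 2 := by gcongr
            have : 1 ≤ M ^ 4 := one_le_pow₀ (by linarith)
            nlinarith
          calc _ ≤ (5 * M ^ 4) ^ α * 1 * (2 * M ^ 2) ^ 2 := by gcongr
            _ = _ := by ring
        · rw [indicator_of_notMem hm, hs]
          · simp
          · rw [abs_div, abs_of_pos hM0, le_div_iff₀ hM0, one_mul]
            by_contra hcon
            push Not at hcon
            have := abs_lt.1 hcon
            exact hm ⟨by linarith, by linarith⟩
      · rw [indicator_of_notMem (show l ∉ Ioi (0 : ℝ) from hl)]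
        apply indicator_nonneg
        intros; positivity
    refine integral_mono_of_nonneg (Eventually.of_forall fun l => ?_) ?_
      (Eventually.of_forall hind)
    · apply indicator_nonneg
      intros; positivity
    · rw [integrable_indicator_iff measurableSet_Icc]
      exact integrableOn_const (by simp)
  unfold sobNorm
  calc _ ≤ ((5 * M ^ 4) ^ α * (2 * M ^ 2) ^ 2 * (2 * M)) ^ ((1 : ℝ) / 2) := by
        apply Real.rpow_le_rpow _ key (by norm_num)
        apply setIntegral_nonneg measurableSet_Ioi
        intros; positivity
    _ = ((8 * 5 ^ α) * M ^ (4 * α + 5)) ^ ((1 : ℝ) / 2) := by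
        congr 1
        rw [Real.mul_rpow (by norm_num) (by positivity), Real.rpow_add hM0]
        rw [show (M ^ 4 : ℝ) = M ^ (4 : ℝ) by norm_cast, ← Real.rpow_mul hM0.le]
        rw [show (M ^ (5 : ℝ) : ℝ) = M ^ 5 by norm_cast]
        ring
    _ = _ := by
        rw [Real.mul_rpow (by positivity) (by positivity), ← Real.rpow_mul hM0.le]
        congr 2; ring

end

/-- Theorem 1.1(i) on `ℍ³`: if `α < 1/4` then the local maximal estimate fails
for every `q ∈ [1,∞]`. -/
theorem schrodinger_maximal_fails_below_quarter
    (α : ℝ) (hα0 : 0 ≤ α) (hα : α < 1 / 4) (R : ℝ) (hR : 0 < R)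
    (q : ℝ≥0∞) (hq : 1 ≤ q) :
    ¬ ∃ C : ℝ, 0 < C ∧ ∀ g : SchwartzMap ℝ ℂ, (∀ x, g (-x) = g x) →
      eLpNorm (Sstar ⇑g) q (ballMeasure R) ≤ ENNReal.ofReal (C * sobNorm α ⇑g) := by
  rintro ⟨C, hC, H⟩
  obtain ⟨ψ, hc, h0, h1, hs, hJ⟩ := exists_bump
  set J := ∫ x, ψ x with hJd
  set K := ∫ x, |deriv ψ x| with hKd
  set b := min R 1 with hb
  have hb0 : 0 < b := lt_min hR one_pos
  set A := Ioo (b / 2) b with hA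
  have hμ : ballMeasure R A ≠ 0 := by
    unfold ballMeasure
    rw [Ne, withDensity_apply_eq_zero (by fun_prop)]
    have hsub : A ⊆ ({x | ENNReal.ofReal (Real.sinh x ^ 2) ≠ 0} ∩ A) := by
      intro x hx
      refine ⟨?_, hx⟩
      have : 0 < Real.sinh x := Real.sinh_pos_iff.2 (by linarith [hx.1])
      simp only [mem_ofPred_eq, ne_eq, ENNReal.ofReal_eq_zero, not_le]
      positivity
    intro h
    have := measure_mono_null hsub h
    rw [Measure.restrict_apply measurableSet_Ioo, inter_eq_left.2, Real.volume_Ioo] at this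
    · rw [ENNReal.ofReal_eq_zero] at this; linarith
    · exact Ioo_subset_Ioo (by linarith) (min_le_left _ _)
  obtain ⟨δ, hδ, hδm⟩ : ∃ δ : ℝ, 0 < δ ∧
      ENNReal.ofReal δ ≤ (ballMeasure R A) ^ (1 / q.toReal) := by
    have hne : 0 < (ballMeasure R A) ^ (1 / q.toReal) :=
      ENNReal.rpow_pos_of_nonneg (pos_iff_ne_zero.2 hμ) (by positivity)
    obtain ⟨r, hr, hr1, hr2⟩ := ENNReal.lt_iff_exists_real_btwn.1 hne
    exact ⟨r, by simpa using hr1, hr2.le⟩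
  set D := (8 * (5 : ℝ) ^ α) ^ ((1 : ℝ) / 2) with hD
  -- main inequality for all large `M`
  have main : ∀ᶠ M : ℝ in atTop,
      M ^ 3 / (2 * Real.sinh 1) * (J / 4) * δ ≤ C * (D * M ^ (2 * α + 5 / 2)) := by
    have lim : ∀ᶠ M : ℝ in atTop, J / 4 ≤ J / 2 - 2 * J / M - (J + K) / (2 * M * (b / 2)) := by
      have : Tendsto (fun M : ℝ => J / 2 - 2 * J * M⁻¹ - (J + K) / b * M⁻¹) atTop
          (nhds (J / 2 - 2 * J * 0 - (J + K) / b * 0)) :=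
        (tendsto_const_nhds.sub (tendsto_inv_atTop_zero.const_mul _)).sub
          (tendsto_inv_atTop_zero.const_mul _)
      filter_upwards [this.eventually (eventually_ge_nhds (b := J / 4) (by linarith)),
        eventually_gt_atTop 0] with M hM hM0
      have e : (J + K) / (2 * M * (b / 2)) = (J + K) / b * M⁻¹ := by field_simp
      rw [e, div_eq_mul_inv (2 * J)]
      exact hM
    filter_upwards [lim, eventually_ge_atTop 2] with M hl hM
    have hM0 : 0 < M := by linarith
    set c := M ^ 3 / (2 * Real.sinh 1) * (J / 4) with hcd
    have hsh : 0 < Real.sinh 1 := Real.sinh_pos_iff.2 one_pos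
    have hc0 : 0 < c := by positivity
    have hH := H ((packet_hcs hs M hM).toSchwartzMap (packet_cd hc M)) (packet_neg ψ M)
    change eLpNorm (Sstar (packet ψ M)) q (ballMeasure R) ≤
      ENNReal.ofReal (C * sobNorm α (packet ψ M)) at hH
    have hpt : ∀ s, ‖A.indicator (fun _ => c) s‖ ≤ ‖Sstar (packet ψ M) s‖ := by
      intro s
      by_cases hsA : s ∈ A
      · rw [indicator_of_mem hsA, Real.norm_eq_abs, abs_of_pos hc0]
        refine le_trans ?_ (le_abs_self _)
        have hs1 : s ≤ 1 := hsA.2.le.trans (min_le_right _ _)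
        have hs0 : 0 < s := by linarith [hsA.1]
        have l1 := Sprop_lower hc h0 hs M s (b / 2) hM (by positivity) hsA.1.le hs1
        rw [max_eq_right (norm_nonneg _)] at l1
        have l2 := Sstar_ge hc hs M s (s / (2 * M ^ 2)) hM
          ⟨by positivity, by rw [div_lt_one (by positivity)]; nlinarith⟩
        refine le_trans ?_ (l1.trans l2)
        rw [hcd]
        gcongr
      · rw [indicator_of_notMem hsA]; simp
    have h2 := eLpNorm_mono (p := q) (μ := ballMeasure R) hpt
    rw [eLpNorm_indicator_const' measurableSet_Ioo hμ (by positivity)] at h2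
    have h3 : ENNReal.ofReal (c * δ) ≤ ENNReal.ofReal (C * (D * M ^ (2 * α + 5 / 2))) := by
      rw [ENNReal.ofReal_mul hc0.le]
      calc _ ≤ ‖c‖ₑ * (ballMeasure R A) ^ (1 / q.toReal) := by
            rw [Real.enorm_eq_ofReal hc0.le]; gcongr
        _ ≤ _ := h2.trans (hH.trans (ENNReal.ofReal_le_ofReal (by
            gcongr; exact sob_le α hα0 h0 h1 hs M hM)))
    exact (ENNReal.ofReal_le_ofReal_iff (by positivity)).1 h3
  have hsh : 0 < Real.sinh 1 := Real.sinh_pos_iff.2 one_pos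
  have hlim := tendsto_rpow_atTop (y := 1 / 2 - 2 * α) (by linarith)
  set κ := 1 / (2 * Real.sinh 1) * (J / 4) * δ with hκ
  have hκ0 : 0 < κ := by positivity
  obtain ⟨M, m1, m2, m3⟩ := (main.and ((hlim.eventually_gt_atTop (C * D / κ)).and
    (eventually_gt_atTop 0))).exists
  rw [div_lt_iff₀ hκ0] at m2
  have e : M ^ 3 = M ^ (1 / 2 - 2 * α) * M ^ (2 * α + 5 / 2) := by
    rw [← Real.rpow_add m3, ← Real.rpow_natCast]; congr 1; push_cast; ring
  have e2 : M ^ 3 / (2 * Real.sinh 1) * (J / 4) * δ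
      = M ^ (1 / 2 - 2 * α) * κ * M ^ (2 * α + 5 / 2) := by
    rw [e, hκ]; ring
  rw [e2] at m1
  have : 0 < M ^ (2 * α + 5 / 2) := by positivity
  nlinarith
end

section
/- (Theorem 1.1(ii) on ℍ³, sufficiency.) Let 1/4 ≤ α < 3/2 and 1 ≤ q ≤ 6/(3−2α). Then for every R > 0 there is a constant C > 0 (depending only on α, q and R) such that ‖S*g‖_{L^q(B_R)} ≤ C ‖g‖_{H^α} for all even Schwartz functions g : ℝ → ℂ. -/
open MeasureTheory Filter Set ENNReal

lemma osc_ibp {a b M : ℝ} (hab : a ≤ b) (_hM : 0 ≤ M) {P P' : ℝ → ℂ} {u u' : ℝ → ℝ}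
    (hP : ∀ x ∈ Icc a b, HasDerivAt P (P' x) x) (hP' : ContinuousOn P' (Icc a b))
    (hPM : ∀ x ∈ Icc a b, ‖P x‖ ≤ M)
    (hu : ∀ x ∈ Icc a b, HasDerivAt u (u' x) x) (hu' : ContinuousOn u' (Icc a b)) :
    ‖∫ x in a..b, (u x : ℂ) * P' x‖ ≤ M * (|u a| + |u b| + ∫ x in a..b, |u' x|) := by
  rw [← uIcc_of_le hab] at *
  have hu'i : IntervalIntegrable u' volume a b := hu'.intervalIntegrable
  have h := intervalIntegral.integral_mul_deriv_eq_deriv_mul (u := fun x => (u x : ℂ))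
    (u' := fun x => (u' x : ℂ)) (v := P) (v' := P') (a := a) (b := b)
    (fun x hx => (hu x hx).ofReal_comp) hP
    (Complex.continuous_ofReal.comp_continuousOn hu').intervalIntegrable hP'.intervalIntegrable
  rw [h]
  have e1 : ‖(u b : ℂ) * P b‖ ≤ M * |u b| := by
    rw [norm_mul, Complex.norm_real, Real.norm_eq_abs, mul_comm]
    exact mul_le_mul_of_nonneg_right (hPM b (by simp)) (abs_nonneg _)
  have e2 : ‖(u a : ℂ) * P a‖ ≤ M * |u a| := by
    rw [norm_mul, Complex.norm_real, Real.norm_eq_abs, mul_comm]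
    exact mul_le_mul_of_nonneg_right (hPM a (by simp)) (abs_nonneg _)
  have e3 : ‖∫ x in a..b, (u' x : ℂ) * P x‖ ≤ M * ∫ x in a..b, |u' x| := by
    rw [← intervalIntegral.integral_const_mul]
    apply intervalIntegral.norm_integral_le_of_norm_le hab
    · refine Filter.Eventually.of_forall fun x hx => ?_
      rw [norm_mul, Complex.norm_real, Real.norm_eq_abs, mul_comm]
      refine mul_le_mul_of_nonneg_right (hPM x ?_) (abs_nonneg _)
      rw [uIcc_of_le hab]; exact Ioc_subset_Icc_self hx
    · exact (hu'i.abs).const_mul M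
  calc _ ≤ ‖(u b : ℂ) * P b‖ + ‖(u a : ℂ) * P a‖ + ‖∫ x in a..b, (u' x : ℂ) * P x‖ :=
        (norm_sub_le _ _).trans (by gcongr; exact norm_sub_le _ _)
    _ ≤ _ := by nlinarith

lemma osc_ibp_mono {a b M : ℝ} (hab : a ≤ b) (hM : 0 ≤ M) {P P' : ℝ → ℂ} {u u' : ℝ → ℝ}
    (hP : ∀ x ∈ Icc a b, HasDerivAt P (P' x) x) (hP' : ContinuousOn P' (Icc a b))
    (hPM : ∀ x ∈ Icc a b, ‖P x‖ ≤ M)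
    (hu : ∀ x ∈ Icc a b, HasDerivAt u (u' x) x) (hu' : ContinuousOn u' (Icc a b))
    (hs : (∀ x ∈ Icc a b, 0 ≤ u' x) ∨ (∀ x ∈ Icc a b, u' x ≤ 0)) :
    ‖∫ x in a..b, (u x : ℂ) * P' x‖ ≤ 2 * M * (|u a| + |u b|) := by
  refine (osc_ibp hab hM hP hP' hPM hu hu').trans ?_
  have hu_int : ∫ x in a..b, u' x = u b - u a := by
    apply intervalIntegral.integral_eq_sub_of_hasDerivAt
    · rwa [uIcc_of_le hab]
    · rw [← uIcc_of_le hab] at hu'; exact hu'.intervalIntegrable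
  have : ∫ x in a..b, |u' x| ≤ |u a| + |u b| := by
    rcases hs with hs | hs
    · rw [intervalIntegral.integral_congr (g := u'), hu_int]
      · linarith [le_abs_self (u b), neg_abs_le (u a)]
      · intro x hx; rw [uIcc_of_le hab] at hx; exact abs_of_nonneg (hs x hx)
    · rw [intervalIntegral.integral_congr (g := fun x => - u' x), intervalIntegral.integral_neg, hu_int]
      · linarith [le_abs_self (u a), neg_abs_le (u b)]
      · intro x hx; rw [uIcc_of_le hab] at hx; exact abs_of_nonpos (hs x hx)
  nlinarith

/-- quartic phase piece -/
lemma quartic_piece {t a b c : ℝ} (hab : a ≤ b) (hc : 0 < c)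
    (hn : (∀ v ∈ Icc a b, c ≤ v + 2 * t * v ^ 3) ∨ (∀ v ∈ Icc a b, v + 2 * t * v ^ 3 ≤ -c))
    (hs : (∀ v ∈ Icc a b, 0 ≤ 1 + 6 * t * v ^ 2) ∨ (∀ v ∈ Icc a b, 1 + 6 * t * v ^ 2 ≤ 0)) :
    ‖∫ v in a..b, Complex.exp (Complex.I * ((v ^ 2 + t * v ^ 4 : ℝ) : ℂ))‖ ≤ 2 / c := by
  have hn0 : ∀ v ∈ Icc a b, c ≤ |v + 2 * t * v ^ 3| := by
    intro v hv
    rcases hn with h | h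
    · exact (h v hv).trans (le_abs_self _)
    · exact (by linarith [h v hv] : c ≤ -(v + 2 * t * v ^ 3)).trans (neg_le_abs _)
  have hne : ∀ v ∈ Icc a b, v + 2 * t * v ^ 3 ≠ 0 := by
    intro v hv h0; have := hn0 v hv; rw [h0] at this; simp at this; linarith
  set u : ℝ → ℝ := fun v => (2 * (v + 2 * t * v ^ 3))⁻¹ with hu
  set u' : ℝ → ℝ := fun v => -(2 * (1 + 6 * t * v ^ 2)) / (2 * (v + 2 * t * v ^ 3)) ^ 2 with hu'
  set P : ℝ → ℂ := fun v => -Complex.I * Complex.exp (Complex.I * ((v ^ 2 + t * v ^ 4 : ℝ) : ℂ)) with hP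
  set P' : ℝ → ℂ := fun v => ((2 * (v + 2 * t * v ^ 3) : ℝ) : ℂ) *
    Complex.exp (Complex.I * ((v ^ 2 + t * v ^ 4 : ℝ) : ℂ)) with hP'
  have hPd : ∀ x ∈ Icc a b, HasDerivAt P (P' x) x := by
    intro x _
    have h1 : HasDerivAt (fun v : ℝ => v ^ 2 + t * v ^ 4) (2 * (x + 2 * t * x ^ 3)) x := by
      have := (hasDerivAt_pow 2 x).add ((hasDerivAt_pow 4 x).const_mul t)
      exact this.congr_deriv (by push_cast; ring)
    have h2 := ((h1.ofReal_comp.const_mul Complex.I).cexp).const_mul (-Complex.I)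
    refine h2.congr_deriv ?_
    have hI : -Complex.I * Complex.I = 1 := by simp
    rw [hP']; simp only
    linear_combination (((2 * (x + 2 * t * x ^ 3) : ℝ) : ℂ) *
      Complex.exp (Complex.I * ((x ^ 2 + t * x ^ 4 : ℝ) : ℂ))) * hI
  have hud : ∀ x ∈ Icc a b, HasDerivAt u (u' x) x := by
    intro x hx
    have h1 : HasDerivAt (fun v : ℝ => 2 * (v + 2 * t * v ^ 3)) (2 * (1 + 6 * t * x ^ 2)) x := by
      have := ((hasDerivAt_id x).add ((hasDerivAt_pow 3 x).const_mul (2 * t))).const_mul 2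
      exact this.congr_deriv (by push_cast; ring)
    exact h1.inv (mul_ne_zero two_ne_zero (hne x hx))
  have hP'c : ContinuousOn P' (Icc a b) := by
    apply Continuous.continuousOn; rw [hP']; fun_prop
  have hu'c : ContinuousOn u' (Icc a b) := by
    apply ContinuousOn.div
    · fun_prop
    · fun_prop
    · intro x hx; exact pow_ne_zero 2 (mul_ne_zero two_ne_zero (hne x hx))
  have hPn : ∀ x ∈ Icc a b, ‖P x‖ ≤ 1 := by
    intro x _
    rw [hP]; simp only [norm_mul, norm_neg, Complex.norm_I, one_mul]
    rw [mul_comm, Complex.norm_exp_ofReal_mul_I]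
  have hsu : (∀ x ∈ Icc a b, 0 ≤ u' x) ∨ (∀ x ∈ Icc a b, u' x ≤ 0) := by
    rcases hs with h | h
    · right; intro x hx; apply div_nonpos_of_nonpos_of_nonneg _ (sq_nonneg _); linarith [h x hx]
    · left; intro x hx; apply div_nonneg _ (sq_nonneg _); linarith [h x hx]
  have key := osc_ibp_mono hab zero_le_one hPd hP'c hPn hud hu'c hsu
  have hub : ∀ x ∈ Icc a b, |u x| ≤ (2 * c)⁻¹ := by
    intro x hx
    rw [hu]; simp only [abs_inv, abs_mul, abs_two]
    gcongr
    exact hn0 x hx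
  have e : ∫ v in a..b, Complex.exp (Complex.I * ((v ^ 2 + t * v ^ 4 : ℝ) : ℂ))
      = ∫ x in a..b, (u x : ℂ) * P' x := by
    apply intervalIntegral.integral_congr
    intro x hx; rw [uIcc_of_le hab] at hx
    simp only [hu, hP']
    rw [← mul_assoc, ← Complex.ofReal_mul, inv_mul_cancel₀ (mul_ne_zero two_ne_zero (hne x hx))]
    simp
  rw [e]
  refine key.trans ?_
  have h1 := hub a (left_mem_Icc.2 hab)
  have h2 := hub b (right_mem_Icc.2 hab)
  have : (2 / c) = 4 * (2 * c)⁻¹ := by field_simp; norm_num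
  rw [this]; linarith

lemma quartic_triv {t a b : ℝ} (hab : a ≤ b) :
    ‖∫ v in a..b, Complex.exp (Complex.I * ((v ^ 2 + t * v ^ 4 : ℝ) : ℂ))‖ ≤ b - a := by
  have := intervalIntegral.norm_integral_le_of_norm_le_const (a := a) (b := b) (C := 1)
    (f := fun v : ℝ => Complex.exp (Complex.I * ((v ^ 2 + t * v ^ 4 : ℝ) : ℂ))) (by
      intro x _; rw [mul_comm, Complex.norm_exp_ofReal_mul_I])
  rwa [abs_of_nonneg (by linarith), one_mul] at this

/-- chaining bounds -/
lemma chain_bound {E : ℝ → ℂ} (hE : Continuous E) {a b A B : ℝ} (hab : a ≤ b)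
    (h1 : ∀ V, a ≤ V → V ≤ b → ‖∫ v in a..V, E v‖ ≤ A)
    (h2 : ∀ V, b ≤ V → ‖∫ v in b..V, E v‖ ≤ B) (hB : 0 ≤ B) :
    ∀ V, a ≤ V → ‖∫ v in a..V, E v‖ ≤ A + B := by
  intro V hV
  rcases le_total V b with h | h
  · linarith [h1 V hV h]
  · rw [← intervalIntegral.integral_add_adjacent_intervals (hE.intervalIntegrable a b)
      (hE.intervalIntegrable b V)]
    exact (norm_add_le _ _).trans (add_le_add (h1 b hab le_rfl) (h2 V h))

lemma quartic_bound (t : ℝ) : ∀ V : ℝ, 0 ≤ V →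
    ‖∫ v in (0:ℝ)..V, Complex.exp (Complex.I * ((v ^ 2 + t * v ^ 4 : ℝ) : ℂ))‖ ≤ 20 := by
  have hE : Continuous fun v : ℝ => Complex.exp (Complex.I * ((v ^ 2 + t * v ^ 4 : ℝ) : ℂ)) := by
    fun_prop
  rcases le_or_gt 0 t with ht | ht
  · have := chain_bound hE (a := 0) (b := 1) (A := 1) (B := 2) zero_le_one
      (fun V h0 h1 => (quartic_triv h0).trans (by linarith))
      (fun V h1 => by
        have := quartic_piece (t := t) (c := 1) h1 one_pos
          (Or.inl fun v hv => by have : 0 ≤ 2 * t * v ^ 3 := by have := hv.1; positivity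
                                 linarith [hv.1])
          (Or.inl fun v hv => by positivity)
        linarith) zero_le_two
    intro V hV; linarith [this V hV]
  ·
    obtain ⟨p, hp, htp⟩ : ∃ p : ℝ, 0 < p ∧ 2 * t * p ^ 2 = -1 := by
      refine ⟨(Real.sqrt (-2 * t))⁻¹, by have : 0 < -2 * t := by linarith
                                         positivity, ?_⟩
      rw [inv_pow, Real.sq_sqrt (by linarith)]
      have : t ≠ 0 := ht.ne
      field_simp
    have ht' : t = -1 / (2 * p ^ 2) := by field_simp; linarith
    have htail : ∀ d : ℝ, 1 ≤ d → ∀ V, p + d ≤ V →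
        ‖∫ v in (p + d)..V, Complex.exp (Complex.I * ((v ^ 2 + t * v ^ 4 : ℝ) : ℂ))‖ ≤ 2 := by
      intro d hd V hV
      have := quartic_piece (t := t) (c := 1) hV one_pos
          (Or.inr fun v hv => by
            have h1 : p + 1 ≤ v := by linarith [hv.1]
            have e : v + 2 * t * v ^ 3 = - (v * (v ^ 2 - p ^ 2) / p ^ 2) := by
              rw [ht']; field_simp; ring
            rw [e, neg_le_neg_iff, le_div_iff₀ (by positivity)]
            have h2 : (2 * p) ≤ v ^ 2 - p ^ 2 := by nlinarith
            have h3 : p * (2 * p) ≤ v * (v ^ 2 - p ^ 2) := by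
              apply mul_le_mul <;> nlinarith
            nlinarith)
          (Or.inr fun v hv => by
            have h1 : p ≤ v := by linarith [hv.1]
            have h2 : p ^ 2 ≤ v ^ 2 := by gcongr
            nlinarith)
      linarith
    rcases le_or_gt p 3 with h3 | h3
    · have := chain_bound hE (a := 0) (b := p + 1) (A := 4) (B := 2) (by positivity)
        (fun V h0 h1 => (quartic_triv h0).trans (by linarith)) (htail 1 le_rfl) zero_le_two
      intro V hV; linarith [this V hV]
    ·
      obtain ⟨r, hr, hrp⟩ : ∃ r : ℝ, 0 < r ∧ 3 * r ^ 2 = p ^ 2 := by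
        refine ⟨p / Real.sqrt 3, by positivity, ?_⟩
        rw [div_pow, Real.sq_sqrt (by norm_num)]; field_simp
      have hr1 : 1 ≤ r := by nlinarith
      have hr2 : r ≤ p - 1 := by
        by_contra h; push Not at h; nlinarith
      have he : ∀ v : ℝ, v + 2 * t * v ^ 3 = v * (p ^ 2 - v ^ 2) / p ^ 2 := by
        intro v; rw [ht']; field_simp; ring
      have c4 := chain_bound hE (a := p - 1) (b := p + 1) (A := 2) (B := 2) (by linarith)
        (fun V h0 h1 => (quartic_triv h0).trans (by linarith)) (htail 1 le_rfl) zero_le_two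
      have c3 := chain_bound hE (a := r) (b := p - 1) (A := 4) (B := 2 + 2) hr2
        (fun V h0 h1 => by
          have := quartic_piece (t := t) (c := 1/2) h0 (by norm_num)
            (Or.inl fun v hv => by
              have h1 : r ≤ v := hv.1
              have h2 : v ≤ p - 1 := by linarith [hv.2]
              have h5 : p ≤ 2 * r := by nlinarith
              rw [he, le_div_iff₀ (by positivity)]
              have h4 : p ≤ p ^ 2 - v ^ 2 := by nlinarith
              nlinarith [mul_le_mul (h5.trans (by linarith : 2 * r ≤ 2 * v)) h4 hp.le (by linarith)])
            (Or.inr fun v hv => by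
              have h2 : r ^ 2 ≤ v ^ 2 := by gcongr; exact hv.1
              nlinarith)
          linarith) c4 (by norm_num)
      have c2 := chain_bound hE (a := 1) (b := r) (A := 4) (B := 4 + (2 + 2)) hr1
        (fun V h0 h1 => by
          have := quartic_piece (t := t) (c := 1/2) h0 (by norm_num)
            (Or.inl fun v hv => by
              have h1 : 1 ≤ v := hv.1
              have h2 : v ^ 2 ≤ r ^ 2 := by gcongr; linarith [hv.2]
              rw [he, le_div_iff₀ (by positivity)]
              have h4 : 2 / 3 * p ^ 2 ≤ p ^ 2 - v ^ 2 := by nlinarith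
              nlinarith [mul_le_mul h1 h4 (by positivity) (by linarith)])
            (Or.inl fun v hv => by
              have h2 : v ^ 2 ≤ r ^ 2 := by gcongr; linarith [hv.1]; linarith [hv.2]
              nlinarith)
          linarith) c3 (by norm_num)
      have c1 := chain_bound hE (a := 0) (b := 1) (A := 1) (B := 4 + (4 + (2 + 2))) zero_le_one
        (fun V h0 h1 => (quartic_triv h0).trans (by linarith)) c2 (by norm_num)
      intro V hV; linarith [c1 V hV]

lemma quartic_bound_pos (x t V : ℝ) (hx : 0 < x) (hV : 0 ≤ V) :
    ‖∫ v in (0:ℝ)..V, Complex.exp (Complex.I * ((x * v ^ 2 + t * v ^ 4 : ℝ) : ℂ))‖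
      ≤ 20 * (Real.sqrt |x|)⁻¹ := by
  rw [abs_of_pos hx]
  have hs : 0 < Real.sqrt x := Real.sqrt_pos.2 hx
  have h := quartic_bound (t / x ^ 2) (V * Real.sqrt x) (by positivity)
  have e := intervalIntegral.smul_integral_comp_mul_right (a := 0) (b := V)
    (fun v : ℝ => Complex.exp (Complex.I * ((v ^ 2 + (t / x ^ 2) * v ^ 4 : ℝ) : ℂ))) (Real.sqrt x)
  rw [zero_mul] at e
  rw [← e, norm_smul, Real.norm_eq_abs, abs_of_pos hs] at h
  have e2 : ∀ v : ℝ, (v * Real.sqrt x) ^ 2 + (t / x ^ 2) * (v * Real.sqrt x) ^ 4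
      = x * v ^ 2 + t * v ^ 4 := by
    intro v
    have : (Real.sqrt x) ^ 2 = x := Real.sq_sqrt hx.le
    rw [mul_pow, mul_pow, show (Real.sqrt x) ^ 4 = ((Real.sqrt x) ^ 2) ^ 2 by ring, this]
    field_simp
  simp only [e2] at h
  rw [← div_eq_mul_inv, le_div_iff₀ hs, mul_comm]
  exact h

lemma quartic_bound_ne (x t V : ℝ) (hx : x ≠ 0) (hV : 0 ≤ V) :
    ‖∫ v in (0:ℝ)..V, Complex.exp (Complex.I * ((x * v ^ 2 + t * v ^ 4 : ℝ) : ℂ))‖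
      ≤ 20 * (Real.sqrt |x|)⁻¹ := by
  rcases lt_or_gt_of_ne hx with h | h
  · have := quartic_bound_pos (-x) (-t) V (by linarith) hV
    rw [abs_neg, ← Complex.norm_conj, ← intervalIntegral.intervalIntegral_conj] at this
    have e : ∀ v : ℝ, (starRingEnd ℂ) (Complex.exp (Complex.I * ((-x * v ^ 2 + -t * v ^ 4 : ℝ) : ℂ)))
        = Complex.exp (Complex.I * ((x * v ^ 2 + t * v ^ 4 : ℝ) : ℂ)) := by
      intro v
      rw [← Complex.exp_conj, map_mul, Complex.conj_I, Complex.conj_ofReal]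
      congr 1; push_cast; ring
    simp only [e] at this
    exact this
  · exact quartic_bound_pos x t V h hV

/-- oscillatory integral with weight `λ^{-1/2}` -/
lemma osc_half {x t a b : ℝ} (hx : x ≠ 0) (ha : 0 < a) (hab : a ≤ b) {u u' : ℝ → ℝ}
    (hu : ∀ l ∈ Icc a b, HasDerivAt u (u' l) l) (hu' : ContinuousOn u' (Icc a b)) :
    ‖∫ l in a..b, (u l : ℂ) * (((Real.sqrt l)⁻¹ : ℝ) *
      Complex.exp (Complex.I * ((x * l + t * l ^ 2 : ℝ) : ℂ)))‖
      ≤ 40 * (Real.sqrt |x|)⁻¹ * (|u a| + |u b| + ∫ l in a..b, |u' l|) := by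
  set E : ℝ → ℂ := fun v => Complex.exp (Complex.I * ((x * v ^ 2 + t * v ^ 4 : ℝ) : ℂ)) with hE
  have hEc : Continuous E := by rw [hE]; fun_prop
  apply osc_ibp hab (by positivity) (P := fun l => 2 * ∫ v in (0:ℝ)..(Real.sqrt l), E v) _ _ _ hu hu'
  · intro l hl
    have hl0 : 0 < l := lt_of_lt_of_le ha hl.1
    have h1 : HasDerivAt (fun w : ℝ => ∫ v in (0:ℝ)..w, E v) (E (Real.sqrt l)) (Real.sqrt l) :=
      intervalIntegral.integral_hasDerivAt_right (hEc.intervalIntegrable _ _)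
        (hEc.stronglyMeasurableAtFilter _ _) hEc.continuousAt
    have h2 := (h1.scomp l (Real.hasDerivAt_sqrt hl0.ne')).const_mul 2
    refine h2.congr_deriv ?_
    have hs : (Real.sqrt l) ^ 2 = l := Real.sq_sqrt hl0.le
    simp only [hE]
    rw [show (Real.sqrt l) ^ 4 = ((Real.sqrt l) ^ 2) ^ 2 by ring, hs, Complex.real_smul]
    push_cast
    have : ((Real.sqrt l : ℝ) : ℂ) ≠ 0 := by
      exact_mod_cast (Real.sqrt_pos.2 hl0).ne'
    field_simp
  · apply ContinuousOn.mul
    · apply Complex.continuous_ofReal.comp_continuousOn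
      apply ContinuousOn.inv₀ (by fun_prop)
      intro l hl; exact (Real.sqrt_pos.2 (lt_of_lt_of_le ha hl.1)).ne'
    · fun_prop
  · intro l hl
    rw [norm_mul, Complex.norm_ofNat]
    linarith [quartic_bound_ne x t (Real.sqrt l) hx (Real.sqrt_nonneg _)]

lemma osc_low {c s' x t a b : ℝ} (hc0 : 0 ≤ c) (hc1 : c < 1) (hs' : 0 < s') (hx : x ≠ 0)
    (ha : 0 < a) (hab : a ≤ b) (hb : b ≤ 1 / s') :
    ‖∫ l in a..b, ((Real.sin (l * s') * l ^ (-c) : ℝ) : ℂ) * (((Real.sqrt l)⁻¹ : ℝ) *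
      Complex.exp (Complex.I * ((x * l + t * l ^ 2 : ℝ) : ℂ)))‖
      ≤ 40 * (Real.sqrt |x|)⁻¹ * ((2 + 2 / (1 - c)) * s' ^ c) := by
  have hpos : ∀ l ∈ Icc a b, 0 < l := fun l hl => lt_of_lt_of_le ha hl.1
  have key := osc_half (x := x) (t := t) hx ha hab (u := fun l => Real.sin (l * s') * l ^ (-c))
    (u' := fun l => Real.cos (l * s') * s' * l ^ (-c) + Real.sin (l * s') * (-c * l ^ (-c - 1)))
    (by
      intro l hl
      have h1 : HasDerivAt (fun l : ℝ => l * s') s' l := by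
        simpa using (hasDerivAt_id l).mul_const s'
      exact h1.sin.mul (Real.hasDerivAt_rpow_const (Or.inl (hpos l hl).ne')))
    (by
      have h1 : ContinuousOn (fun l : ℝ => l ^ (-c)) (Icc a b) :=
        continuousOn_id.rpow_const fun l hl => Or.inl (hpos l hl).ne'
      have h2 : ContinuousOn (fun l : ℝ => l ^ (-c - 1)) (Icc a b) :=
        continuousOn_id.rpow_const fun l hl => Or.inl (hpos l hl).ne'
      fun_prop)
  refine key.trans ?_
  have hsin : ∀ l, 0 < l → |Real.sin (l * s')| ≤ l * s' := fun l hl => by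
    have h0 : 0 < l * s' := by positivity
    exact Real.abs_sin_le_abs.trans_eq (abs_of_pos h0)
  have hcs : ∀ l, 0 < l → l ≤ 1 / s' → l * s' * l ^ (-c) ≤ s' ^ c := by
    intro l hl hl2
    have : l * s' * l ^ (-c) = (l * s') ^ (1 - c) * s' ^ c := by
      rw [Real.mul_rpow hl.le hs'.le, mul_assoc (l ^ (1 - c)), ← Real.rpow_add hs', sub_add_cancel, Real.rpow_one,
        show (1 - c) = 1 + (-c) by ring, Real.rpow_add hl, Real.rpow_one]; ring
    rw [this]
    have h1 : (l * s') ^ (1 - c) ≤ 1 := by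
      apply Real.rpow_le_one (by positivity) _ (by linarith)
      rwa [le_div_iff₀ hs'] at hl2
    have : 0 ≤ s' ^ c := by positivity
    nlinarith
  have hu : ∀ l, 0 < l → l ≤ 1 / s' → |Real.sin (l * s') * l ^ (-c)| ≤ s' ^ c := by
    intro l hl hl2
    rw [abs_mul, abs_of_nonneg (by positivity : 0 ≤ l ^ (-c))]
    exact (mul_le_mul_of_nonneg_right (hsin l hl) (by positivity)).trans (hcs l hl hl2)
  have h1 := hu a ha (hab.trans hb)
  have h2 := hu b (ha.trans_le hab) hb
  have h3 : ∫ l in a..b, |Real.cos (l * s') * s' * l ^ (-c) + Real.sin (l * s') * (-c * l ^ (-c - 1))|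
      ≤ 2 / (1 - c) * s' ^ c := by
    calc _ ≤ ∫ l in a..b, 2 * s' * l ^ (-c) := by
          apply intervalIntegral.integral_mono_on hab
          · apply ContinuousOn.intervalIntegrable
            rw [uIcc_of_le hab]
            have h1 : ContinuousOn (fun l : ℝ => l ^ (-c)) (Icc a b) :=
              continuousOn_id.rpow_const fun l hl => Or.inl (hpos l hl).ne'
            have h2 : ContinuousOn (fun l : ℝ => l ^ (-c - 1)) (Icc a b) :=
              continuousOn_id.rpow_const fun l hl => Or.inl (hpos l hl).ne'
            fun_prop
          · apply ContinuousOn.intervalIntegrable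
            rw [uIcc_of_le hab]
            have h1 : ContinuousOn (fun l : ℝ => l ^ (-c)) (Icc a b) :=
              continuousOn_id.rpow_const fun l hl => Or.inl (hpos l hl).ne'
            fun_prop
          · intro l hl
            have hl0 := hpos l hl
            have hp : 0 < l ^ (-c) := by positivity
            have e : l ^ (-c - 1) = l ^ (-c) / l := by rw [Real.rpow_sub hl0, Real.rpow_one]
            refine (abs_add_le _ _).trans ?_
            rw [abs_mul, abs_mul, abs_mul, abs_mul, abs_of_pos hs', abs_of_pos hp, e,
              abs_of_pos (by positivity : 0 < l ^ (-c) / l), abs_neg, abs_of_nonneg hc0]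
            have i1 : |Real.cos (l * s')| * s' * l ^ (-c) ≤ 1 * s' * l ^ (-c) := by
              gcongr; exact Real.abs_cos_le_one _
            have i2 : |Real.sin (l * s')| * (c * (l ^ (-c) / l)) ≤ (l * s') * (1 * (l ^ (-c) / l)) := by
              gcongr
              exact hsin l hl0
            have i3 : (l * s') * (1 * (l ^ (-c) / l)) = s' * l ^ (-c) := by field_simp
            linarith
      _ = 2 * s' * ((b ^ (1 - c) - a ^ (1 - c)) / (1 - c)) := by
          rw [intervalIntegral.integral_const_mul, integral_rpow (Or.inl (by linarith))]
          rw [show -c + 1 = 1 - c by ring]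
      _ ≤ 2 * s' * (b ^ (1 - c) / (1 - c)) := by
          have : 0 < 1 - c := by linarith
          gcongr
          have : 0 ≤ a ^ (1 - c) := by positivity
          linarith
      _ = 2 / (1 - c) * (b * s' * b ^ (-c)) := by
          have hb0 : 0 < b := ha.trans_le hab
          rw [show (1 - c) = 1 + (-c) by ring, Real.rpow_add hb0, Real.rpow_one]; ring
      _ ≤ _ := by
          have : 0 < 1 - c := by linarith
          gcongr
          exact hcs b (ha.trans_le hab) hb
  gcongr
  rw [add_mul]
  linarith

lemma osc_high {c s' x t a b : ℝ} (hc0 : 0 ≤ c) (hs' : 0 < s') (hx : x ≠ 0)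
    (ha : 1 / s' ≤ a) (hab : a ≤ b) :
    ‖∫ l in a..b, ((l ^ (-c) : ℝ) : ℂ) * (((Real.sqrt l)⁻¹ : ℝ) *
      Complex.exp (Complex.I * ((x * l + t * l ^ 2 : ℝ) : ℂ)))‖
      ≤ 40 * (Real.sqrt |x|)⁻¹ * (2 * s' ^ c) := by
  have ha0 : 0 < a := lt_of_lt_of_le (by positivity) ha
  have hpos : ∀ l ∈ Icc a b, 0 < l := fun l hl => lt_of_lt_of_le ha0 hl.1
  have hd : ∀ l ∈ Icc a b, HasDerivAt (fun l : ℝ => l ^ (-c)) (-c * l ^ (-c - 1)) l := fun l hl =>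
    Real.hasDerivAt_rpow_const (Or.inl (hpos l hl).ne')
  have hco : ContinuousOn (fun l : ℝ => -c * l ^ (-c - 1)) (Icc a b) := by
    have h2 : ContinuousOn (fun l : ℝ => l ^ (-c - 1)) (Icc a b) :=
        continuousOn_id.rpow_const fun l hl => Or.inl (hpos l hl).ne'
    fun_prop
  have key := osc_half (x := x) (t := t) hx ha0 hab hd hco
  refine key.trans ?_
  have h3 : ∫ l in a..b, |(-c * l ^ (-c - 1))| = a ^ (-c) - b ^ (-c) := by
    rw [intervalIntegral.integral_congr (g := fun l => - (-c * l ^ (-c - 1)))]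
    · rw [intervalIntegral.integral_neg, intervalIntegral.integral_eq_sub_of_hasDerivAt
        (f := fun l : ℝ => l ^ (-c))]
      · ring
      · rwa [uIcc_of_le hab]
      · apply ContinuousOn.intervalIntegrable; rwa [uIcc_of_le hab]
    · intro l hl; rw [uIcc_of_le hab] at hl
      have := hpos l hl
      apply abs_of_nonpos
      have : 0 ≤ l ^ (-c - 1) := by positivity
      nlinarith
  have hb0 : 0 < b := ha0.trans_le hab
  rw [h3, abs_of_pos (Real.rpow_pos_of_pos ha0 _), abs_of_pos (Real.rpow_pos_of_pos hb0 _)]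
  have : a ^ (-c) ≤ s' ^ c := by
    rw [Real.rpow_neg ha0.le, ← Real.inv_rpow ha0.le]
    apply Real.rpow_le_rpow (by positivity) _ hc0
    rw [inv_le_comm₀ ha0 hs']; simpa using ha
  gcongr
  linarith

lemma kernel_osc {α s s' t a b : ℝ} (h1 : 1 / 4 ≤ α) (h2 : α < 3 / 4) (hs' : 0 < s') (hs : s' < s)
    (ha : 0 < a) (hab : a ≤ b) :
    ‖∫ l in a..b, ((Real.sin (l * s) * Real.sin (l * s') * l ^ (-(2 * α)) : ℝ) : ℂ) *
      Complex.exp (Complex.I * ((t * l ^ 2 : ℝ) : ℂ))‖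
      ≤ (160 + 80 / (3 / 2 - 2 * α)) * (s' ^ (2 * α - 1 / 2) * (Real.sqrt (s - s'))⁻¹) := by
  set c := 2 * α - 1 / 2 with hc
  have hc0 : 0 ≤ c := by linarith
  have hc1 : c < 1 := by linarith
  have hs0 : 0 < s := hs'.trans hs
  have hd : 0 < s - s' := by linarith
  have hc2 : 3 / 2 - 2 * α = 1 - c := by linarith
  rw [hc2]
  set F : ℝ → ℂ := fun l => ((Real.sin (l * s) * Real.sin (l * s') * l ^ (-(2 * α)) : ℝ) : ℂ) *
      Complex.exp (Complex.I * ((t * l ^ 2 : ℝ) : ℂ)) with hF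
  have hFc : ∀ a b : ℝ, 0 < a → a ≤ b → ContinuousOn F (uIcc a b) := by
    intro a b ha hab
    rw [uIcc_of_le hab]
    have : ContinuousOn (fun l : ℝ => l ^ (-(2 * α))) (Icc a b) :=
        continuousOn_id.rpow_const fun l hl => Or.inl (lt_of_lt_of_le ha hl.1).ne'
    rw [hF]; fun_prop
  have hE : ∀ (x : ℝ) (p : ℝ → ℝ), Continuous p → ∀ a b : ℝ, 0 < a → a ≤ b →
      IntervalIntegrable (fun l => ((p l * l ^ (-c) : ℝ) : ℂ) * (((Real.sqrt l)⁻¹ : ℝ) *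
      Complex.exp (Complex.I * ((x * l + t * l ^ 2 : ℝ) : ℂ)))) volume a b := by
    intro x p hp a b ha hab
    apply ContinuousOn.intervalIntegrable
    rw [uIcc_of_le hab]
    have h1 : ContinuousOn (fun l : ℝ => l ^ (-c)) (Icc a b) :=
        continuousOn_id.rpow_const fun l hl => Or.inl (lt_of_lt_of_le ha hl.1).ne'
    have h2 : ContinuousOn (fun l : ℝ => (Real.sqrt l)⁻¹) (Icc a b) := by
      apply ContinuousOn.inv₀ (by fun_prop)
      intro l hl; exact (Real.sqrt_pos.2 (lt_of_lt_of_le ha hl.1)).ne'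
    fun_prop
  have hpw : ∀ l : ℝ, 0 < l → l ^ (-(2 * α)) = l ^ (-c) * (Real.sqrt l)⁻¹ := by
    intro l hl
    rw [Real.sqrt_eq_rpow, ← Real.rpow_neg hl.le, ← Real.rpow_add hl]; congr 1; linarith
  have hexp : ∀ x l : ℝ, Complex.exp (Complex.I * ((x * l + t * l ^ 2 : ℝ) : ℂ)) =
      (Complex.cos ((l * x : ℝ) : ℂ) + Complex.sin ((l * x : ℝ) : ℂ) * Complex.I) *
        Complex.exp (Complex.I * ((t * l ^ 2 : ℝ) : ℂ)) := by
    intro x l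
    rw [← Complex.exp_mul_I, ← Complex.exp_add]; congr 1; push_cast; ring
  have hX : s' ^ c * (Real.sqrt s)⁻¹ ≤ s' ^ c * (Real.sqrt (s - s'))⁻¹ := by
    gcongr
    linarith
  have low : ∀ a b : ℝ, 0 < a → a ≤ b → b ≤ 1 / s' → ‖∫ l in a..b, F l‖ ≤
      (80 + 80 / (1 - c)) * (s' ^ c * (Real.sqrt (s - s'))⁻¹) := by
    intro a b ha hab hb
    have e : ∫ l in a..b, F l = (-Complex.I / 2) *
        ((∫ l in a..b, ((Real.sin (l * s') * l ^ (-c) : ℝ) : ℂ) * (((Real.sqrt l)⁻¹ : ℝ) *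
          Complex.exp (Complex.I * ((s * l + t * l ^ 2 : ℝ) : ℂ)))) -
        (∫ l in a..b, ((Real.sin (l * s') * l ^ (-c) : ℝ) : ℂ) * (((Real.sqrt l)⁻¹ : ℝ) *
          Complex.exp (Complex.I * ((-s * l + t * l ^ 2 : ℝ) : ℂ))))) := by
      rw [← intervalIntegral.integral_sub (hE _ (fun l => Real.sin (l * s')) (by fun_prop) a b ha hab)
        (hE _ (fun l => Real.sin (l * s')) (by fun_prop) a b ha hab), ← intervalIntegral.integral_const_mul]
      apply intervalIntegral.integral_congr
      intro l hl; rw [uIcc_of_le hab] at hl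
      have hl0 : 0 < l := lt_of_lt_of_le ha hl.1
      simp only [hF]
      rw [hpw l hl0, hexp, hexp]
      have := Complex.I_sq
      push_cast
      rw [mul_neg, Complex.cos_neg, Complex.sin_neg]
      ring_nf
      rw [this]; ring
    have b1 := osc_low (t := t) hc0 hc1 hs' hs0.ne' ha hab hb
    have b2 := osc_low (t := t) hc0 hc1 hs' (neg_ne_zero.2 hs0.ne') ha hab hb
    rw [abs_neg] at b2
    rw [abs_of_pos hs0] at b1 b2
    rw [e, norm_mul, norm_div, norm_neg, Complex.norm_I, Complex.norm_ofNat]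
    have b3 := norm_sub_le
        (∫ l in a..b, ((Real.sin (l * s') * l ^ (-c) : ℝ) : ℂ) * (((Real.sqrt l)⁻¹ : ℝ) *
          Complex.exp (Complex.I * ((s * l + t * l ^ 2 : ℝ) : ℂ))))
        (∫ l in a..b, ((Real.sin (l * s') * l ^ (-c) : ℝ) : ℂ) * (((Real.sqrt l)⁻¹ : ℝ) *
          Complex.exp (Complex.I * ((-s * l + t * l ^ 2 : ℝ) : ℂ))))
    calc _ ≤ 40 * (Real.sqrt s)⁻¹ * ((2 + 2 / (1 - c)) * s' ^ c) := by linarith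
      _ = (80 + 80 / (1 - c)) * (s' ^ c * (Real.sqrt s)⁻¹) := by ring
      _ ≤ _ := by
        have : 0 < 1 - c := by linarith
        gcongr
  have high : ∀ a b : ℝ, 1 / s' ≤ a → a ≤ b → ‖∫ l in a..b, F l‖ ≤
      80 * (s' ^ c * (Real.sqrt (s - s'))⁻¹) := by
    intro a b ha1 hab
    have ha : 0 < a := lt_of_lt_of_le (by positivity) ha1
    set G : ℝ → ℝ → ℂ := fun x l => ((l ^ (-c) : ℝ) : ℂ) * (((Real.sqrt l)⁻¹ : ℝ) *
      Complex.exp (Complex.I * ((x * l + t * l ^ 2 : ℝ) : ℂ))) with hG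
    have hGi : ∀ x, IntervalIntegrable (G x) volume a b := by
      intro x
      have := hE x (fun _ => 1) (by fun_prop) a b ha hab
      simpa only [one_mul] using this
    have e : ∫ l in a..b, F l = (1 / 4) *
        (((∫ l in a..b, G (s - s') l) + (∫ l in a..b, G (-(s - s')) l)) -
          ((∫ l in a..b, G (s + s') l) + (∫ l in a..b, G (-(s + s')) l))) := by
      rw [← intervalIntegral.integral_add (hGi _) (hGi _), ← intervalIntegral.integral_add (hGi _) (hGi _),
        ← intervalIntegral.integral_sub ((hGi _).add (hGi _)) ((hGi _).add (hGi _)),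
        ← intervalIntegral.integral_const_mul]
      apply intervalIntegral.integral_congr
      intro l hl; rw [uIcc_of_le hab] at hl
      have hl0 : 0 < l := lt_of_lt_of_le ha hl.1
      simp only [hF, hG]
      rw [hpw l hl0, hexp, hexp, hexp, hexp]
      have := Complex.I_sq
      push_cast
      rw [mul_neg, mul_neg, Complex.cos_neg, Complex.sin_neg, Complex.cos_neg, Complex.sin_neg,
        mul_sub (l : ℂ), mul_add (l : ℂ), Complex.cos_sub, Complex.cos_add]
      ring_nf
    have b1 := osc_high (t := t) hc0 hs' hd.ne' ha1 hab
    have b2 := osc_high (t := t) hc0 hs' (neg_ne_zero.2 hd.ne') ha1 hab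
    have hss : 0 < s + s' := by linarith
    have b3 := osc_high (t := t) hc0 hs' hss.ne' ha1 hab
    have b4 := osc_high (t := t) hc0 hs' (neg_ne_zero.2 hss.ne') ha1 hab
    rw [abs_neg] at b2 b4
    rw [abs_of_pos hd] at b1 b2
    rw [abs_of_pos hss] at b3 b4
    have b5 : 40 * (Real.sqrt (s + s'))⁻¹ * (2 * s' ^ c) ≤ 40 * (Real.sqrt (s - s'))⁻¹ * (2 * s' ^ c) := by
      gcongr
      linarith
    rw [e, norm_mul]
    have n1 : ‖(1 / 4 : ℂ)‖ = 1 / 4 := by simp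
    rw [n1]
    have n2 := norm_sub_le ((∫ l in a..b, G (s - s') l) + (∫ l in a..b, G (-(s - s')) l))
          ((∫ l in a..b, G (s + s') l) + (∫ l in a..b, G (-(s + s')) l))
    have n3 := norm_add_le (∫ l in a..b, G (s - s') l) (∫ l in a..b, G (-(s - s')) l)
    have n4 := norm_add_le (∫ l in a..b, G (s + s') l) (∫ l in a..b, G (-(s + s')) l)
    have : 80 * (s' ^ c * (Real.sqrt (s - s'))⁻¹) = 40 * (Real.sqrt (s - s'))⁻¹ * (2 * s' ^ c) := by ring
    rw [this]
    change ‖∫ l in a..b, G _ l‖ ≤ _ at b1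
    change ‖∫ l in a..b, G _ l‖ ≤ _ at b2
    change ‖∫ l in a..b, G _ l‖ ≤ _ at b3
    change ‖∫ l in a..b, G _ l‖ ≤ _ at b4
    linarith
  have hY : 0 ≤ s' ^ c * (Real.sqrt (s - s'))⁻¹ := by positivity
  have hZ : 0 ≤ 80 / (1 - c) := by
    have : 0 < 1 - c := by linarith
    positivity
  rcases le_total b (1 / s') with hb | hb
  · exact (low a b ha hab hb).trans (by gcongr; linarith)
  · rcases le_total (1 / s') a with h | h
    · exact (high a b h hab).trans (by gcongr; linarith)
    · rw [← intervalIntegral.integral_add_adjacent_intervals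
        (hFc a (1 / s') ha h).intervalIntegrable (hFc (1 / s') b (by positivity) hb).intervalIntegrable]
      refine (norm_add_le _ _).trans ?_
      have := low a (1 / s') ha h le_rfl
      have := high (1 / s') b le_rfl hb
      linarith

lemma kernel_abs {α θ s s' t a b : ℝ} (hθ0 : 0 ≤ θ) (hθ1 : θ ≤ 1) (hθ2 : 2 * α - 2 < θ)
    (hθ3 : θ < 2 * α - 1) (hs' : 0 < s') (hs : s' < s)
    (ha : 0 < a) (hab : a ≤ b) :
    ‖∫ l in a..b, ((Real.sin (l * s) * Real.sin (l * s') * l ^ (-(2 * α)) : ℝ) : ℂ) *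
      Complex.exp (Complex.I * ((t * l ^ 2 : ℝ) : ℂ))‖
      ≤ (1 / (θ + 2 - 2 * α) + 1 / (2 * α - 1 - θ)) * (s' ^ θ * s ^ (2 * α - 1 - θ)) := by
  have hs0 : 0 < s := hs'.trans hs
  have d1 : 0 < θ + 2 - 2 * α := by linarith
  have d2 : 0 < 2 * α - 1 - θ := by linarith
  set F : ℝ → ℂ := fun l => ((Real.sin (l * s) * Real.sin (l * s') * l ^ (-(2 * α)) : ℝ) : ℂ) *
      Complex.exp (Complex.I * ((t * l ^ 2 : ℝ) : ℂ)) with hF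
  have hFc : ∀ a b : ℝ, 0 < a → a ≤ b → ContinuousOn F (uIcc a b) := by
    intro a b ha hab
    rw [uIcc_of_le hab]
    have : ContinuousOn (fun l : ℝ => l ^ (-(2 * α))) (Icc a b) :=
        continuousOn_id.rpow_const fun l hl => Or.inl (lt_of_lt_of_le ha hl.1).ne'
    rw [hF]; fun_prop
  have hpc : ∀ (p : ℝ) (a b : ℝ), 0 < a → a ≤ b →
      IntervalIntegrable (fun l : ℝ => l ^ p) volume a b := by
    intro p a b ha hab
    apply ContinuousOn.intervalIntegrable
    rw [uIcc_of_le hab]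
    exact continuousOn_id.rpow_const fun l hl => Or.inl (lt_of_lt_of_le ha hl.1).ne'
  have hn : ∀ l, 0 < l → ‖F l‖ = |Real.sin (l * s)| * |Real.sin (l * s')| * l ^ (-(2 * α)) := by
    intro l hl
    rw [hF]; simp only
    rw [norm_mul, mul_comm Complex.I, Complex.norm_exp_ofReal_mul_I, mul_one, Complex.norm_real,
      Real.norm_eq_abs, abs_mul, abs_mul, abs_of_pos (Real.rpow_pos_of_pos hl _)]
  have hsin : ∀ x, 0 < x → |Real.sin x| ≤ x := fun x hx =>
    Real.abs_sin_le_abs.trans_eq (abs_of_pos hx)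
  have hsinθ : ∀ x, 0 < x → |Real.sin x| ≤ x ^ θ := by
    intro x hx
    rcases le_total x 1 with h | h
    · refine (hsin x hx).trans ?_
      calc x = x ^ (1:ℝ) := (Real.rpow_one x).symm
        _ ≤ x ^ θ := Real.rpow_le_rpow_of_exponent_ge hx h hθ1
    · exact (Real.abs_sin_le_one x).trans (Real.one_le_rpow h hθ0)
  have low : ∀ a b : ℝ, 0 < a → a ≤ b → b ≤ 1 / s → ‖∫ l in a..b, F l‖ ≤
      1 / (θ + 2 - 2 * α) * (s' ^ θ * s ^ (2 * α - 1 - θ)) := by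
    intro a b ha hab hb
    have hb0 : 0 < b := ha.trans_le hab
    calc ‖∫ l in a..b, F l‖ ≤ ∫ l in a..b, s' ^ θ * s * l ^ (θ + 1 - 2 * α) := by
          apply intervalIntegral.norm_integral_le_of_norm_le hab
          · refine Filter.Eventually.of_forall fun l hl => ?_
            have hl0 : 0 < l := ha.trans hl.1
            rw [hn l hl0]
            calc _ ≤ (l * s) * (l * s') ^ θ * l ^ (-(2 * α)) := by
                  gcongr
                  · exact hsin _ (by positivity)
                  · exact hsinθ _ (by positivity)
              _ = _ := by
                  rw [Real.mul_rpow hl0.le hs'.le, show θ + 1 - 2 * α = θ + 1 + (-(2 * α)) by ring,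
                    Real.rpow_add hl0, Real.rpow_add hl0, Real.rpow_one]; ring
          · exact (hpc _ a b ha hab).const_mul _
      _ = s' ^ θ * s * ((b ^ (θ + 2 - 2 * α) - a ^ (θ + 2 - 2 * α)) / (θ + 2 - 2 * α)) := by
          rw [intervalIntegral.integral_const_mul, integral_rpow (Or.inl (by linarith))]
          rw [show θ + 1 - 2 * α + 1 = θ + 2 - 2 * α by ring]
      _ ≤ s' ^ θ * s * ((1 / s) ^ (θ + 2 - 2 * α) / (θ + 2 - 2 * α)) := by
          have : 0 ≤ a ^ (θ + 2 - 2 * α) := by positivity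
          have : b ^ (θ + 2 - 2 * α) ≤ (1 / s) ^ (θ + 2 - 2 * α) := by gcongr
          gcongr
          linarith
      _ = _ := by
          rw [one_div, Real.inv_rpow hs0.le, ← Real.rpow_neg hs0.le,
            show 2 * α - 1 - θ = 1 + -(θ + 2 - 2 * α) by ring, Real.rpow_add hs0, Real.rpow_one]; ring
  have high : ∀ a b : ℝ, 1 / s ≤ a → a ≤ b → ‖∫ l in a..b, F l‖ ≤
      1 / (2 * α - 1 - θ) * (s' ^ θ * s ^ (2 * α - 1 - θ)) := by
    intro a b ha1 hab
    have ha : 0 < a := lt_of_lt_of_le (by positivity) ha1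
    have hb0 : 0 < b := ha.trans_le hab
    calc ‖∫ l in a..b, F l‖ ≤ ∫ l in a..b, s' ^ θ * l ^ (θ - 2 * α) := by
          apply intervalIntegral.norm_integral_le_of_norm_le hab
          · refine Filter.Eventually.of_forall fun l hl => ?_
            have hl0 : 0 < l := ha.trans hl.1
            rw [hn l hl0]
            calc _ ≤ 1 * (l * s') ^ θ * l ^ (-(2 * α)) := by
                  gcongr
                  · exact Real.abs_sin_le_one _
                  · exact hsinθ _ (by positivity)
              _ = _ := by
                  rw [Real.mul_rpow hl0.le hs'.le, show θ - 2 * α = θ + (-(2 * α)) by ring,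
                    Real.rpow_add hl0]; ring
          · exact (hpc _ a b ha hab).const_mul _
      _ = s' ^ θ * ((a ^ (-(2 * α - 1 - θ)) - b ^ (-(2 * α - 1 - θ))) / (2 * α - 1 - θ)) := by
          rw [intervalIntegral.integral_const_mul, integral_rpow (Or.inr ⟨by linarith, by
            rw [uIcc_of_le hab]; intro h; linarith [h.1]⟩)]
          rw [show θ - 2 * α + 1 = -(2 * α - 1 - θ) by ring, div_neg, ← neg_div, neg_sub]
      _ ≤ s' ^ θ * (s ^ (2 * α - 1 - θ) / (2 * α - 1 - θ)) := by
          have : 0 ≤ b ^ (-(2 * α - 1 - θ)) := by positivity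
          have : a ^ (-(2 * α - 1 - θ)) ≤ s ^ (2 * α - 1 - θ) := by
            rw [Real.rpow_neg ha.le, ← Real.inv_rpow ha.le]
            apply Real.rpow_le_rpow (by positivity) _ d2.le
            rw [inv_le_comm₀ ha hs0]; simpa using ha1
          gcongr
          linarith
      _ = _ := by ring
  have hY : 0 ≤ s' ^ θ * s ^ (2 * α - 1 - θ) := by positivity
  have hZ1 : 0 ≤ 1 / (θ + 2 - 2 * α) := by positivity
  have hZ2 : 0 ≤ 1 / (2 * α - 1 - θ) := by positivity
  rcases le_total b (1 / s) with hb | hb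
  · exact (low a b ha hab hb).trans (by gcongr; linarith)
  · rcases le_total (1 / s) a with h | h
    · exact (high a b h hab).trans (by gcongr; linarith)
    · rw [← intervalIntegral.integral_add_adjacent_intervals
        (hFc a (1 / s) ha h).intervalIntegrable (hFc (1 / s) b (by positivity) hb).intervalIntegrable]
      refine (norm_add_le _ _).trans ?_
      have := low a (1 / s) ha h le_rfl
      have := high (1 / s) b le_rfl hb
      linarith

lemma kernel_log (α : ℝ) (h1 : 1 / 4 ≤ α) (h2 : α < 3 / 2) :
    ∃ δ β C : ℝ, 0 < δ ∧ 0 ≤ β ∧ β * (3 / (3 - 2 * α)) < 1 ∧ 0 < C ∧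
      ∀ y y' t a b : ℝ, y ≠ y' → 0 < a → a ≤ b →
      ‖∫ l in a..b, ((Real.sin (l * Real.exp y) * Real.sin (l * Real.exp y') * l ^ (-(2 * α)) : ℝ) : ℂ) *
        Complex.exp (Complex.I * ((t * l ^ 2 : ℝ) : ℂ))‖ * Real.exp ((1 / 2 - α) * (y + y'))
      ≤ C * (Real.exp (-δ * |y - y'|) * |y - y'| ^ (-β)) := by
  suffices H : ∃ δ β C : ℝ, 0 < δ ∧ 0 ≤ β ∧ β * (3 / (3 - 2 * α)) < 1 ∧ 0 < C ∧
      ∀ y y' t a b : ℝ, y' < y → 0 < a → a ≤ b →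
      ‖∫ l in a..b, ((Real.sin (l * Real.exp y) * Real.sin (l * Real.exp y') * l ^ (-(2 * α)) : ℝ) : ℂ) *
        Complex.exp (Complex.I * ((t * l ^ 2 : ℝ) : ℂ))‖ * Real.exp ((1 / 2 - α) * (y + y'))
      ≤ C * (Real.exp (-δ * (y - y')) * (y - y') ^ (-β)) by
    obtain ⟨δ, β, C, hδ, hβ, hβ2, hC, H⟩ := H
    refine ⟨δ, β, C, hδ, hβ, hβ2, hC, ?_⟩
    intro y y' t a b hy ha hab
    rcases lt_or_gt_of_ne hy with h | h
    · have := H y' y t a b h ha hab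
      rw [abs_sub_comm, abs_of_pos (by linarith : 0 < y' - y), add_comm y y']
      simp only [mul_comm (Real.sin (_ * Real.exp y))]
      exact this
    · rw [abs_of_pos (by linarith : 0 < y - y')]
      exact H y y' t a b h ha hab
  have h3 : 0 < 3 - 2 * α := by linarith
  rcases lt_or_ge α (3 / 4) with h | h
  · refine ⟨α - 1 / 8, 1 / 2, (160 + 80 / (3 / 2 - 2 * α)) * 2, by linarith, by norm_num, ?_, ?_, ?_⟩
    · rw [← mul_div_assoc, div_lt_one h3]; linarith
    · have : 0 < 3 / 2 - 2 * α := by linarith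
      positivity
    intro y y' t a b hy ha hab
    have hz : 0 < y - y' := by linarith
    have hk := kernel_osc (t := t) h1 h (Real.exp_pos y') (Real.exp_lt_exp.2 hy) ha hab
    have hC : 0 < 160 + 80 / (3 / 2 - 2 * α) := by
      have : 0 < 3 / 2 - 2 * α := by linarith
      positivity
    have hroot : (Real.sqrt (Real.exp y - Real.exp y'))⁻¹ ≤
        2 * Real.exp (-y / 2 + (y - y') / 8) * (y - y') ^ (-(1 / 2 : ℝ)) := by
      have i1 : Real.exp (-(y - y')) * (1 + (y - y')) ≤ 1 := by
        have := Real.add_one_le_exp (y - y')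
        calc _ ≤ Real.exp (-(y - y')) * Real.exp (y - y') := by gcongr; linarith
          _ = 1 := by rw [← Real.exp_add]; simp
      have i2 : (1 + (y - y')) ≤ 4 * Real.exp ((y - y') / 4) := by
        have := Real.add_one_le_exp ((y - y') / 4)
        linarith
      have i3 : Real.exp y * Real.exp (-((y - y') / 4)) * (y - y') / 4 ≤ Real.exp y - Real.exp y' := by
        have e : Real.exp y' = Real.exp y * Real.exp (-(y - y')) := by rw [← Real.exp_add]; congr 1; ring
        have e2 : Real.exp (-((y - y') / 4)) = (Real.exp ((y - y') / 4))⁻¹ := Real.exp_neg _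
        rw [e, ← mul_one_sub, mul_assoc, mul_div_assoc]
        gcongr
        rw [e2]
        have i4 : (y - y') / (1 + (y - y')) ≤ 1 - Real.exp (-(y - y')) := by
          rw [div_le_iff₀ (by linarith)]; nlinarith
        refine le_trans ?_ i4
        rw [inv_mul_eq_div, div_div, mul_comm]
        gcongr
      have i5 : Real.sqrt (Real.exp y * Real.exp (-((y - y') / 4)) * (y - y') / 4) =
          Real.exp (y / 2 - (y - y') / 8) * (y - y') ^ (1 / 2 : ℝ) / 2 := by
        rw [← Real.sqrt_eq_rpow, Real.sqrt_eq_iff_mul_self_eq (by positivity) (by positivity)]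
        have := Real.mul_self_sqrt hz.le
        rw [← Real.exp_add, show y + -((y - y') / 4) = (y / 2 - (y - y') / 8) + (y / 2 - (y - y') / 8) by ring,
          Real.exp_add]
        linear_combination (-Real.exp (y / 2 - (y - y') / 8) * Real.exp (y / 2 - (y - y') / 8) / 4) * this
      have i6 : Real.exp (y / 2 - (y - y') / 8) * (y - y') ^ (1 / 2 : ℝ) / 2 ≤
          Real.sqrt (Real.exp y - Real.exp y') := by
        rw [← i5]; exact Real.sqrt_le_sqrt i3
      calc _ ≤ (Real.exp (y / 2 - (y - y') / 8) * (y - y') ^ (1 / 2 : ℝ) / 2)⁻¹ := by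
            gcongr
        _ = _ := by
            rw [show -y / 2 + (y - y') / 8 = -(y / 2 - (y - y') / 8) by ring, Real.exp_neg (_ - _),
              Real.rpow_neg hz.le]
            field_simp
    calc _ ≤ ((160 + 80 / (3 / 2 - 2 * α)) * (Real.exp y' ^ (2 * α - 1 / 2) *
            (2 * Real.exp (-y / 2 + (y - y') / 8) * (y - y') ^ (-(1 / 2 : ℝ))))) *
              Real.exp ((1 / 2 - α) * (y + y')) := by
          refine mul_le_mul_of_nonneg_right (hk.trans ?_) (Real.exp_pos _).le
          gcongr
      _ = (160 + 80 / (3 / 2 - 2 * α)) * 2 * ((Real.exp (y' * (2 * α - 1 / 2)) *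
            Real.exp (-y / 2 + (y - y') / 8) * Real.exp ((1 / 2 - α) * (y + y'))) *
              (y - y') ^ (-(1 / 2 : ℝ))) := by
          rw [← Real.exp_mul]; ring
      _ = _ := by
          rw [← Real.exp_add, ← Real.exp_add]; congr 4; ring
  · set θ := 5 * α / 6 - 1 / 4 with hθ
    have d1 : 0 < θ + 2 - 2 * α := by linarith
    have d2 : 0 < 2 * α - 1 - θ := by linarith
    refine ⟨θ + 1 / 2 - α, 0, 1 / (θ + 2 - 2 * α) + 1 / (2 * α - 1 - θ), by linarith, le_rfl,
      by simp, by positivity, ?_⟩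
    intro y y' t a b hy ha hab
    have hk := kernel_abs (t := t) (α := α) (θ := θ) (by linarith) (by linarith) (by linarith)
      (by linarith) (Real.exp_pos y') (Real.exp_lt_exp.2 hy) ha hab
    rw [neg_zero, Real.rpow_zero, mul_one]
    calc _ ≤ _ := mul_le_mul_of_nonneg_right hk (Real.exp_pos _).le
      _ = (1 / (θ + 2 - 2 * α) + 1 / (2 * α - 1 - θ)) * (Real.exp (y' * θ) *
            Real.exp (y * (2 * α - 1 - θ)) * Real.exp ((1 / 2 - α) * (y + y'))) := by
          rw [← Real.exp_mul, ← Real.exp_mul]; ring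
      _ = _ := by
          rw [← Real.exp_add, ← Real.exp_add]; congr 2; ring


lemma young_schur {μ : Measure ℝ} [SFinite μ] {q : ℝ} (hq : 2 < q) {w : ℝ → ℝ≥0∞}
    (hw : Measurable w) {k : ℝ × ℝ → ℝ≥0∞} (hk : Measurable k) {A : ℝ≥0∞}
    (h1 : ∀ y, ∫⁻ y', k (y, y') ^ (q / 2) ∂μ ≤ A) (h2 : ∀ y', ∫⁻ y, k (y, y') ^ (q / 2) ∂μ ≤ A) :
    ∫⁻ z, w z.1 * w z.2 * k z ∂(μ.prod μ) ≤
      A ^ (2 / q) * (∫⁻ y, w y ^ (q / (q - 1)) ∂μ) ^ (2 * (1 - 1 / q)) := by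
  have hq0 : 0 < q := by linarith
  have hq1 : 0 < q - 1 := by linarith
  set p := q / (q - 1) with hp
  have hp0 : 0 < p := by positivity
  set W := ∫⁻ y, w y ^ p ∂μ with hW
  let f : Fin 3 → ℝ × ℝ → ℝ≥0∞ := ![fun z => w z.1 ^ p * w z.2 ^ p, fun z => w z.1 ^ p * k z ^ (q / 2),
    fun z => w z.2 ^ p * k z ^ (q / 2)]
  let e : Fin 3 → ℝ := ![1 - 2 / q, 1 / q, 1 / q]
  have he0 : 0 ≤ 1 - 2 / q := by rw [sub_nonneg, div_le_one hq0]; exact hq.le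
  have he1 : 0 ≤ 1 / q := by positivity
  have key := ENNReal.lintegral_prod_norm_pow_le (μ := μ.prod μ) (Finset.univ : Finset (Fin 3)) (f := f)
    (p := e) (by
      intro i _; fin_cases i <;> simp [f] <;> fun_prop) (by
      simp [Fin.sum_univ_three, e]; ring) (by
      intro i _; fin_cases i
      · exact he0
      · exact he1
      · exact he1)
  simp only [Fin.prod_univ_three, f, e, Matrix.cons_val_zero, Matrix.cons_val_one, Matrix.cons_val] at key
  have hpe : p * (1 - 2 / q) + p * (1 / q) = 1 := by
    rw [hp]; field_simp; ring
  have hpe0 : 0 ≤ p * (1 - 2 / q) := by positivity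
  have hpe1 : 0 ≤ p * (1 / q) := by positivity
  have lhs : ∀ z : ℝ × ℝ, w z.1 * w z.2 * k z = (w z.1 ^ p * w z.2 ^ p) ^ (1 - 2 / q) *
      (w z.1 ^ p * k z ^ (q / 2)) ^ (1 / q) * (w z.2 ^ p * k z ^ (q / 2)) ^ (1 / q) := by
    intro z
    have hpow : ∀ x : ℝ≥0∞, x ^ (p * (1 - 2 / q)) * x ^ (p * (1 / q)) = x := by
      intro x
      rw [← ENNReal.rpow_add_of_nonneg _ _ hpe0 hpe1, hpe, ENNReal.rpow_one]
    have hkp : ∀ x : ℝ≥0∞, x ^ (q / 2 * (1 / q)) * x ^ (q / 2 * (1 / q)) = x := by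
      intro x
      rw [← ENNReal.rpow_add_of_nonneg _ _ (by positivity) (by positivity),
        show q / 2 * (1 / q) + q / 2 * (1 / q) = 1 by field_simp; norm_num, ENNReal.rpow_one]
    rw [ENNReal.mul_rpow_of_nonneg _ _ he0, ENNReal.mul_rpow_of_nonneg _ _ he1,
      ENNReal.mul_rpow_of_nonneg _ _ he1]
    simp only [← ENNReal.rpow_mul]
    nth_rewrite 1 [← hpow (w z.1), ← hpow (w z.2), ← hkp (k z)]
    ring
  simp_rw [lhs]
  refine key.trans ?_
  have i1 : ∫⁻ z, w z.1 ^ p * w z.2 ^ p ∂(μ.prod μ) = W * W :=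
    lintegral_prod_mul (f := fun y => w y ^ p) (g := fun y => w y ^ p) (by fun_prop) (by fun_prop)
  have i2 : ∫⁻ z, w z.1 ^ p * k z ^ (q / 2) ∂(μ.prod μ) ≤ W * A := by
    rw [lintegral_prod _ (by fun_prop)]
    calc _ = ∫⁻ y, w y ^ p * ∫⁻ y', k (y, y') ^ (q / 2) ∂μ ∂μ := by
          congr 1; ext y
          dsimp only
          rw [lintegral_const_mul _ (by fun_prop)]
      _ ≤ ∫⁻ y, w y ^ p * A ∂μ := by gcongr with y; exact h1 y
      _ = W * A := by rw [lintegral_mul_const _ (by fun_prop)]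
  have i3 : ∫⁻ z, w z.2 ^ p * k z ^ (q / 2) ∂(μ.prod μ) ≤ W * A := by
    rw [lintegral_prod_symm' _ (by fun_prop)]
    calc _ = ∫⁻ y', w y' ^ p * ∫⁻ y, k (y, y') ^ (q / 2) ∂μ ∂μ := by
          congr 1; ext y
          dsimp only
          rw [lintegral_const_mul _ (by fun_prop)]
      _ ≤ ∫⁻ y, w y ^ p * A ∂μ := by gcongr with y; exact h2 y
      _ = W * A := by rw [lintegral_mul_const _ (by fun_prop)]
  rw [i1]
  calc _ ≤ (W * W) ^ (1 - 2 / q) * (W * A) ^ (1 / q) * (W * A) ^ (1 / q) := by gcongr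
    _ = (A ^ (1 / q) * A ^ (1 / q)) * (W ^ (1 - 2 / q) * W ^ (1 - 2 / q) * W ^ (1 / q) * W ^ (1 / q)) := by
        rw [ENNReal.mul_rpow_of_nonneg _ _ he0, ENNReal.mul_rpow_of_nonneg _ _ he1]; ring
    _ = _ := by
        rw [← ENNReal.rpow_add_of_nonneg _ _ he1 he1, ← ENNReal.rpow_add_of_nonneg _ _ he0 he0,
          ← ENNReal.rpow_add_of_nonneg _ _ (by positivity) he1,
          ← ENNReal.rpow_add_of_nonneg _ _ (by positivity) he1]
        congr 2 <;> ring

lemma kappa_integrable {δ β r : ℝ} (hδ : 0 < δ) (hr : 0 < r) (hβr : β * r < 1) :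
    ∫⁻ z : ℝ, ENNReal.ofReal (Real.exp (-δ * |z|) * |z| ^ (-β)) ^ r < ⊤ := by
  have h := Real.integral_rpow_mul_exp_neg_mul_Ioi (a := 1 - β * r) (r := δ * r) (by linarith) (by positivity)
  have h2 := integral_comp_abs (f := fun t : ℝ => t ^ (1 - β * r - 1) * Real.exp (-(δ * r * t)))
  have hI : Integrable (fun x : ℝ => |x| ^ (1 - β * r - 1) * Real.exp (-(δ * r * |x|))) := by
    apply Integrable.of_integral_ne_zero
    rw [h2, h]
    have := Real.Gamma_pos_of_pos (s := 1 - β * r) (by linarith)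
    positivity
  have := hI.lintegral_lt_top
  convert this using 2
  ext z
  rw [ENNReal.ofReal_rpow_of_nonneg (by positivity) hr.le, Real.mul_rpow (by positivity) (by positivity),
    ← Real.exp_mul, ← Real.rpow_mul (abs_nonneg _), mul_comm]
  congr 3 <;> ring_nf

/-- The oscillating factor. -/
noncomputable def Eo (τ : ℝ → ℝ) (l y : ℝ) : ℂ :=
  ((Real.sin (l * Real.exp y) : ℝ) : ℂ) * Complex.exp (Complex.I * ((τ y * l ^ 2 : ℝ) : ℂ))

lemma norm_cexp_I_mul (x : ℝ) : ‖Complex.exp (Complex.I * (x : ℂ))‖ = 1 := by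
  rw [mul_comm]; exact Complex.norm_exp_ofReal_mul_I x

lemma Eo_norm_le (τ : ℝ → ℝ) (l y : ℝ) : ‖Eo τ l y‖ ≤ 1 := by
  rw [Eo, norm_mul, norm_cexp_I_mul, mul_one, Complex.norm_real]
  exact Real.abs_sin_le_one _

lemma Eo_measurable {X : Type*} [MeasurableSpace X] {τ : ℝ → ℝ} (hτ : Measurable τ) {f h : X → ℝ}
    (hf : Measurable f) (hh : Measurable h) : Measurable (fun p => Eo τ (f p) (h p)) := by
  unfold Eo
  fun_prop

lemma Eo_mul_conj (τ : ℝ → ℝ) (l y y' : ℝ) : Eo τ l y * (starRingEnd ℂ) (Eo τ l y') =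
    ((Real.sin (l * Real.exp y) * Real.sin (l * Real.exp y') : ℝ) : ℂ) *
      Complex.exp (Complex.I * (((τ y - τ y') * l ^ 2 : ℝ) : ℂ)) := by
  unfold Eo
  rw [map_mul, Complex.conj_ofReal, ← Complex.exp_conj, map_mul, Complex.conj_I, Complex.conj_ofReal]
  rw [show Complex.I * (((τ y - τ y') * l ^ 2 : ℝ) : ℂ) =
    Complex.I * ((τ y * l ^ 2 : ℝ) : ℂ) + -Complex.I * ((τ y' * l ^ 2 : ℝ) : ℂ) by push_cast; ring,
    Complex.exp_add]
  push_cast; ring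

lemma ae_ne_prod {μ : Measure ℝ} [SFinite μ] [NullSingletonClass μ] : ∀ᵐ z ∂(μ.prod μ), z.1 ≠ z.2 := by
  have hm : MeasurableSet {z : ℝ × ℝ | z.1 ≠ z.2} := (measurableSet_eq_fun measurable_fst measurable_snd).compl
  rw [Measure.ae_prod_iff_ae_ae hm]
  refine Eventually.of_forall fun x => ?_
  have : ∀ᵐ y ∂μ, y ∈ ({x} : Set ℝ)ᶜ := by
    rw [ae_iff]; simp
  filter_upwards [this] with y hy
  intro h; exact hy (by simp [h])

lemma dual_bound (α : ℝ) {μ : Measure ℝ} [SFinite μ] [NullSingletonClass μ] {b : ℝ → ℂ} (hb : Integrable b μ)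
    {τ : ℝ → ℝ} (hτ : Measurable τ) {ε N : ℝ} (hε : 0 < ε) (hN : ε ≤ N) {k : ℝ × ℝ → ℝ≥0∞}
    (hk : ∀ y y' t : ℝ, y ≠ y' →
      ‖∫ l in ε..N, ((Real.sin (l * Real.exp y) * Real.sin (l * Real.exp y') * l ^ (-(2 * α)) : ℝ) : ℂ) *
        Complex.exp (Complex.I * ((t * l ^ 2 : ℝ) : ℂ))‖ₑ ≤ k (y, y')) :
    ENNReal.ofReal (∫ l in Ioc ε N, l ^ (-(2 * α)) * ‖∫ y, b y * Eo τ l y ∂μ‖ ^ 2) ≤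
      ∫⁻ z, ‖b z.1‖ₑ * ‖b z.2‖ₑ * k z ∂(μ.prod μ) := by
  set ν := (volume : Measure ℝ).restrict (Ioc ε N) with hν
  let Φ : ℝ → ℝ × ℝ → ℂ := fun l z => ((l ^ (-(2 * α)) : ℝ) : ℂ) *
    ((b z.1 * Eo τ l z.1) * (starRingEnd ℂ) (b z.2 * Eo τ l z.2))
  have hpow : IntegrableOn (fun l : ℝ => l ^ (-(2 * α))) (Ioc ε N) := by
    have hc : ContinuousOn (fun l : ℝ => l ^ (-(2 * α))) (Icc ε N) := by
      apply ContinuousOn.rpow_const continuousOn_id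
      intro x hx; left; exact (hε.trans_le hx.1).ne'
    exact (hc.integrableOn_Icc).mono_set Ioc_subset_Icc_self
  have hbb : Integrable (fun z : ℝ × ℝ => ‖b z.1‖ * ‖b z.2‖) (μ.prod μ) := hb.norm.mul_prod hb.norm
  have hΦi : Integrable (Function.uncurry Φ) (ν.prod (μ.prod μ)) := by
    have hdom : Integrable (fun p : ℝ × (ℝ × ℝ) => (p.1 ^ (-(2 * α))) * (‖b p.2.1‖ * ‖b p.2.2‖))
        (ν.prod (μ.prod μ)) := Integrable.mul_prod hpow hbb
    refine hdom.mono ?_ ?_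
    · have hb1 : AEStronglyMeasurable (fun p : ℝ × (ℝ × ℝ) => b p.2.1) (ν.prod (μ.prod μ)) :=
        (hb.aestronglyMeasurable.comp_fst (ν := μ)).comp_snd (μ := ν)
      have hb2 : AEStronglyMeasurable (fun p : ℝ × (ℝ × ℝ) => b p.2.2) (ν.prod (μ.prod μ)) :=
        (hb.aestronglyMeasurable.comp_snd (μ := μ)).comp_snd (μ := ν)
      have he1 : Measurable (fun p : ℝ × (ℝ × ℝ) => Eo τ p.1 p.2.1) :=
        Eo_measurable hτ (by fun_prop) (by fun_prop)
      have he2 : Measurable (fun p : ℝ × (ℝ × ℝ) => Eo τ p.1 p.2.2) :=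
        Eo_measurable hτ (by fun_prop) (by fun_prop)
      have hl : Measurable (fun p : ℝ × (ℝ × ℝ) => ((p.1 ^ (-(2 * α)) : ℝ) : ℂ)) := by fun_prop
      exact hl.aestronglyMeasurable.mul ((hb1.mul he1.aestronglyMeasurable).mul
        (Complex.continuous_conj.comp_aestronglyMeasurable (hb2.mul he2.aestronglyMeasurable)))
    · refine Eventually.of_forall fun p => ?_
      simp only [Function.uncurry, Φ, norm_mul, Complex.norm_real, RCLike.norm_conj, norm_norm]
      have h1 := Eo_norm_le τ p.1 p.2.1
      have h2 := Eo_norm_le τ p.1 p.2.2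
      gcongr
      · exact mul_le_of_le_one_right (norm_nonneg _) h1
      · exact mul_le_of_le_one_right (norm_nonneg _) h2
  have s1 : ∀ l, ∫ z, Φ l z ∂(μ.prod μ) =
      ((l ^ (-(2 * α)) * ‖∫ y, b y * Eo τ l y ∂μ‖ ^ 2 : ℝ) : ℂ) := by
    intro l
    simp only [Φ]
    rw [integral_const_mul, integral_prod_mul (fun y => b y * Eo τ l y)
      (fun y => (starRingEnd ℂ) (b y * Eo τ l y)), integral_conj, Complex.mul_conj']
    push_cast; ring
  have s2 : ((∫ l in Ioc ε N, l ^ (-(2 * α)) * ‖∫ y, b y * Eo τ l y ∂μ‖ ^ 2 : ℝ) : ℂ) =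
      ∫ z, ∫ l, Φ l z ∂ν ∂(μ.prod μ) := by
    rw [← integral_integral_swap hΦi]
    simp_rw [s1]
    exact integral_complex_ofReal.symm
  have s3 : ∀ z : ℝ × ℝ, z.1 ≠ z.2 → ‖∫ l, Φ l z ∂ν‖ₑ ≤ ‖b z.1‖ₑ * ‖b z.2‖ₑ * k z := by
    intro z hz
    have e : ∀ l, Φ l z = (b z.1 * (starRingEnd ℂ) (b z.2)) *
        (((Real.sin (l * Real.exp z.1) * Real.sin (l * Real.exp z.2) * l ^ (-(2 * α)) : ℝ) : ℂ) *
        Complex.exp (Complex.I * (((τ z.1 - τ z.2) * l ^ 2 : ℝ) : ℂ))) := by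
      intro l
      have := Eo_mul_conj τ l z.1 z.2
      simp only [Φ, map_mul]
      rw [show b z.1 * Eo τ l z.1 * ((starRingEnd ℂ) (b z.2) * (starRingEnd ℂ) (Eo τ l z.2)) =
        b z.1 * (starRingEnd ℂ) (b z.2) * (Eo τ l z.1 * (starRingEnd ℂ) (Eo τ l z.2)) by ring, this]
      push_cast; ring
    simp_rw [e]
    rw [integral_const_mul, enorm_mul, enorm_mul, hν, ← intervalIntegral.integral_of_le hN]
    have := hk z.1 z.2 (τ z.1 - τ z.2) hz
    have hc : ‖(starRingEnd ℂ) (b z.2)‖ₑ = ‖b z.2‖ₑ := by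
      rw [← ofReal_norm, ← ofReal_norm, RCLike.norm_conj]
    rw [hc]
    gcongr
  have s4 : 0 ≤ ∫ l in Ioc ε N, l ^ (-(2 * α)) * ‖∫ y, b y * Eo τ l y ∂μ‖ ^ 2 := by
    apply setIntegral_nonneg measurableSet_Ioc
    intro l hl
    have : 0 < l := hε.trans hl.1
    positivity
  calc _ = ‖((∫ l in Ioc ε N, l ^ (-(2 * α)) * ‖∫ y, b y * Eo τ l y ∂μ‖ ^ 2 : ℝ) : ℂ)‖ₑ := by
        rw [← ofReal_norm, Complex.norm_real, Real.norm_of_nonneg s4]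
    _ = ‖∫ z, ∫ l, Φ l z ∂ν ∂(μ.prod μ)‖ₑ := by rw [s2]
    _ ≤ ∫⁻ z, ‖∫ l, Φ l z ∂ν‖ₑ ∂(μ.prod μ) := enorm_integral_le_lintegral_enorm _
    _ ≤ _ := by
        apply lintegral_mono_ae
        filter_upwards [ae_ne_prod (μ := μ)] with z hz using s3 z hz

/-- The sine-transform form of the propagator. -/
noncomputable def Tsin (g : ℝ → ℂ) (t s : ℝ) : ℂ :=
  ∫ l in Ioi (0 : ℝ), ((Real.sin (l * s) : ℝ) : ℂ) * Complex.exp (Complex.I * ((t * l ^ 2 : ℝ) : ℂ)) *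
    ((l : ℂ) * g l)

lemma schwartz_int (g : SchwartzMap ℝ ℂ) (n : ℕ) : Integrable (fun l : ℝ => |l| ^ n * ‖g l‖) := by
  simpa using g.integrable_pow_mul volume n

lemma lg_integrable (g : SchwartzMap ℝ ℂ) : IntegrableOn (fun l : ℝ => (l : ℂ) * g l) (Ioi 0) := by
  have h := (schwartz_int g 1).integrableOn (s := Ioi 0)
  refine Integrable.mono h (by fun_prop) (Eventually.of_forall fun l => ?_)
  simp

lemma Tsin_continuous (g : SchwartzMap ℝ ℂ) : Continuous (fun p : ℝ × ℝ => Tsin g p.1 p.2) := by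
  unfold Tsin
  refine continuous_of_dominated (bound := fun l : ℝ => ‖(l : ℂ) * g l‖) ?_ ?_ (lg_integrable g).norm ?_
  · intro p
    exact Continuous.aestronglyMeasurable (by fun_prop)
  · intro p
    refine Eventually.of_forall fun l => ?_
    rw [norm_mul, norm_mul, norm_cexp_I_mul, mul_one, Complex.norm_real]
    exact mul_le_of_le_one_left (norm_nonneg _) (Real.abs_sin_le_one _)
  · refine Eventually.of_forall fun l => ?_
    fun_prop

lemma Tsin_norm_le (g : SchwartzMap ℝ ℂ) : ∃ K : ℝ, 0 ≤ K ∧ ∀ t s : ℝ, 0 ≤ s → ‖Tsin g t s‖ ≤ K * s := by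
  have h := (schwartz_int g 2).integrableOn (s := Ioi 0)
  refine ⟨∫ l in Ioi (0 : ℝ), |l| ^ 2 * ‖g l‖, integral_nonneg fun l => by positivity, fun t s hs => ?_⟩
  unfold Tsin
  rw [← integral_mul_const]
  refine norm_integral_le_of_norm_le (h.mul_const s) (Eventually.of_forall fun l => ?_)
  rw [norm_mul, norm_mul, norm_mul, norm_cexp_I_mul, mul_one, Complex.norm_real, Complex.norm_real,
    Real.norm_eq_abs, Real.norm_eq_abs]
  have h1 : |Real.sin (l * s)| ≤ |l| * s := by
    refine Real.abs_sin_le_abs.trans_eq ?_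
    rw [abs_mul, abs_of_nonneg hs]
  calc _ ≤ (|l| * s) * (|l| * ‖g l‖) := by gcongr
    _ = _ := by ring

lemma Sprop_norm (g : ℝ → ℂ) (t s : ℝ) (hs : 0 < s) : ‖Sprop g t s‖ = ‖Tsin g t s‖ / Real.sinh s := by
  have hsh : 0 < Real.sinh s := Real.sinh_pos_iff.mpr hs
  have : Sprop g t s = (Complex.exp (Complex.I * (t : ℂ)) / ((Real.sinh s : ℝ) : ℂ)) * Tsin g t s := by
    unfold Sprop Tsin
    rw [← integral_const_mul]
    refine setIntegral_congr_fun measurableSet_Ioi fun l hl => ?_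
    have hl0 : (l : ℂ) ≠ 0 := by exact_mod_cast (ne_of_gt hl)
    have hs0 : ((Real.sinh s : ℝ) : ℂ) ≠ 0 := by exact_mod_cast hsh.ne'
    have e : Complex.exp (Complex.I * ((t * (l ^ 2 + 1) : ℝ) : ℂ)) = Complex.exp (Complex.I * (t : ℂ)) *
        Complex.exp (Complex.I * ((t * l ^ 2 : ℝ) : ℂ)) := by
      rw [← Complex.exp_add]; congr 1; push_cast; ring
    rw [e, Complex.ofReal_div, Complex.ofReal_mul]
    field_simp
  rw [this, norm_mul, norm_div, norm_cexp_I_mul, Complex.norm_real, Real.norm_of_nonneg hsh.le]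
  ring

lemma sob_integrable (α : ℝ) (h2 : α < 3 / 2) (g : SchwartzMap ℝ ℂ) :
    IntegrableOn (fun l : ℝ => (l ^ 2 + 1) ^ α * ‖g l‖ ^ 2 * l ^ 2) (Ioi 0) := by
  obtain ⟨M, hM0, hM⟩ : ∃ M : ℝ, 0 ≤ M ∧ ∀ x, ‖g x‖ ≤ M :=
    ⟨_, by positivity, fun x => g.norm_le_seminorm ℝ x⟩
  have h : IntegrableOn (fun l : ℝ => M * (|l| ^ 6 * ‖g l‖ + 2 * (|l| ^ 4 * ‖g l‖) + |l| ^ 2 * ‖g l‖)) (Ioi 0) :=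
    ((((schwartz_int g 6).add ((schwartz_int g 4).const_mul 2)).add (schwartz_int g 2)).const_mul M).integrableOn
  refine Integrable.mono h ?_ (Eventually.of_forall fun l => ?_)
  · refine Continuous.aestronglyMeasurable ?_
    have : Continuous fun l : ℝ => (l ^ 2 + 1) ^ α :=
      Continuous.rpow_const (by fun_prop) (fun x => Or.inl (by positivity))
    fun_prop
  · rw [Real.norm_of_nonneg (by positivity), Real.norm_of_nonneg (by positivity)]
    have h3 : (l ^ 2 + 1) ^ α ≤ (l ^ 2 + 1) ^ 2 := by
      rw [← Real.rpow_natCast (l ^ 2 + 1) 2]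
      apply Real.rpow_le_rpow_of_exponent_le
      · nlinarith [sq_nonneg l]
      · norm_num; linarith
    have h4 := hM l
    have a2 : |l| ^ 2 = l ^ 2 := sq_abs l
    have a4 : |l| ^ 4 = l ^ 4 := by rw [show 4 = 2 * 2 by norm_num, pow_mul, pow_mul, a2]
    have a6 : |l| ^ 6 = l ^ 6 := by rw [show 6 = 2 * 3 by norm_num, pow_mul, pow_mul, a2]
    rw [a2, a4, a6]
    calc _ ≤ (l ^ 2 + 1) ^ 2 * (M * ‖g l‖) * l ^ 2 := by
          gcongr; rw [sq]; gcongr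
      _ = _ := by ring

lemma Tsin_measurable (g : SchwartzMap ℝ ℂ) {f h : ℝ → ℝ} (hf : Measurable f) (hh : Measurable h) :
    Measurable (fun y => Tsin g (f y) (h y)) := by
  have h0 := (Tsin_continuous g).measurable
  generalize Tsin (⇑g) = S at h0 ⊢
  exact h0.comp (hf.prodMk hh)

lemma conclude {x B S : ℝ≥0∞} {q : ℝ} (hq : 1 < q) (hx : x ≠ ⊤)
    (h : x ≤ B * x ^ (1 - 1 / q) * S) : x ≤ (B * S) ^ q := by
  have hq0 : 0 < q := by linarith
  rcases eq_or_ne x 0 with h0 | h0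
  · simp [h0]
  have e : x = x ^ (1 / q) * x ^ (1 - 1 / q) := by
    rw [← ENNReal.rpow_add _ _ h0 hx]; simp
  have hp0 : x ^ (1 - 1 / q) ≠ 0 := by
    simp [ENNReal.rpow_eq_zero_iff, h0, hx]
  have hpt : x ^ (1 - 1 / q) ≠ ⊤ := by
    simp [ENNReal.rpow_eq_top_iff, h0, hx]
  have h1 : x ^ (1 / q) ≤ B * S := by
    rw [← ENNReal.mul_le_mul_iff_left hp0 hpt, ← e]
    calc x ≤ _ := h
      _ = _ := by ring
  calc x = (x ^ (1 / q)) ^ q := by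
        rw [← ENNReal.rpow_mul, one_div, inv_mul_cancel₀ hq0.ne', ENNReal.rpow_one]
    _ ≤ _ := by gcongr

lemma exp_integrableOn_Iio (L c : ℝ) (hc : 0 < c) : IntegrableOn (fun y => Real.exp (c * y)) (Iio L) := by
  have := integrableOn_exp_mul_Iic hc L
  exact this.mono_set Iio_subset_Iic_self

lemma trunc_cs (α : ℝ) {A f : ℝ → ℂ} (hA : AEStronglyMeasurable A (volume.restrict (Ioi 0)))
    (hf : AEStronglyMeasurable f (volume.restrict (Ioi 0))) {ε N : ℝ} (hε : 0 < ε) :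
    ‖∫ l in Ioc ε N, A l * f l‖ₑ ≤
      (∫⁻ l in Ioc ε N, ENNReal.ofReal (l ^ (-(2 * α)) * ‖A l‖ ^ 2)) ^ (1 / 2 : ℝ) *
      (∫⁻ l in Ioi 0, ENNReal.ofReal (l ^ (2 * α) * ‖f l‖ ^ 2)) ^ (1 / 2 : ℝ) := by
  have hsub : Ioc ε N ⊆ Ioi 0 := fun x hx => hε.trans hx.1
  have hA' := hA.mono_measure (Measure.restrict_mono hsub le_rfl)
  have hf' := hf.mono_measure (Measure.restrict_mono hsub le_rfl)
  calc _ ≤ ∫⁻ l in Ioc ε N, ‖A l * f l‖ₑ := enorm_integral_le_lintegral_enorm _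
    _ = ∫⁻ l in Ioc ε N, ((fun l => ENNReal.ofReal (l ^ (-α)) * ‖A l‖ₑ) *
          (fun l => ENNReal.ofReal (l ^ α) * ‖f l‖ₑ)) l := by
        refine setLIntegral_congr_fun measurableSet_Ioc fun l hl => ?_
        have hl0 : 0 < l := hsub hl
        have : ENNReal.ofReal (l ^ (-α)) * ENNReal.ofReal (l ^ α) = 1 := by
          rw [← ENNReal.ofReal_mul (by positivity), ← Real.rpow_add hl0]; simp
        simp only [Pi.mul_apply]
        calc _ = 1 * ‖A l‖ₑ * ‖f l‖ₑ := by rw [enorm_mul, one_mul]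
          _ = _ := by rw [← this]; ring
    _ ≤ (∫⁻ l in Ioc ε N, (ENNReal.ofReal (l ^ (-α)) * ‖A l‖ₑ) ^ (2 : ℝ)) ^ (1 / 2 : ℝ) *
        (∫⁻ l in Ioc ε N, (ENNReal.ofReal (l ^ α) * ‖f l‖ₑ) ^ (2 : ℝ)) ^ (1 / 2 : ℝ) := by
        refine ENNReal.lintegral_mul_le_Lp_mul_Lq _ Real.HolderConjugate.two_two ?_ ?_
        · exact AEMeasurable.mul (by fun_prop) hA'.enorm
        · exact AEMeasurable.mul (by fun_prop) hf'.enorm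
    _ ≤ _ := by
        have key : ∀ (c l : ℝ) (z : ℂ), 0 < l → (ENNReal.ofReal (l ^ c) * ‖z‖ₑ) ^ (2 : ℝ) =
            ENNReal.ofReal (l ^ (2 * c) * ‖z‖ ^ 2) := by
          intro c l z hl
          rw [← ofReal_norm, ← ENNReal.ofReal_mul (by positivity),
            ENNReal.ofReal_rpow_of_nonneg (by positivity) (by norm_num),
            Real.mul_rpow (by positivity) (by positivity), ← Real.rpow_mul hl.le, mul_comm c]
          norm_num
        gcongr ?_ ^ (1 / 2 : ℝ) * ?_ ^ (1 / 2 : ℝ)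
        · refine (setLIntegral_congr_fun measurableSet_Ioc fun l hl => ?_).le
          rw [key _ _ _ (hsub hl), mul_neg]
        · calc _ = ∫⁻ l in Ioc ε N, ENNReal.ofReal (l ^ (2 * α) * ‖f l‖ ^ 2) := by
                refine setLIntegral_congr_fun measurableSet_Ioc fun l hl => ?_
                rw [key _ _ _ (hsub hl)]
            _ ≤ _ := lintegral_mono_set hsub

lemma sob_ge (α : ℝ) (h1 : 0 ≤ α) (h2 : α < 3 / 2) (g : SchwartzMap ℝ ℂ) :
    (∫⁻ l in Ioi (0 : ℝ), ENNReal.ofReal (l ^ (2 * α) * ‖(l : ℂ) * g l‖ ^ 2)) ^ (1 / 2 : ℝ) ≤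
      ENNReal.ofReal (sobNorm α g) := by
  unfold sobNorm
  have hnn : ∀ l : ℝ, 0 ≤ (l ^ 2 + 1) ^ α * ‖g l‖ ^ 2 * l ^ 2 := fun l => by positivity
  rw [← ENNReal.ofReal_rpow_of_nonneg (integral_nonneg hnn) (by norm_num),
    ofReal_integral_eq_lintegral_ofReal (sob_integrable α h2 g) (Eventually.of_forall hnn)]
  gcongr ?_ ^ (1 / 2 : ℝ)
  refine setLIntegral_mono' measurableSet_Ioi fun l hl => ?_
  have hl0 : (0 : ℝ) < l := hl
  apply ENNReal.ofReal_le_ofReal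
  have : l ^ (2 * α) ≤ (l ^ 2 + 1) ^ α := by
    rw [Real.rpow_mul hl0.le]
    apply Real.rpow_le_rpow (by positivity) _ h1
    norm_num
  rw [norm_mul, Complex.norm_real, Real.norm_of_nonneg hl0.le]
  calc l ^ (2 * α) * (l * ‖g l‖) ^ 2 ≤ (l ^ 2 + 1) ^ α * (l * ‖g l‖) ^ 2 := by gcongr
    _ = _ := by ring

lemma energy (α : ℝ) (h1 : 1 / 4 ≤ α) (h2 : α < 3 / 2) (q : ℝ) (hq : q = 6 / (3 - 2 * α)) :
    ∃ B : ℝ≥0∞, B ≠ ⊤ ∧ ∀ (L : ℝ) (τ : ℝ → ℝ) (b : ℝ → ℂ) (h : ℝ → ℝ≥0∞), Measurable τ → Measurable h →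
      Integrable b (volume.restrict (Iio L)) →
      (∀ y, ‖b y‖ₑ = ENNReal.ofReal (Real.exp ((1 / 2 - α) * y)) * h y) →
      ∀ ε N : ℝ, 0 < ε → ε ≤ N →
      ENNReal.ofReal (∫ l in Ioc ε N, l ^ (-(2 * α)) * ‖∫ y in Iio L, b y * Eo τ l y‖ ^ 2) ≤
        B * (∫⁻ y in Iio L, h y ^ (q / (q - 1))) ^ (2 * (1 - 1 / q)) := by
  obtain ⟨δ, β, C, hδ, hβ, hβr, hC, hker⟩ := kernel_log α h1 h2
  have h3 : 0 < 3 - 2 * α := by linarith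
  have hq2 : 2 < q := by rw [hq, lt_div_iff₀ h3]; linarith
  have hqr : q / 2 = 3 / (3 - 2 * α) := by rw [hq]; field_simp; norm_num
  have hAfin := kappa_integrable (r := q / 2) hδ (by linarith) (by rw [hqr]; exact hβr)
  set κ : ℝ → ℝ≥0∞ := fun z => ENNReal.ofReal (Real.exp (-δ * |z|) * |z| ^ (-β)) with hκ
  set A := ∫⁻ z : ℝ, κ z ^ (q / 2) with hA
  have hκm : Measurable κ := by rw [hκ]; fun_prop
  refine ⟨ENNReal.ofReal C * A ^ (2 / q), ?_, ?_⟩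
  · apply ENNReal.mul_ne_top ENNReal.ofReal_ne_top
    exact ENNReal.rpow_ne_top_of_nonneg (by positivity) hAfin.ne
  intro L τ b h hτ hh hb hbn ε N hε hN
  let e : ℝ → ℝ := fun y => Real.exp ((1 / 2 - α) * y)
  have he : ∀ y, 0 < e y := fun y => Real.exp_pos _
  have d := dual_bound α hb hτ hε hN (k := fun z => ENNReal.ofReal C * κ (z.1 - z.2) *
      (ENNReal.ofReal (e z.1) * ENNReal.ofReal (e z.2))⁻¹) (by
    intro y y' t hne
    have hk := hker y y' t ε N hne hε hN
    have hne : ENNReal.ofReal (e y) * ENNReal.ofReal (e y') ≠ 0 := by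
      have := he y; have := he y'
      simp [*]
    have hnt : ENNReal.ofReal (e y) * ENNReal.ofReal (e y') ≠ ⊤ := by finiteness
    dsimp only
    rw [← div_eq_mul_inv, ENNReal.le_div_iff_mul_le (Or.inl hne) (Or.inl hnt)]
    rw [← ofReal_norm, ← ENNReal.ofReal_mul (he _).le, ← ENNReal.ofReal_mul (norm_nonneg _),
      ← ENNReal.ofReal_mul hC.le]
    apply ENNReal.ofReal_le_ofReal
    refine le_trans (le_of_eq ?_) hk
    simp only [e]
    rw [← Real.exp_add, ← mul_add])
  refine d.trans ?_
  have e1 : ∀ z : ℝ × ℝ, ‖b z.1‖ₑ * ‖b z.2‖ₑ * (ENNReal.ofReal C * κ (z.1 - z.2) *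
      (ENNReal.ofReal (e z.1) * ENNReal.ofReal (e z.2))⁻¹) =
      ENNReal.ofReal C * (h z.1 * h z.2 * κ (z.1 - z.2)) := by
    intro z
    rw [hbn, hbn]
    have hne : ENNReal.ofReal (e z.1) * ENNReal.ofReal (e z.2) ≠ 0 := by
      have := he z.1; have := he z.2
      simp [*]
    have hnt : ENNReal.ofReal (e z.1) * ENNReal.ofReal (e z.2) ≠ ⊤ := by finiteness
    have := ENNReal.mul_inv_cancel hne hnt
    calc _ = (ENNReal.ofReal (e z.1) * ENNReal.ofReal (e z.2) *
          (ENNReal.ofReal (e z.1) * ENNReal.ofReal (e z.2))⁻¹) *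
          (ENNReal.ofReal C * (h z.1 * h z.2 * κ (z.1 - z.2))) := by simp only [e]; ring
      _ = _ := by rw [this, one_mul]
  simp_rw [e1]
  rw [lintegral_const_mul _ (by fun_prop), mul_assoc]
  gcongr
  refine young_schur hq2 hh (k := fun z => κ (z.1 - z.2)) (by fun_prop) ?_ ?_
  · intro y
    calc _ ≤ ∫⁻ y', κ (y - y') ^ (q / 2) := setLIntegral_le_lintegral _ _
      _ = A := lintegral_sub_left_eq_self (fun z => κ z ^ (q / 2)) y
      _ ≤ A := le_rfl
  · intro y
    calc _ ≤ ∫⁻ y', κ (y' - y) ^ (q / 2) := setLIntegral_le_lintegral _ _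
      _ = A := lintegral_sub_right_eq_self (fun z => κ z ^ (q / 2)) y
      _ ≤ A := le_rfl

lemma fubini_pair {μ : Measure ℝ} [SFinite μ] {b : ℝ → ℂ} (hb : Integrable b μ) {τ : ℝ → ℝ} (hτ : Measurable τ)
    (g : SchwartzMap ℝ ℂ) :
    (∫ y, b y * Tsin g (τ y) (Real.exp y) ∂μ =
      ∫ l in Ioi (0 : ℝ), (∫ y, b y * Eo τ l y ∂μ) * ((l : ℂ) * g l)) ∧
    IntegrableOn (fun l : ℝ => (∫ y, b y * Eo τ l y ∂μ) * ((l : ℂ) * g l)) (Ioi 0) := by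
  set ν := (volume : Measure ℝ).restrict (Ioi 0) with hν
  have hf : Integrable (fun l : ℝ => (l : ℂ) * g l) ν := lg_integrable g
  let Φ : ℝ → ℝ → ℂ := fun y l => b y * Eo τ l y * ((l : ℂ) * g l)
  have hΦ : Integrable (Function.uncurry Φ) (μ.prod ν) := by
    have hdom : Integrable (fun p : ℝ × ℝ => b p.1 * ((p.2 : ℂ) * g p.2)) (μ.prod ν) := hb.mul_prod hf
    refine hdom.mono ?_ (Eventually.of_forall fun p => ?_)
    · have m1 : AEStronglyMeasurable (fun p : ℝ × ℝ => b p.1) (μ.prod ν) := hb.aestronglyMeasurable.comp_fst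
      have m2 : AEStronglyMeasurable (fun p : ℝ × ℝ => (p.2 : ℂ) * g p.2) (μ.prod ν) :=
        hf.aestronglyMeasurable.comp_snd
      have m3 : Measurable (fun p : ℝ × ℝ => Eo τ p.2 p.1) := Eo_measurable hτ (by fun_prop) (by fun_prop)
      exact (m1.mul m3.aestronglyMeasurable).mul m2
    · simp only [Function.uncurry, Φ]
      rw [norm_mul, norm_mul, norm_mul (b p.1)]
      have := Eo_norm_le τ p.2 p.1
      gcongr
      exact mul_le_of_le_one_right (norm_nonneg _) this
  have e1 : ∀ y, ∫ l, Φ y l ∂ν = b y * Tsin g (τ y) (Real.exp y) := by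
    intro y
    unfold Tsin
    rw [← integral_const_mul]
    congr 1
    ext l
    simp only [Φ, Eo]
    ring
  have e2 : ∀ l : ℝ, ∫ y, Φ y l ∂μ = (∫ y, b y * Eo τ l y ∂μ) * ((l : ℂ) * g l) := by
    intro l
    rw [← integral_mul_const]
  have hi := hΦ.integral_prod_right
  have hs := integral_integral_swap hΦ
  simp only [Function.uncurry, e2] at hi
  simp only [e1, e2] at hs
  exact ⟨hs, hi⟩

lemma A_meas {μ : Measure ℝ} [SFinite μ] {b : ℝ → ℂ} (hb : Integrable b μ) {τ : ℝ → ℝ} (hτ : Measurable τ)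
    (ν : Measure ℝ) [SFinite ν] : AEStronglyMeasurable (fun l => ∫ y, b y * Eo τ l y ∂μ) ν := by
  have m1 : AEStronglyMeasurable (fun p : ℝ × ℝ => b p.2) (ν.prod μ) := hb.aestronglyMeasurable.comp_snd
  have m3 : Measurable (fun p : ℝ × ℝ => Eo τ p.1 p.2) := Eo_measurable hτ (by fun_prop) (by fun_prop)
  exact (m1.mul m3.aestronglyMeasurable).integral_prod_right'

lemma A_bound {μ : Measure ℝ} {b : ℝ → ℂ} (hb : Integrable b μ) (τ : ℝ → ℝ) (l : ℝ) :
    ‖∫ y, b y * Eo τ l y ∂μ‖ ≤ ∫ y, ‖b y‖ ∂μ := by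
  refine norm_integral_le_of_norm_le hb.norm (Eventually.of_forall fun y => ?_)
  rw [norm_mul]
  exact mul_le_of_le_one_right (norm_nonneg _) (Eo_norm_le τ l y)

lemma A_sq_integrable (α : ℝ) {μ : Measure ℝ} [SFinite μ] {b : ℝ → ℂ} (hb : Integrable b μ) {τ : ℝ → ℝ}
    (hτ : Measurable τ) {ε N : ℝ} (hε : 0 < ε) :
    IntegrableOn (fun l : ℝ => l ^ (-(2 * α)) * ‖∫ y, b y * Eo τ l y ∂μ‖ ^ 2) (Ioc ε N) := by
  have hpow : IntegrableOn (fun l : ℝ => l ^ (-(2 * α))) (Ioc ε N) := by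
    have hc : ContinuousOn (fun l : ℝ => l ^ (-(2 * α))) (Icc ε N) := by
      apply ContinuousOn.rpow_const continuousOn_id
      intro x hx; left; exact (hε.trans_le hx.1).ne'
    exact (hc.integrableOn_Icc).mono_set Ioc_subset_Icc_self
  refine Integrable.mul_bdd (c := (∫ y, ‖b y‖ ∂μ) ^ 2) hpow ((A_meas hb hτ _).norm.pow 2) (Eventually.of_forall fun l => ?_)
  rw [norm_pow, norm_norm]
  have := A_bound hb τ l
  gcongr

lemma pairing_bound (α : ℝ) (h1 : 1 / 4 ≤ α) (h2 : α < 3 / 2) (q : ℝ) (hq : q = 6 / (3 - 2 * α)) :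
    ∃ B : ℝ≥0∞, B ≠ ⊤ ∧ ∀ (g : SchwartzMap ℝ ℂ) (L : ℝ) (τ : ℝ → ℝ) (b : ℝ → ℂ) (h : ℝ → ℝ≥0∞),
      Measurable τ → Measurable h →
      Integrable b (volume.restrict (Iio L)) →
      (∀ y, ‖b y‖ₑ = ENNReal.ofReal (Real.exp ((1 / 2 - α) * y)) * h y) →
      ‖∫ y in Iio L, b y * Tsin g (τ y) (Real.exp y)‖ₑ ≤
        B * (∫⁻ y in Iio L, h y ^ (q / (q - 1))) ^ (1 - 1 / q) * ENNReal.ofReal (sobNorm α g) := by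
  obtain ⟨B, hB, hE⟩ := energy α h1 h2 q hq
  refine ⟨B ^ (1 / 2 : ℝ), ENNReal.rpow_ne_top_of_nonneg (by norm_num) hB, ?_⟩
  intro g L τ b h hτ hh hb hbn
  obtain ⟨hfu, hfi⟩ := fubini_pair hb hτ g
  rw [hfu]
  let s : ℕ → Set ℝ := fun n => Ioc (1 / ((n : ℝ) + 1)) ((n : ℝ) + 1)
  have hsU : ⋃ n, s n = Ioi 0 := by
    ext x
    simp only [mem_iUnion, s, mem_Ioc, mem_Ioi]
    constructor
    · rintro ⟨n, hn, -⟩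
      exact lt_trans (by positivity) hn
    · intro hx
      obtain ⟨n, hn⟩ := exists_nat_one_div_lt hx
      obtain ⟨m, hm⟩ := exists_nat_ge x
      refine ⟨max n m, lt_of_le_of_lt ?_ hn, ?_⟩
      · have : (n : ℝ) ≤ ((max n m : ℕ) : ℝ) := by exact_mod_cast le_max_left _ _
        gcongr
      · have : (m : ℝ) ≤ ((max n m : ℕ) : ℝ) := by exact_mod_cast le_max_right _ _
        linarith
  have hsm : Monotone s := by
    intro n m hnm
    have : (n : ℝ) ≤ m := by exact_mod_cast hnm
    apply Ioc_subset_Ioc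
    · gcongr
    · gcongr
  have ht := tendsto_setIntegral_of_monotone (fun n => (measurableSet_Ioc : MeasurableSet (s n))) hsm
    (by rw [hsU]; exact hfi)
  rw [hsU] at ht
  refine le_of_tendsto ht.enorm (Eventually.of_forall fun n => ?_)
  have hn : 0 < 1 / ((n : ℝ) + 1) := by positivity
  have hn1 : 1 / ((n : ℝ) + 1) ≤ (n : ℝ) + 1 := by
    have : (1 : ℝ) ≤ (n : ℝ) + 1 := by linarith [Nat.cast_nonneg (α := ℝ) n]
    exact (div_le_self (by norm_num) this).trans this
  refine (trunc_cs α (A_meas hb hτ _) (lg_integrable g).aestronglyMeasurable hn).trans ?_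
  have hE' := hE L τ b h hτ hh hb hbn _ _ hn hn1
  rw [ofReal_integral_eq_lintegral_ofReal (A_sq_integrable α hb hτ hn)
    ((ae_restrict_iff' measurableSet_Ioc).mpr (Eventually.of_forall fun l hl => by
      have : 0 < l := hn.trans hl.1
      positivity))] at hE'
  refine mul_le_mul' ?_ (sob_ge α (by linarith) h2 g)
  calc _ ≤ (B * (∫⁻ y in Iio L, h y ^ (q / (q - 1))) ^ (2 * (1 - 1 / q))) ^ (1 / 2 : ℝ) := by gcongr
    _ = _ := by
      rw [ENNReal.mul_rpow_of_nonneg _ _ (by norm_num), ← ENNReal.rpow_mul]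
      congr 2; ring

lemma core (α : ℝ) (h1 : 1 / 4 ≤ α) (h2 : α < 3 / 2) (q : ℝ) (hq : q = 6 / (3 - 2 * α)) :
    ∃ B : ℝ≥0∞, B ≠ ⊤ ∧ ∀ (g : SchwartzMap ℝ ℂ) (L : ℝ) (τ : ℝ → ℝ), Measurable τ →
      ∫⁻ y in Iio L, ENNReal.ofReal (Real.exp ((1 / 2 - α) * y) * ‖Tsin g (τ y) (Real.exp y)‖) ^ q ≤
        (B * ENNReal.ofReal (sobNorm α g)) ^ q := by
  obtain ⟨B, hB, hP⟩ := pairing_bound α h1 h2 q hq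
  refine ⟨B, hB, fun g L τ hτ => ?_⟩
  have h3 : 0 < 3 - 2 * α := by linarith
  have hq2 : 2 < q := by rw [hq, lt_div_iff₀ h3]; linarith
  have hqa : (3 / 2 - α) * q = 3 := by rw [hq]; field_simp; ring
  obtain ⟨K, hK, hTK⟩ := Tsin_norm_le g
  let T : ℝ → ℂ := fun y => Tsin g (τ y) (Real.exp y)
  let e : ℝ → ℝ := fun y => Real.exp ((1 / 2 - α) * y)
  let H : ℝ → ℝ := fun y => e y * ‖T y‖
  have he : ∀ y, 0 < e y := fun y => Real.exp_pos _
  have hH0 : ∀ y, 0 ≤ H y := fun y => mul_nonneg (he y).le (norm_nonneg _)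
  have hTm : Measurable T := Tsin_measurable g hτ Real.measurable_exp
  have hem : Measurable e := by simp only [e]; fun_prop
  have hHm : Measurable H := hem.mul hTm.norm
  have hHb : ∀ y, H y ≤ K * Real.exp ((3 / 2 - α) * y) := by
    intro y
    calc H y ≤ e y * (K * Real.exp y) := by
          simp only [H]; gcongr; exact hTK _ _ (Real.exp_pos y).le
      _ = K * (Real.exp ((1 / 2 - α) * y) * Real.exp y) := by simp only [e]; ring
      _ = _ := by rw [← Real.exp_add]; ring_nf
  have hHp : ∀ (p : ℝ) y, 0 ≤ p → H y ^ p ≤ K ^ p * Real.exp ((3 / 2 - α) * p * y) := by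
    intro p y hp
    calc H y ^ p ≤ (K * Real.exp ((3 / 2 - α) * y)) ^ p := Real.rpow_le_rpow (hH0 y) (hHb y) hp
      _ = _ := by
        rw [Real.mul_rpow hK (Real.exp_pos _).le, ← Real.exp_mul]; ring_nf
  have hIi : Integrable (fun y => H y ^ q) (volume.restrict (Iio L)) := by
    refine Integrable.mono' ((exp_integrableOn_Iio L 3 (by norm_num)).const_mul (K ^ q)) (hHm.pow_const q).aestronglyMeasurable
      (Eventually.of_forall fun y => ?_)
    rw [Real.norm_of_nonneg (Real.rpow_nonneg (hH0 y) _)]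
    have := hHp q y (by linarith)
    rwa [hqa] at this
  let b : ℝ → ℂ := fun y => (starRingEnd ℂ) (T y) * ((e y ^ 2 * H y ^ (q - 2) : ℝ) : ℂ)
  have hbm : Measurable b := by
    refine (Complex.continuous_conj.measurable.comp hTm).mul ?_
    exact Complex.measurable_ofReal.comp ((hem.pow_const 2).mul (hHm.pow_const _))
  have hHq1 : ∀ y, H y * H y ^ (q - 2) = H y ^ (q - 1) := by
    intro y
    rw [← Real.rpow_one_add' (hH0 y) (by linarith)]; ring_nf
  have hHq : ∀ y, H y * H y ^ (q - 1) = H y ^ q := by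
    intro y
    rw [← Real.rpow_one_add' (hH0 y) (by linarith)]; ring_nf
  have hbn : ∀ y, ‖b y‖ = e y * H y ^ (q - 1) := by
    intro y
    simp only [b]
    rw [norm_mul, RCLike.norm_conj, Complex.norm_real, Real.norm_of_nonneg
      (mul_nonneg (sq_nonneg _) (Real.rpow_nonneg (hH0 y) _)), ← hHq1]
    simp only [H]; ring
  have hbi : Integrable b (volume.restrict (Iio L)) := by
    refine Integrable.mono' ((exp_integrableOn_Iio L 2 (by norm_num)).const_mul (K ^ (q - 1)))
      hbm.aestronglyMeasurable (Eventually.of_forall fun y => ?_)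
    rw [hbn]
    calc _ ≤ e y * (K ^ (q - 1) * Real.exp ((3 / 2 - α) * (q - 1) * y)) := by
          have := hHp (q - 1) y (by linarith)
          have := (he y).le
          gcongr
      _ = K ^ (q - 1) * (Real.exp ((1 / 2 - α) * y) * Real.exp ((3 / 2 - α) * (q - 1) * y)) := by
          simp only [e]; ring
      _ = _ := by
          rw [← Real.exp_add]
          congr 2
          rw [mul_sub (3 / 2 - α) q 1, hqa]; ring
  have hbT : ∀ y, b y * T y = ((H y ^ q : ℝ) : ℂ) := by
    intro y
    have : b y * T y = (T y * (starRingEnd ℂ) (T y)) * ((e y ^ 2 * H y ^ (q - 2) : ℝ) : ℂ) := by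
      simp only [b]; ring
    rw [this, Complex.mul_conj', ← hHq, ← hHq1]
    simp only [H]; push_cast; ring
  have hI0 : 0 ≤ ∫ y in Iio L, H y ^ q := integral_nonneg fun y => Real.rpow_nonneg (hH0 y) _
  have hp := hP g L τ b (fun y => ENNReal.ofReal (H y) ^ (q - 1)) hτ (by fun_prop) hbi (by
    intro y
    rw [← ofReal_norm, hbn, ENNReal.ofReal_mul (he y).le, ENNReal.ofReal_rpow_of_nonneg (hH0 y) (by linarith)])
  have hx : ∫⁻ y in Iio L, ENNReal.ofReal (H y) ^ q = ENNReal.ofReal (∫ y in Iio L, H y ^ q) := by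
    rw [ofReal_integral_eq_lintegral_ofReal hIi (Eventually.of_forall fun y => Real.rpow_nonneg (hH0 y) _)]
    congr 1; ext y
    rw [ENNReal.ofReal_rpow_of_nonneg (hH0 y) (by linarith)]
  have hpw : ∀ y, (ENNReal.ofReal (H y) ^ (q - 1)) ^ (q / (q - 1)) = ENNReal.ofReal (H y) ^ q := by
    intro y
    rw [← ENNReal.rpow_mul]; congr 1
    have : q - 1 ≠ 0 := by linarith
    field_simp
  have hl : ‖∫ y in Iio L, b y * Tsin g (τ y) (Real.exp y)‖ₑ = ENNReal.ofReal (∫ y in Iio L, H y ^ q) := by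
    have : ∀ y, b y * Tsin g (τ y) (Real.exp y) = ((H y ^ q : ℝ) : ℂ) := hbT
    simp_rw [this]
    rw [integral_complex_ofReal, ← ofReal_norm, Complex.norm_real, Real.norm_of_nonneg hI0]
  simp only [hpw] at hp
  rw [hl, ← hx] at hp
  exact conclude (by linarith) (by rw [hx]; exact ENNReal.ofReal_ne_top) hp

lemma Tsin_bdd (g : SchwartzMap ℝ ℂ) : ∃ K : ℝ, ∀ t s : ℝ, ‖Tsin g t s‖ ≤ K := by
  refine ⟨∫ l in Ioi (0 : ℝ), ‖(l : ℂ) * g l‖, fun t s => ?_⟩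
  unfold Tsin
  refine norm_integral_le_of_norm_le (lg_integrable g).norm (Eventually.of_forall fun l => ?_)
  rw [norm_mul, norm_mul, norm_cexp_I_mul, mul_one, Complex.norm_real]
  exact mul_le_of_le_one_left (norm_nonneg _) (Real.abs_sin_le_one _)

lemma select (g : SchwartzMap ℝ ℂ) : ∃ τ : ℝ → ℝ, Measurable τ ∧
    ∀ s : ℝ, ∀ t : Ioo (0 : ℝ) 1, ‖Tsin g t s‖ ≤ 2 * ‖Tsin g (τ s) s‖ := by
  obtain ⟨K, hK⟩ := Tsin_bdd g
  have : Nonempty (Ioo (0 : ℝ) 1) := ⟨⟨1 / 2, by norm_num, by norm_num⟩⟩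
  let d : ℕ → ℝ := fun n => (TopologicalSpace.denseSeq (Ioo (0 : ℝ) 1) n : ℝ)
  have hc := Tsin_continuous g
  have hcs : ∀ t, Continuous fun s => ‖Tsin g t s‖ := fun t =>
    (hc.comp (by fun_prop : Continuous fun s : ℝ => (t, s))).norm
  have hex : ∀ s, ∃ n, ∀ m, ‖Tsin g (d m) s‖ ≤ 2 * ‖Tsin g (d n) s‖ := by
    intro s
    have hbdd : BddAbove (range fun n => ‖Tsin g (d n) s‖) := ⟨K, by rintro _ ⟨n, rfl⟩; exact hK _ _⟩
    by_cases hM : (⨆ n, ‖Tsin g (d n) s‖) ≤ 0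
    · refine ⟨0, fun m => ?_⟩
      have := (le_ciSup hbdd m).trans hM
      have := norm_nonneg (Tsin g (d 0) s)
      beta_reduce at *
      linarith
    · push Not at hM
      obtain ⟨n, hn⟩ := exists_lt_of_lt_ciSup (half_lt_self hM)
      refine ⟨n, fun m => ?_⟩
      have := le_ciSup hbdd m
      beta_reduce at *
      linarith
  classical
  let N : ℝ → ℕ := fun s => Nat.find (hex s)
  have hNm : Measurable N := by
    refine measurable_find hex fun n => ?_
    simp only [ofPred_forall]
    refine MeasurableSet.iInter fun m => ?_
    exact measurableSet_le (hcs _).measurable ((hcs _).measurable.const_mul 2)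
  refine ⟨fun s => d (N s), (measurable_from_nat (f := d)).comp hNm, fun s t => ?_⟩
  have hcl : IsClosed {t : Ioo (0 : ℝ) 1 | ‖Tsin g t s‖ ≤ 2 * ‖Tsin g (d (N s)) s‖} := by
    refine isClosed_le ?_ continuous_const
    exact (hc.comp (by fun_prop : Continuous fun t : Ioo (0 : ℝ) 1 => ((t : ℝ), s))).norm
  refine DenseRange.induction_on (TopologicalSpace.denseRange_denseSeq (Ioo (0 : ℝ) 1)) t hcl ?_
  intro m
  exact Nat.find_spec (hex s) m

lemma sinh_le_exp_mul {s R : ℝ} (hs : 0 ≤ s) (hR : s ≤ R) : Real.sinh s ≤ Real.exp R * s := by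
  have h1 : Real.sinh s = Real.exp s * (1 - Real.exp (-(2 * s))) / 2 := by
    rw [Real.sinh_eq, mul_sub, mul_one, ← Real.exp_add]; ring_nf
  have h2 := Real.add_one_le_exp (-(2 * s))
  have h3 : Real.exp s ≤ Real.exp R := Real.exp_le_exp.mpr hR
  have h4 := Real.exp_pos s
  rw [h1]
  calc _ ≤ Real.exp s * (2 * s) / 2 := by gcongr; linarith
    _ = Real.exp s * s := by ring
    _ ≤ _ := by gcongr

lemma Ioo_eq_exp_image {R : ℝ} (hR : 0 < R) : Ioo 0 R = Real.exp '' Iio (Real.log R) := by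
  ext x
  constructor
  · rintro ⟨h0, h1⟩
    exact ⟨Real.log x, Real.log_lt_log h0 h1, Real.exp_log h0⟩
  · rintro ⟨y, hy, rfl⟩
    exact ⟨Real.exp_pos y, (Real.lt_log_iff_exp_lt hR).mp hy⟩

lemma radial_bound (α : ℝ) (h1 : 1 / 4 ≤ α) (h2 : α < 3 / 2) (q : ℝ) (hq : q = 6 / (3 - 2 * α)) (R : ℝ) (hR : 0 < R) :
    ∃ B : ℝ≥0∞, B ≠ ⊤ ∧ ∀ (g : SchwartzMap ℝ ℂ) (τ : ℝ → ℝ), Measurable τ →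
      eLpNorm (fun s => 2 * ‖Tsin g (τ s) s‖ / s) (ENNReal.ofReal q) (ballMeasure R) ≤
        B * ENNReal.ofReal (sobNorm α g) := by
  obtain ⟨B, hB, hC⟩ := core α h1 h2 q hq
  have h3 : 0 < 3 - 2 * α := by linarith
  have hq2 : 2 < q := by rw [hq, lt_div_iff₀ h3]; linarith
  have hq0 : 0 < q := by linarith
  have hqa : (3 / 2 - α) * q = 3 := by rw [hq]; field_simp; ring
  let c : ℝ≥0∞ := ENNReal.ofReal (Real.exp R ^ 2)
  refine ⟨c ^ (1 / q) * (2 * B), ?_, fun g τ hτ => ?_⟩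
  · have : c ^ (1 / q) ≠ ⊤ := ENNReal.rpow_ne_top_of_nonneg (by positivity) ENNReal.ofReal_ne_top
    finiteness
  have hTm : Measurable (fun s => Tsin g (τ s) s) := Tsin_measurable g hτ measurable_id
  let F : ℝ → ℝ := fun s => 2 * ‖Tsin g (τ s) s‖ / s
  have hFm : Measurable F := ((hTm.norm).const_mul 2).div measurable_id
  have hmain : ∫⁻ s, ‖F s‖ₑ ^ q ∂(ballMeasure R) ≤ c * (2 * B * ENNReal.ofReal (sobNorm α g)) ^ q := by
    unfold ballMeasure
    rw [lintegral_withDensity_eq_lintegral_mul _ (by fun_prop) (by fun_prop)]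
    simp only [Pi.mul_apply]
    calc _ ≤ ∫⁻ s in Ioo 0 R, c * (ENNReal.ofReal (s ^ 2) * ‖F s‖ₑ ^ q) := by
          refine setLIntegral_mono' measurableSet_Ioo fun s hs => ?_
          rw [← mul_assoc, ← ENNReal.ofReal_mul (by positivity)]
          gcongr
          rw [← mul_pow]
          have := sinh_le_exp_mul hs.1.le hs.2.le
          have h0 : 0 ≤ Real.sinh s := Real.sinh_nonneg_iff.mpr hs.1.le
          gcongr
      _ = c * ∫⁻ s in Ioo 0 R, ENNReal.ofReal (s ^ 2) * ‖F s‖ₑ ^ q := by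
          rw [lintegral_const_mul _ (by fun_prop)]
      _ ≤ c * (2 * B * ENNReal.ofReal (sobNorm α g)) ^ q := by
          gcongr
          rw [Ioo_eq_exp_image hR, lintegral_image_eq_lintegral_abs_deriv_mul measurableSet_Iio
            (fun y _ => (Real.hasDerivAt_exp y).hasDerivWithinAt) Real.exp_injective.injOn]
          have hp : ∀ y, ENNReal.ofReal |Real.exp y| * (ENNReal.ofReal (Real.exp y ^ 2) * ‖F (Real.exp y)‖ₑ ^ q) =
              2 ^ q * ENNReal.ofReal (Real.exp ((1 / 2 - α) * y) * ‖Tsin g (τ (Real.exp y)) (Real.exp y)‖) ^ q := by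
            intro y
            have hy := Real.exp_pos y
            have hF0 : 0 ≤ F (Real.exp y) := by simp only [F]; positivity
            rw [← ofReal_norm, Real.norm_of_nonneg hF0, abs_of_pos hy, ENNReal.ofReal_rpow_of_nonneg hF0 hq0.le,
              ← ENNReal.ofReal_mul (by positivity), ← ENNReal.ofReal_mul hy.le,
              ← ENNReal.mul_rpow_of_nonneg _ _ hq0.le, show (2 : ℝ≥0∞) = ENNReal.ofReal 2 by simp,
              ← ENNReal.ofReal_mul (by norm_num), ENNReal.ofReal_rpow_of_nonneg (by positivity) hq0.le]
            congr 1
            have e3 : Real.exp y * Real.exp y ^ 2 = (Real.exp ((3 / 2 - α) * y)) ^ q := by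
              rw [← Real.exp_mul, ← Real.exp_nat_mul, ← Real.exp_add]
              congr 1
              rw [show (3 / 2 - α) * y * q = ((3 / 2 - α) * q) * y by ring, hqa]; push_cast; ring
            rw [← mul_assoc, e3, ← Real.mul_rpow (by positivity) hF0]
            congr 1
            have e4 : Real.exp ((3 / 2 - α) * y) = Real.exp ((1 / 2 - α) * y) * Real.exp y := by
              rw [← Real.exp_add]; ring_nf
            simp only [F]
            rw [e4]
            field_simp
          simp_rw [hp]
          rw [lintegral_const_mul' _ _ (by finiteness), mul_assoc, ENNReal.mul_rpow_of_nonneg _ _ hq0.le]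
          gcongr
          exact hC g (Real.log R) (fun y => τ (Real.exp y)) (hτ.comp Real.measurable_exp)
  rw [eLpNorm_eq_lintegral_rpow_enorm_toReal (by simpa using hq0) ENNReal.ofReal_ne_top,
    ENNReal.toReal_ofReal hq0.le]
  calc _ ≤ (c * (2 * B * ENNReal.ofReal (sobNorm α g)) ^ q) ^ (1 / q) := by gcongr
    _ = _ := by
      rw [ENNReal.mul_rpow_of_nonneg _ _ (by positivity), ← ENNReal.rpow_mul, mul_one_div_cancel hq0.ne',
        ENNReal.rpow_one]
      ring

lemma ballMeasure_univ (R : ℝ) : ballMeasure R univ ≠ ⊤ := by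
  unfold ballMeasure
  rw [withDensity_apply _ MeasurableSet.univ, Measure.restrict_univ]
  have : ∫⁻ s in Ioo 0 R, ENNReal.ofReal (Real.sinh s ^ 2) ≤ ∫⁻ s in Ioo 0 R, ENNReal.ofReal (Real.sinh R ^ 2) := by
    refine setLIntegral_mono' measurableSet_Ioo fun s hs => ?_
    have h0 : 0 ≤ Real.sinh s := Real.sinh_nonneg_iff.mpr hs.1.le
    have h1 : Real.sinh s ≤ Real.sinh R := Real.sinh_le_sinh.mpr hs.2.le
    gcongr
  refine ne_top_of_le_ne_top ?_ this
  rw [setLIntegral_const, Real.volume_Ioo]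
  finiteness

lemma Sstar_le {g : SchwartzMap ℝ ℂ} {τ : ℝ → ℝ}
    (hτ : ∀ s : ℝ, ∀ t : Ioo (0 : ℝ) 1, ‖Tsin g t s‖ ≤ 2 * ‖Tsin g (τ s) s‖) {s : ℝ} (hs : 0 < s) :
    ‖Sstar g s‖ ≤ ‖2 * ‖Tsin g (τ s) s‖ / s‖ := by
  have : Nonempty (Ioo (0 : ℝ) 1) := ⟨⟨1 / 2, by norm_num, by norm_num⟩⟩
  have h0 : 0 ≤ Sstar g s := Real.iSup_nonneg fun t => norm_nonneg _
  have hsh : s ≤ Real.sinh s := Real.self_le_sinh_iff.mpr hs.le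
  rw [Real.norm_of_nonneg h0, Real.norm_of_nonneg (by positivity)]
  refine ciSup_le fun t => ?_
  rw [Sprop_norm _ _ _ hs]
  have := hτ s t
  gcongr


/-- Theorem 1.1(ii) on `ℍ³`, sufficiency: if `1/4 ≤ α < 3/2` and
`1 ≤ q ≤ 6/(3-2α)`, the local maximal estimate holds. -/
theorem schrodinger_maximal_sufficient_mid_range
    (α : ℝ) (hα1 : 1 / 4 ≤ α) (hα2 : α < 3 / 2)
    (q : ℝ≥0∞) (hq1 : 1 ≤ q) (hq2 : q ≤ ENNReal.ofReal (6 / (3 - 2 * α)))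
    (R : ℝ) (hR : 0 < R) :
    ∃ C : ℝ, 0 < C ∧ ∀ g : SchwartzMap ℝ ℂ, (∀ x, g (-x) = g x) →
      eLpNorm (Sstar ⇑g) q (ballMeasure R) ≤ ENNReal.ofReal (C * sobNorm α ⇑g) := by

  obtain ⟨B, hB, hrad⟩ := radial_bound α hα1 hα2 _ rfl R hR
  set q0 : ℝ := 6 / (3 - 2 * α) with hq0
  have hq0' : 0 < q0 := by
    have : 0 < 3 - 2 * α := by linarith
    positivity
  let m : ℝ≥0∞ := ballMeasure R univ ^ (1 / q.toReal - 1 / (ENNReal.ofReal q0).toReal)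
  have hqt : q ≠ ⊤ := ne_top_of_le_ne_top ENNReal.ofReal_ne_top hq2
  have hqp : 0 < q.toReal := ENNReal.toReal_pos (by positivity) hqt
  have hm : m ≠ ⊤ := by
    refine ENNReal.rpow_ne_top_of_nonneg ?_ (ballMeasure_univ R)
    rw [sub_nonneg]
    exact one_div_le_one_div_of_le hqp (ENNReal.toReal_mono ENNReal.ofReal_ne_top hq2)
  have hBm : B * m ≠ ⊤ := ENNReal.mul_ne_top hB hm
  refine ⟨(B * m).toReal + 1, by positivity, fun g _ => ?_⟩
  obtain ⟨τ, hτm, hτ⟩ := select g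
  have hFm : Measurable (fun s => 2 * ‖Tsin g (τ s) s‖ / s) := by
    have hTm : Measurable (fun s => Tsin g (τ s) s) :=
      Tsin_measurable g hτm measurable_id
    exact ((hTm.norm).const_mul 2).div measurable_id
  have hae : ∀ᵐ s ∂(ballMeasure R), ‖Sstar g s‖ ≤ ‖2 * ‖Tsin g (τ s) s‖ / s‖ := by
    refine (withDensity_absolutelyContinuous _ _).ae_le ?_
    refine (ae_restrict_iff' measurableSet_Ioo).mpr (Eventually.of_forall fun s hs => ?_)
    exact Sstar_le hτ hs.1
  calc eLpNorm (Sstar ⇑g) q (ballMeasure R) ≤ eLpNorm (fun s => 2 * ‖Tsin g (τ s) s‖ / s) q (ballMeasure R) :=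
        eLpNorm_mono_ae hae
    _ ≤ eLpNorm (fun s => 2 * ‖Tsin g (τ s) s‖ / s) (ENNReal.ofReal q0) (ballMeasure R) * m :=
        eLpNorm_le_eLpNorm_mul_rpow_measure_univ hq2 hFm.aestronglyMeasurable
    _ ≤ (B * ENNReal.ofReal (sobNorm α g)) * m := by gcongr; exact hrad g τ hτm
    _ = (B * m) * ENNReal.ofReal (sobNorm α g) := by ring
    _ ≤ ENNReal.ofReal ((B * m).toReal + 1) * ENNReal.ofReal (sobNorm α g) := by
        gcongr
        calc B * m = ENNReal.ofReal (B * m).toReal := (ENNReal.ofReal_toReal hBm).symm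
          _ ≤ _ := ENNReal.ofReal_le_ofReal (by linarith)
    _ = _ := by rw [ENNReal.ofReal_mul (by positivity)]
end

section
/- (Theorem 1.1(ii) on ℍ³, necessity.) Let 1/4 ≤ α < 3/2 and let q ∈ [1, ∞] satisfy q > 6/(3−2α). Then for every R > 0 there is no constant C > 0 such that ‖S*g‖_{L^q(B_R)} ≤ C ‖g‖_{H^α} for all even Schwartz functions g : ℝ → ℂ. -/
open MeasureTheory Filter Set ENNReal

lemma sprop_bdd (g : ℝ → ℂ) (s : ℝ) :
    BddAbove (Set.range fun t : Set.Ioo (0 : ℝ) 1 => ‖Sprop g (t : ℝ) s‖) := by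
  refine ⟨∫ l in Set.Ioi (0 : ℝ), ‖((Real.sin (l * s) / (l * Real.sinh s) : ℝ) : ℂ)
      * g l * ((l : ℂ) ^ 2)‖, ?_⟩
  rintro _ ⟨t, rfl⟩
  refine (norm_integral_le_integral_norm _).trans (le_of_eq ?_)
  refine integral_congr_ae (Eventually.of_forall fun l => ?_)
  have h : ‖Complex.exp (Complex.I * (((t : ℝ) * (l ^ 2 + 1) : ℝ) : ℂ))‖ = 1 := by
    rw [mul_comm]; exact Complex.norm_exp_ofReal_mul_I _
  simp only [norm_mul, h, mul_one]

lemma sinh_le_aux {s : ℝ} (h0 : 0 < s) (h1 : s ≤ 1) : Real.sinh s ≤ 3 / 2 * s := by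
  have h2 := Real.abs_exp_sub_one_sub_id_le (x := s) (by rw [abs_of_pos h0]; exact h1)
  have h3 := Real.add_one_le_exp (-s)
  have h4 := (abs_le.mp h2).2
  rw [Real.sinh_eq]
  nlinarith

/-- The cutoff. -/
noncomputable def cutoff (N : ℝ) (hN : 0 < N) : ContDiffBump (0 : ℝ) where
  rIn := N / 2
  rOut := N
  rIn_pos := by positivity
  rIn_lt_rOut := by linarith

/-- The test function. -/
noncomputable def testFun (N : ℝ) (hN : 0 < N) : ℝ → ℂ := fun l =>
  Complex.exp (-(Complex.I * (((1 / 2 : ℝ) * (l ^ 2 + 1) : ℝ) : ℂ))) * ((cutoff N hN l : ℝ) : ℂ)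

lemma testFun_norm (N : ℝ) (hN : 0 < N) (l : ℝ) : ‖testFun N hN l‖ = cutoff N hN l := by
  unfold testFun
  have h : ‖Complex.exp (-(Complex.I * (((1 / 2 : ℝ) * (l ^ 2 + 1) : ℝ) : ℂ)))‖ = 1 := by
    have := Complex.norm_exp_ofReal_mul_I (-((1 / 2 : ℝ) * (l ^ 2 + 1)))
    refine Eq.trans ?_ this
    refine congrArg (fun z => ‖Complex.exp z‖) ?_
    push_cast
    ring
  rw [norm_mul, h, one_mul, Complex.norm_real, Real.norm_of_nonneg (cutoff N hN).nonneg]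

lemma testFun_smooth (N : ℝ) (hN : 0 < N) : ContDiff ℝ (⊤ : ℕ∞) (testFun N hN) := by
  unfold testFun
  refine ContDiff.mul ?_ ?_
  · refine ContDiff.cexp (ContDiff.neg (contDiff_const.mul ?_))
    have h : ContDiff ℝ (⊤ : ℕ∞) (fun l : ℝ => (1 / 2 : ℝ) * (l ^ 2 + 1)) :=
      contDiff_const.mul ((contDiff_id.pow 2).add contDiff_const)
    exact Complex.ofRealCLM.contDiff.comp h
  · exact Complex.ofRealCLM.contDiff.comp (cutoff N hN).contDiff

lemma testFun_supp (N : ℝ) (hN : 0 < N) : HasCompactSupport (testFun N hN) := by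
  refine HasCompactSupport.mul_left ?_
  exact (cutoff N hN).hasCompactSupport.comp_left (g := fun x : ℝ => (x : ℂ)) (by simp)

lemma cutoff_zero (N : ℝ) (hN : 0 < N) {l : ℝ} (h : N ≤ l) : cutoff N hN l = 0 := by
  refine (cutoff N hN).zero_of_le_dist ?_
  simp only [Real.dist_eq, sub_zero]
  exact h.trans (le_abs_self l)

lemma cutoff_one (N : ℝ) (hN : 0 < N) {l : ℝ} (h0 : 0 ≤ l) (h : l ≤ N / 2) :
    cutoff N hN l = 1 := by
  refine (cutoff N hN).one_of_mem_closedBall ?_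
  simp only [Metric.mem_closedBall, Real.dist_eq, sub_zero, abs_of_nonneg h0]
  exact h

lemma sprop_eq (N : ℝ) (hN : 0 < N) (s : ℝ) :
    Sprop (testFun N hN) (1 / 2) s =
      ((∫ l in Set.Ioi (0 : ℝ), Real.sin (l * s) / Real.sinh s * l * cutoff N hN l : ℝ) : ℂ) := by
  unfold Sprop
  rw [← integral_complex_ofReal]
  refine setIntegral_congr_fun measurableSet_Ioi fun l hl => ?_
  have hl' : (l : ℂ) ≠ 0 := by exact_mod_cast (ne_of_gt hl)
  simp only [testFun, Complex.exp_neg]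
  have he := Complex.exp_ne_zero (Complex.I * (((1 / 2 : ℝ) * (l ^ 2 + 1) : ℝ) : ℂ))
  generalize Complex.exp (Complex.I * (((1 / 2 : ℝ) * (l ^ 2 + 1) : ℝ) : ℂ)) = E at he
  simp only [Complex.ofReal_mul, Complex.ofReal_div, RCLike.ofReal_mul, RCLike.ofReal_div,
    Complex.coe_algebraMap]
  generalize (Real.sinh s : ℂ) = S
  generalize (Real.sin (l * s) : ℂ) = T
  field_simp
  try rfl

lemma main_lower (N : ℝ) (hN : 1 ≤ N) (s : ℝ) (hs : 0 < s) (hsN : s < 1 / N) :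
    N ^ 3 / 128 ≤ ∫ l in Set.Ioi (0 : ℝ),
      Real.sin (l * s) / Real.sinh s * l * cutoff N (by linarith) l := by
  have hN0 : 0 < N := by linarith
  have hs1 : s ≤ 1 := hsN.le.trans (by rw [div_le_one hN0]; exact hN)
  have hNs : N * s < 1 := by rwa [lt_div_iff₀ hN0, mul_comm] at hsN
  have hsh : 0 < Real.sinh s := Real.sinh_pos_iff.2 hs
  set F : ℝ → ℝ := fun l => Real.sin (l * s) / Real.sinh s * l * cutoff N hN0 l with hF
  have key : ∀ l, 0 < l → l ≤ N → l / 2 ≤ Real.sin (l * s) / Real.sinh s := by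
    intro l hl hlN
    have hx : 0 < l * s := by positivity
    have hx1 : l * s ≤ 1 := by nlinarith
    have h1 := Real.sin_gt_sub_cube hx
    have h2 := sinh_le_aux hs hs1
    rw [le_div_iff₀ hsh]
    have h3 : (l * s) ^ 3 ≤ l * s := by
      have : (l * s) ^ 2 ≤ 1 := by nlinarith
      nlinarith
    nlinarith
  have hint : Integrable F := by
    refine Continuous.integrable_of_hasCompactSupport ?_ ?_
    · have := (cutoff N hN0).continuous
      fun_prop
    · exact (cutoff N hN0).hasCompactSupport.mul_left
  have hnn : ∀ l ∈ Set.Ioi (0 : ℝ), 0 ≤ F l := by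
    intro l hl
    have hl : 0 < l := hl
    by_cases h : l ≤ N
    · have := key l hl h
      have h2 := (cutoff N hN0).nonneg (x := l)
      have h3 : 0 ≤ Real.sin (l * s) / Real.sinh s := by linarith
      positivity
    · simp [hF, cutoff_zero N hN0 (le_of_not_ge h)]
  have hsub : Set.Ioc (N / 4) (N / 2) ⊆ Set.Ioi (0 : ℝ) := fun l hl => by
    have : N / 4 < l := hl.1
    show 0 < l
    linarith
  calc N ^ 3 / 128 = ∫ l in Set.Ioc (N / 4) (N / 2), N ^ 2 / 32 := by
        rw [setIntegral_const, Real.volume_real_Ioc_of_le (by linarith), smul_eq_mul]; ring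
    _ ≤ ∫ l in Set.Ioc (N / 4) (N / 2), F l := by
        refine setIntegral_mono_on (by simp) hint.integrableOn measurableSet_Ioc fun l hl => ?_
        have hl0 : 0 < l := hsub hl
        have h4 := hl.1
        have := key l hl0 (by linarith [hl.2])
        simp only [hF, cutoff_one N hN0 hl0.le hl.2, mul_one]
        nlinarith
    _ ≤ ∫ l in Set.Ioi (0 : ℝ), F l := by
        refine setIntegral_mono_set hint.integrableOn ?_ hsub.eventuallyLE
        exact (ae_restrict_iff' measurableSet_Ioi).2 (Eventually.of_forall hnn)

lemma sstar_lower (N : ℝ) (hN : 1 ≤ N) (s : ℝ) (hs : 0 < s) (hsN : s < 1 / N) :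
    N ^ 3 / 128 ≤ Sstar (testFun N (by linarith)) s := by
  have h1 := main_lower N hN s hs hsN
  have h2 := le_ciSup (sprop_bdd (testFun N (by linarith)) s) ⟨1 / 2, by norm_num, by norm_num⟩
  refine le_trans ?_ h2
  simp only []
  rw [sprop_eq, Complex.norm_real]
  exact h1.trans (le_abs_self _)

lemma sob_upper (α : ℝ) (hα : 0 ≤ α) (N : ℝ) (hN : 1 ≤ N) :
    sobNorm α (testFun N (by linarith)) ≤ 2 ^ (α / 2) * N ^ (3 / 2 + α) := by
  have hN0 : 0 < N := by linarith
  have hR : (2 : ℝ) ^ (α / 2) * N ^ (3 / 2 + α) =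
      ((2 * N ^ 2) ^ α * N ^ 2 * N) ^ ((1 : ℝ) / 2) := by
    have h1 : (2 * N ^ 2) ^ α * N ^ 2 * N = 2 ^ α * N ^ (2 * α + 3) := by
      rw [Real.mul_rpow (by positivity) (by positivity), Real.rpow_add hN0, Real.rpow_mul hN0.le]
      have h3 : N ^ (3 : ℝ) = N ^ 3 := by exact_mod_cast Real.rpow_natCast N 3
      have h2 : N ^ (2 : ℝ) = N ^ 2 := by exact_mod_cast Real.rpow_natCast N 2
      rw [h2, h3]
      ring
    rw [h1, Real.mul_rpow (by positivity) (by positivity), ← Real.rpow_mul (by norm_num),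
      ← Real.rpow_mul hN0.le]
    congr 2 <;> ring
  rw [hR]
  unfold sobNorm
  refine Real.rpow_le_rpow (integral_nonneg fun l => by positivity) ?_ (by norm_num)
  have : (2 * N ^ 2) ^ α * N ^ 2 * N =
      ∫ l in Set.Ioi (0 : ℝ), (Set.Ioc 0 N).indicator (fun _ => (2 * N ^ 2) ^ α * N ^ 2) l := by
    rw [setIntegral_indicator measurableSet_Ioc,
      Set.inter_eq_self_of_subset_right Set.Ioc_subset_Ioi_self, setIntegral_const,
      Real.volume_real_Ioc_of_le hN0.le, smul_eq_mul]
    ring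
  rw [this]
  refine integral_mono_of_nonneg (Eventually.of_forall fun l => by positivity) ?_ ?_
  · refine Integrable.integrableOn ?_
    rw [integrable_indicator_iff measurableSet_Ioc]
    exact integrableOn_const (by simp)
  · refine (ae_restrict_iff' measurableSet_Ioi).2 (Eventually.of_forall fun l hl => ?_)
    have hl : 0 < l := hl
    simp only [testFun_norm]
    by_cases h : l ≤ N
    · rw [Set.indicator_of_mem (show l ∈ Set.Ioc 0 N from ⟨hl, h⟩)]
      have h1 : (l ^ 2 + 1) ^ α ≤ (2 * N ^ 2) ^ α :=
        Real.rpow_le_rpow (by positivity) (by nlinarith) hα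
      have h2 := (cutoff N hN0).nonneg (x := l)
      have h3 := (cutoff N hN0).le_one (x := l)
      have h4 : (cutoff N hN0 l) ^ 2 ≤ 1 := by nlinarith
      have h5 : l ^ 2 ≤ N ^ 2 := by nlinarith
      calc _ ≤ (2 * N ^ 2) ^ α * 1 * N ^ 2 := by gcongr
        _ = _ := by ring
    · rw [cutoff_zero N hN0 (le_of_not_ge h)]
      simp only [ne_eq, OfNat.ofNat_ne_zero, not_false_eq_true, zero_pow, mul_zero, zero_mul]
      exact Set.indicator_nonneg (fun _ _ => by positivity) _

lemma ball_lower (R N : ℝ) (hN0 : 0 < N) (hR : 1 / N ≤ R) :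
    ENNReal.ofReal (1 / (8 * N ^ 3)) ≤ ballMeasure R (Set.Ioo 0 (1 / N)) := by
  unfold ballMeasure
  rw [withDensity_apply _ measurableSet_Ioo, Measure.restrict_restrict measurableSet_Ioo,
    Set.inter_eq_self_of_subset_left (Set.Ioo_subset_Ioo_right hR)]
  have hsub : Set.Ioo (1 / (2 * N)) (1 / N) ⊆ Set.Ioo 0 (1 / N) :=
    Set.Ioo_subset_Ioo_left (by positivity)
  calc ENNReal.ofReal (1 / (8 * N ^ 3))
      = ∫⁻ s in Set.Ioo (1 / (2 * N)) (1 / N), ENNReal.ofReal ((1 / (2 * N)) ^ 2) := by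
        rw [setLIntegral_const, Real.volume_Ioo, ← ENNReal.ofReal_mul (by positivity)]
        congr 1
        field_simp
        ring
    _ ≤ ∫⁻ s in Set.Ioo (1 / (2 * N)) (1 / N), ENNReal.ofReal (Real.sinh s ^ 2) := by
        refine setLIntegral_mono' measurableSet_Ioo fun s hs => ?_
        refine ENNReal.ofReal_le_ofReal ?_
        have h0 : 0 < 1 / (2 * N) := by positivity
        have h1 : s ≤ Real.sinh s := Real.self_le_sinh_iff.2 (h0.trans hs.1).le
        exact pow_le_pow_left₀ h0.le (hs.1.le.trans h1) 2
    _ ≤ _ := lintegral_mono_set hsub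

/-- Theorem 1.1(ii) on `ℍ³`, necessity: if `1/4 ≤ α < 3/2` and `q > 6/(3-2α)`,
the local maximal estimate fails. -/
theorem schrodinger_maximal_necessary_mid_range
    (α : ℝ) (hα1 : 1 / 4 ≤ α) (hα2 : α < 3 / 2)
    (q : ℝ≥0∞) (hq1 : 1 ≤ q) (hq2 : ENNReal.ofReal (6 / (3 - 2 * α)) < q)
    (R : ℝ) (hR : 0 < R) :
    ¬ ∃ C : ℝ, 0 < C ∧ ∀ g : SchwartzMap ℝ ℂ, (∀ x, g (-x) = g x) →
      eLpNorm (Sstar ⇑g) q (ballMeasure R) ≤ ENNReal.ofReal (C * sobNorm α ⇑g) := by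
  rintro ⟨C, hC, H⟩
  have hα0 : 0 ≤ α := by linarith
  have hd : 0 < 3 - 2 * α := by linarith
  have hq0 : q ≠ 0 := fun h => by simp [h] at hq1
  set e : ℝ := 1 / q.toReal with he
  have he0 : 0 ≤ e := by positivity
  have he1 : 0 < 3 / 2 - α - 3 * e := by
    by_cases hq : q = ∞
    · simp [he, hq]; linarith
    · have h1 : 6 / (3 - 2 * α) < q.toReal := by
        rwa [← ENNReal.ofReal_lt_iff_lt_toReal (by positivity) hq]
      have h2 : 0 < q.toReal := lt_trans (by positivity) h1
      rw [div_lt_iff₀ hd] at h1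
      have h3 : e * q.toReal = 1 := by rw [he]; field_simp
      by_contra hcon
      push Not at hcon
      nlinarith
  have bound : ∀ N : ℝ, 1 ≤ N → 1 / R ≤ N →
      N ^ (3 / 2 - α - 3 * e) ≤ 128 * 8 ^ e * (C * 2 ^ (α / 2)) := by
    intro N hN hNR
    have hN0 : 0 < N := by linarith
    have hR' : 1 / N ≤ R := by
      rw [div_le_iff₀ hR] at hNR
      rw [div_le_iff₀ hN0]; linarith
    have h1 := H ((testFun_supp N hN0).toSchwartzMap (testFun_smooth N hN0)) (by
      intro x
      show testFun N hN0 (-x) = testFun N hN0 x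
      simp only [testFun, neg_sq, (cutoff N hN0).neg])
    change eLpNorm (Sstar (testFun N hN0)) q (ballMeasure R) ≤
      ENNReal.ofReal (C * sobNorm α (testFun N hN0)) at h1
    have hb := ball_lower R N hN0 hR'
    have hb0 : ballMeasure R (Set.Ioo 0 (1 / N)) ≠ 0 := by
      intro h
      rw [h] at hb
      have : (0 : ℝ) < 1 / (8 * N ^ 3) := by positivity
      simp only [nonpos_iff_eq_zero, ENNReal.ofReal_eq_zero] at hb
      linarith
    have h2 : eLpNorm ((Set.Ioo 0 (1 / N)).indicator fun _ : ℝ => N ^ 3 / 128) q (ballMeasure R)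
        ≤ eLpNorm (Sstar (testFun N hN0)) q (ballMeasure R) := by
      refine eLpNorm_mono_real fun s => ?_
      by_cases hs : s ∈ Set.Ioo 0 (1 / N)
      · rw [Set.indicator_of_mem hs, Real.norm_of_nonneg (by positivity)]
        exact sstar_lower N hN s hs.1 hs.2
      · rw [Set.indicator_of_notMem hs, norm_zero]
        exact Real.iSup_nonneg fun _ => norm_nonneg _
    rw [eLpNorm_indicator_const' measurableSet_Ioo hb0 hq0] at h2
    have h3 : ENNReal.ofReal (N ^ 3 / 128 * (1 / (8 * N ^ 3)) ^ e) ≤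
        ENNReal.ofReal (C * (2 ^ (α / 2) * N ^ (3 / 2 + α))) := by
      calc _ = ‖N ^ 3 / 128‖ₑ * ENNReal.ofReal (1 / (8 * N ^ 3)) ^ e := by
            rw [ENNReal.ofReal_mul (by positivity), Real.enorm_of_nonneg (by positivity),
              ENNReal.ofReal_rpow_of_nonneg (by positivity) he0]
        _ ≤ ‖N ^ 3 / 128‖ₑ * ballMeasure R (Set.Ioo 0 (1 / N)) ^ e := by gcongr
        _ ≤ _ := h2.trans h1
        _ ≤ _ := ENNReal.ofReal_le_ofReal
            (mul_le_mul_of_nonneg_left (sob_upper α hα0 N hN) hC.le)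
    rw [ENNReal.ofReal_le_ofReal_iff (by positivity)] at h3
    have h4 : (1 / (8 * N ^ 3)) ^ e = (8 ^ e)⁻¹ * (N ^ (3 * e))⁻¹ := by
      rw [one_div, Real.inv_rpow (by positivity), Real.mul_rpow (by norm_num) (by positivity),
        mul_inv, ← Real.rpow_natCast, ← Real.rpow_mul hN0.le]
      norm_num
    have h5 : N ^ (3 / 2 - α - 3 * e) = N ^ 3 * (N ^ (3 * e))⁻¹ * (N ^ (3 / 2 + α))⁻¹ := by
      rw [← Real.rpow_natCast, ← Real.rpow_neg hN0.le, ← Real.rpow_neg hN0.le,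
        ← Real.rpow_add hN0, ← Real.rpow_add hN0]
      congr 1; push_cast; ring
    rw [h4] at h3
    rw [h5]
    have hx : 0 < N ^ (3 / 2 + α) := by positivity
    have hy : (0 : ℝ) < 8 ^ e := by positivity
    rw [← div_eq_mul_inv, div_le_iff₀ hx]
    calc N ^ 3 * (N ^ (3 * e))⁻¹
        = 128 * 8 ^ e * (N ^ 3 / 128 * ((8 ^ e)⁻¹ * (N ^ (3 * e))⁻¹)) := by field_simp
      _ ≤ 128 * 8 ^ e * (C * (2 ^ (α / 2) * N ^ (3 / 2 + α))) := by gcongr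
      _ = _ := by ring
  obtain ⟨N, h1, h2, h3⟩ := ((eventually_ge_atTop (1 : ℝ)).and ((eventually_ge_atTop (1 / R)).and
    ((tendsto_rpow_atTop he1).eventually_gt_atTop (128 * 8 ^ e * (C * 2 ^ (α / 2)))))).exists
  exact absurd (bound N h1 h2) (not_le.2 h3)
end

section
/- (Theorem 1.1(iii) on ℍ³, sufficiency.) Let α = 3/2 and let q ∈ [1, ∞). Then for every R > 0 there is a constant C > 0 (depending only on q and R) such that ‖S*g‖_{L^q(B_R)} ≤ C ‖g‖_{H^{3/2}} for all even Schwartz functions g : ℝ → ℂ. -/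
open MeasureTheory Filter Set ENNReal

lemma aux_h_memLp (g : SchwartzMap ℝ ℂ) :
    MemLp (fun l : ℝ => (l ^ 2 + 1) ^ ((3 : ℝ) / 4) * ‖g l‖ * l) 2 (volume.restrict (Ioi (0 : ℝ))) := by
  have hcont : Continuous (fun l : ℝ => (l ^ 2 + 1) ^ ((3 : ℝ) / 4) * ‖g l‖ * l) := by
    have hg := g.continuous
    have h1 : Continuous (fun l : ℝ => (l ^ 2 + 1) ^ ((3 : ℝ) / 4)) :=
      Continuous.rpow_const (by fun_prop) (fun x => Or.inl (by positivity))
    fun_prop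
  rw [memLp_two_iff_integrable_sq hcont.aestronglyMeasurable]
  obtain ⟨C0, hC0⟩ := g.decay 0 0
  obtain ⟨C4, hC4⟩ := g.decay 4 0
  set K := 2 * (C0 + C4) with hK
  have hb : ∀ x : ℝ, ‖g x‖ * (1 + x ^ 2) ^ 2 ≤ K := by
    intro x
    have h0 := hC0.2 x
    have h4 := hC4.2 x
    simp only [pow_zero, one_mul, norm_iteratedFDeriv_zero, Real.norm_eq_abs] at h0 h4
    rw [show |x| ^ 4 = x ^ 4 from by rw [show 4 = 2 * 2 from rfl, pow_mul, sq_abs, ← pow_mul]] at h4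
    have hn := norm_nonneg (g x)
    nlinarith [mul_nonneg hn (sq_nonneg (x ^ 2 - 1))]
  have hint : Integrable (fun x : ℝ => K ^ 2 * (1 + x ^ 2)⁻¹) := integrable_inv_one_add_sq.const_mul _
  refine (Integrable.mono' hint (hcont.pow 2).aestronglyMeasurable ?_).restrict
  refine Eventually.of_forall fun x => ?_
  have hpos : (0 : ℝ) < 1 + x ^ 2 := by positivity
  have h1 : (x ^ 2 + 1) ^ ((3 : ℝ) / 4) ≤ 1 + x ^ 2 := by
    rw [add_comm (x ^ 2)]
    calc (1 + x ^ 2) ^ ((3 : ℝ) / 4) ≤ (1 + x ^ 2) ^ (1 : ℝ) :=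
          Real.rpow_le_rpow_of_exponent_le (by nlinarith [sq_nonneg x]) (by norm_num)
      _ = _ := Real.rpow_one _
  have h0 : 0 ≤ (x ^ 2 + 1) ^ ((3 : ℝ) / 4) := by positivity
  change ‖((x ^ 2 + 1) ^ ((3 : ℝ) / 4) * ‖g x‖ * x) ^ 2‖ ≤ _
  rw [Real.norm_of_nonneg (sq_nonneg _), ← div_eq_mul_inv, le_div_iff₀ hpos]
  calc ((x ^ 2 + 1) ^ ((3 : ℝ) / 4) * ‖g x‖ * x) ^ 2 * (1 + x ^ 2)
      = ((x ^ 2 + 1) ^ ((3 : ℝ) / 4)) ^ 2 * ‖g x‖ ^ 2 * (x ^ 2 * (1 + x ^ 2)) := by ring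
    _ ≤ (1 + x ^ 2) ^ 2 * ‖g x‖ ^ 2 * ((1 + x ^ 2) * (1 + x ^ 2)) := by
        gcongr
        linarith
    _ = (‖g x‖ * (1 + x ^ 2) ^ 2) ^ 2 := by ring
    _ ≤ K ^ 2 := pow_le_pow_left₀ (by positivity) (hb x) 2

lemma aux_f_memLp (e : ℝ) (he : 0 < e) :
    MemLp (fun l : ℝ => (l ^ 2 + 1) ^ (-(1 + e) / 4)) 2 (volume.restrict (Ioi (0 : ℝ))) := by
  have hcont : Continuous (fun l : ℝ => (l ^ 2 + 1) ^ (-(1 + e) / 4)) :=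
      Continuous.rpow_const (by fun_prop) (fun x => Or.inl (by positivity))
  rw [memLp_two_iff_integrable_sq hcont.aestronglyMeasurable]
  have := integrable_rpow_neg_one_add_norm_sq (E := ℝ) (μ := volume) (r := 1 + e) (by simp [he])
  refine (this.congr (Eventually.of_forall fun x => ?_)).restrict
  simp only [Real.norm_eq_abs, sq_abs]
  rw [← Real.rpow_natCast ((x ^ 2 + 1) ^ (-(1 + e) / 4)) 2, ← Real.rpow_mul (by positivity), add_comm]
  congr 1
  push_cast
  ring

lemma aux_kernel (e l s : ℝ) (he : 0 < e) (he1 : e ≤ 1) (hl : 0 < l) (hs : 0 < s) :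
    |Real.sin (l * s) / (l * Real.sinh s)| * l ≤
      s ^ (-(e / 2)) * (l ^ 2 + 1) ^ (-(1 + e) / 4) * (l ^ 2 + 1) ^ ((3 : ℝ) / 4) := by
  have hsh : s ≤ Real.sinh s := Real.self_le_sinh_iff.2 hs.le
  have hsin : |Real.sin (l * s)| ≤ (l * s) ^ (1 - e / 2) := by
    have hls : 0 < l * s := by positivity
    rcases le_total (l * s) 1 with h | h
    · calc |Real.sin (l * s)| ≤ |l * s| := Real.abs_sin_le_abs
        _ = (l * s) ^ (1 : ℝ) := by rw [abs_of_pos hls, Real.rpow_one]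
        _ ≤ _ := Real.rpow_le_rpow_of_exponent_ge hls h (by linarith)
    · exact (Real.abs_sin_le_one _).trans (Real.one_le_rpow h (by linarith))
  have hl2 : l ^ (1 - e / 2) ≤ (l ^ 2 + 1) ^ ((1 - e / 2) / 2) := by
    calc l ^ (1 - e / 2) = (l ^ 2) ^ ((1 - e / 2) / 2) := by
          rw [← Real.rpow_natCast l 2, ← Real.rpow_mul hl.le]; congr 1; push_cast; ring
      _ ≤ _ := Real.rpow_le_rpow (by positivity) (by linarith) (by linarith)
  have hshp : 0 < Real.sinh s := hs.trans_le hsh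
  calc |Real.sin (l * s) / (l * Real.sinh s)| * l = |Real.sin (l * s)| / Real.sinh s := by
        rw [abs_div, abs_of_pos (mul_pos hl hshp)]; field_simp
    _ ≤ (l * s) ^ (1 - e / 2) / s := by gcongr
    _ = s ^ (-(e / 2)) * l ^ (1 - e / 2) := by
        rw [Real.mul_rpow hl.le hs.le, div_eq_iff hs.ne', mul_comm (l ^ _),
          show 1 - e / 2 = -(e / 2) + 1 by ring, Real.rpow_add_one hs.ne']
        ring
    _ ≤ s ^ (-(e / 2)) * (l ^ 2 + 1) ^ ((1 - e / 2) / 2) := by gcongr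
    _ = _ := by
        rw [mul_assoc, ← Real.rpow_add (by positivity)]
        congr 2
        ring

lemma aux_pointwise (e : ℝ) (he : 0 < e) (he1 : e ≤ 1) (g : SchwartzMap ℝ ℂ) (t s : ℝ) (hs : 0 < s) :
    ‖Sprop g t s‖ ≤ s ^ (-(e / 2)) *
      ((∫ l in Ioi (0 : ℝ), ((l ^ 2 + 1) ^ (-(1 + e) / 4)) ^ (2 : ℝ)) ^ ((1 : ℝ) / 2)
        * sobNorm (3 / 2) g) := by
  have hf := aux_f_memLp e he
  have hh := aux_h_memLp g
  have hint := (MemLp.integrable_mul hf hh).const_mul (s ^ (-(e / 2)))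
  have hH := integral_mul_le_Lp_mul_Lq_of_nonneg (μ := volume.restrict (Ioi (0 : ℝ)))
    (f := fun l : ℝ => (l ^ 2 + 1) ^ (-(1 + e) / 4))
    (g := fun l : ℝ => (l ^ 2 + 1) ^ ((3 : ℝ) / 4) * ‖g l‖ * l) (p := 2) (q := 2)
    (by constructor <;> norm_num)
    (Eventually.of_forall fun l => by positivity)
    (by
      filter_upwards [ae_restrict_mem measurableSet_Ioi] with l hl
      have : (0 : ℝ) < l := hl
      positivity)
    (by simpa using hf) (by simpa using hh)
  have hsob : sobNorm (3 / 2) g = (∫ l in Ioi (0 : ℝ),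
      ((l ^ 2 + 1) ^ ((3 : ℝ) / 4) * ‖g l‖ * l) ^ (2 : ℝ)) ^ ((1 : ℝ) / 2) := by
    unfold sobNorm
    congr 2
    ext l
    rw [Real.rpow_two, mul_pow, mul_pow, ← Real.rpow_natCast ((l ^ 2 + 1) ^ ((3 : ℝ) / 4)) 2,
      ← Real.rpow_mul (by positivity)]
    norm_num
  rw [hsob]
  refine le_trans ?_ (mul_le_mul_of_nonneg_left hH (by positivity))
  rw [← integral_const_mul]
  refine norm_integral_le_of_norm_le hint ?_
  filter_upwards [ae_restrict_mem measurableSet_Ioi] with l hl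
  have hl : (0 : ℝ) < l := hl
  have hk := aux_kernel e l s he he1 hl hs
  rw [norm_mul, norm_mul, norm_mul, Complex.norm_real, mul_comm Complex.I, Complex.norm_exp_ofReal_mul_I,
    norm_pow, Complex.norm_real, Real.norm_eq_abs, Real.norm_eq_abs, abs_of_pos hl]
  calc _ = (|Real.sin (l * s) / (l * Real.sinh s)| * l) * (‖g l‖ * l) := by ring
    _ ≤ _ := mul_le_mul_of_nonneg_right hk (by positivity)
    _ = _ := by ring

lemma aux_memLp (q : ℝ≥0∞) (hq1 : 1 ≤ q) (hq2 : q ≠ ⊤) (R : ℝ) :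
    MemLp (fun s : ℝ => s ^ (-(1 / q.toReal / 2))) q (ballMeasure R) := by
  have hq0 : q ≠ 0 := (zero_lt_one.trans_le hq1).ne'
  have hp : 0 < q.toReal := ENNReal.toReal_pos hq0 hq2
  have hmeas : Measurable (fun s : ℝ => s ^ (-(1 / q.toReal / 2))) := by fun_prop
  have hle : ballMeasure R ≤ ENNReal.ofReal (Real.sinh R ^ 2) • volume.restrict (Ioo 0 R) := by
    rw [← withDensity_const]
    refine withDensity_mono ?_
    filter_upwards [ae_restrict_mem measurableSet_Ioo] with s hs
    exact ENNReal.ofReal_le_ofReal (pow_le_pow_left₀ (Real.sinh_nonneg_iff.2 hs.1.le)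
      (Real.sinh_le_sinh.2 hs.2.le) 2)
  refine MemLp.mono_measure hle (MemLp.smul_measure ?_ ENNReal.ofReal_ne_top)
  rw [← integrable_norm_rpow_iff hmeas.aestronglyMeasurable hq0 hq2]
  rcases le_or_gt R 0 with h | hR
  · simp [Ioo_eq_empty (not_lt.2 h)]
  have := (intervalIntegral.integrableOn_Ioo_rpow_iff (s := -(1 / 2)) hR).2 (by norm_num)
  refine Integrable.congr this ?_
  filter_upwards [ae_restrict_mem measurableSet_Ioo] with s hs
  rw [Real.norm_of_nonneg (Real.rpow_nonneg hs.1.le _), ← Real.rpow_mul hs.1.le]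
  congr 1
  field_simp

/-- Theorem 1.1(iii) on `ℍ³`, sufficiency: at `α = 3/2` the local maximal
estimate holds for every finite `q ∈ [1, ∞)`. -/
theorem schrodinger_maximal_sufficient_critical
    (q : ℝ≥0∞) (hq1 : 1 ≤ q) (hq2 : q ≠ ⊤)
    (R : ℝ) (hR : 0 < R) :
    ∃ C : ℝ, 0 < C ∧ ∀ g : SchwartzMap ℝ ℂ, (∀ x, g (-x) = g x) →
      eLpNorm (Sstar ⇑g) q (ballMeasure R) ≤ ENNReal.ofReal (C * sobNorm (3 / 2) ⇑g) := by
  have hq0 : q ≠ 0 := (zero_lt_one.trans_le hq1).ne'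
  have hp : 0 < q.toReal := ENNReal.toReal_pos hq0 hq2
  have hp1 : 1 ≤ q.toReal := by simpa using ENNReal.toReal_mono hq2 hq1
  set e : ℝ := 1 / q.toReal with he_def
  have he : 0 < e := by positivity
  have he1 : e ≤ 1 := by rw [he_def, div_le_one hp]; exact hp1
  have hM : MemLp (fun s : ℝ => s ^ (-(e / 2))) q (ballMeasure R) := aux_memLp q hq1 hq2 R
  set A : ℝ := (∫ l in Ioi (0 : ℝ), ((l ^ 2 + 1) ^ (-(1 + e) / 4)) ^ (2 : ℝ)) ^ ((1 : ℝ) / 2)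
    with hA
  have hA0 : 0 ≤ A := Real.rpow_nonneg (integral_nonneg fun l => by positivity) _
  set B := (eLpNorm (fun s : ℝ => s ^ (-(e / 2))) q (ballMeasure R)).toReal with hB
  have hB0 : 0 ≤ B := ENNReal.toReal_nonneg
  refine ⟨A * B + 1, by positivity, fun g _ => ?_⟩
  have hN : 0 ≤ sobNorm (3 / 2) g :=
    Real.rpow_nonneg (integral_nonneg fun l => by positivity) _
  have hae : ∀ᵐ s ∂(ballMeasure R), ‖Sstar g s‖ ≤ (A * sobNorm (3 / 2) g) * s ^ (-(e / 2)) := by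
    have h0 : ∀ᵐ s ∂(volume.restrict (Ioo 0 R)), s ∈ Ioo 0 R := ae_restrict_mem measurableSet_Ioo
    have h1 : ∀ᵐ s ∂(ballMeasure R), s ∈ Ioo 0 R := (withDensity_absolutelyContinuous _ _).ae_le h0
    filter_upwards [h1] with s hs
    have hs0 : 0 < s := hs.1
    unfold Sstar
    rw [Real.norm_of_nonneg (Real.iSup_nonneg fun t => norm_nonneg _)]
    refine Real.iSup_le (fun t => ?_) (by positivity)
    rw [mul_comm]
    exact aux_pointwise e he he1 g t s hs0
  calc eLpNorm (Sstar g) q (ballMeasure R)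
      ≤ eLpNorm (fun s : ℝ => (A * sobNorm (3 / 2) g) * s ^ (-(e / 2))) q (ballMeasure R) :=
        eLpNorm_mono_ae_real hae
    _ = ENNReal.ofReal (A * sobNorm (3 / 2) g) * ENNReal.ofReal B := by
        rw [hB, ENNReal.ofReal_toReal hM.eLpNorm_lt_top.ne]
        have := eLpNorm_const_smul (A * sobNorm (3 / 2) g) (fun s : ℝ => s ^ (-(e / 2))) q (ballMeasure R)
        rw [Real.enorm_of_nonneg (by positivity)] at this
        exact this
    _ ≤ _ := by
        rw [← ENNReal.ofReal_mul (by positivity)]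
        refine ENNReal.ofReal_le_ofReal ?_
        nlinarith
end

section
/- (Theorem 1.1(iii) on ℍ³, failure at q = ∞.) For every R > 0 there is no constant C > 0 such that ‖S*g‖_{L^∞(B_R)} ≤ C ‖g‖_{H^{3/2}} for all even Schwartz functions g : ℝ → ℂ. -/
open MeasureTheory Filter Set ENNReal

lemma ker_lower {l s : ℝ} (hl : 0 < l) (hs : 0 < s) (hs2 : s ≤ 1 / 2) (hls : l * s ≤ 1) :
    1 / 2 ≤ Real.sin (l * s) / (l * Real.sinh s) := by
  have hsh : 0 < Real.sinh s := Real.sinh_pos_iff.2 hs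
  have h1 := Real.sin_gt_sub_cube (mul_pos hl hs)
  have hx : 0 < l * s := mul_pos hl hs
  have h2 : Real.sinh s ≤ 3 / 2 * s := by
    rw [Real.sinh_eq]
    have a := (abs_le.1 (Real.abs_exp_sub_one_sub_id_le (x := s) (by rw [abs_of_pos hs]; linarith))).2
    have b := (abs_le.1 (Real.abs_exp_sub_one_sub_id_le (x := -s)
      (by rw [abs_neg, abs_of_pos hs]; linarith))).1
    nlinarith
  rw [le_div_iff₀ (by positivity)]
  have h3 : (l * s) ^ 3 ≤ l * s := by
    have : (l * s) ^ 2 ≤ 1 := by nlinarith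
    nlinarith
  nlinarith [mul_le_mul_of_nonneg_left h2 hl.le]

lemma integrand_eq (h : ℝ → ℝ) (t s l : ℝ) :
    ((Real.sin (l * s) / (l * Real.sinh s) : ℝ) : ℂ)
      * Complex.exp (Complex.I * ((t * (l ^ 2 + 1) : ℝ) : ℂ))
      * ((h l : ℝ) : ℂ) * ((l : ℂ) ^ 2)
    = ((h l : ℝ) : ℂ) * (((Real.sin (l * s) * l / Real.sinh s : ℝ) : ℂ)
      * Complex.exp (Complex.I * ((t * (l ^ 2 + 1) : ℝ) : ℂ))) := by
  have : Real.sin (l * s) / (l * Real.sinh s) * l ^ 2 = Real.sin (l * s) * l / Real.sinh s := by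
    rcases eq_or_ne l 0 with rfl | hl
    · simp
    · field_simp
  rw [← this]
  push_cast
  ring

lemma integrand_integrable (h : ℝ → ℝ) (hc : Continuous h) (hcs : HasCompactSupport h) (t s : ℝ) :
    Integrable (fun l : ℝ => ((Real.sin (l * s) / (l * Real.sinh s) : ℝ) : ℂ)
      * Complex.exp (Complex.I * ((t * (l ^ 2 + 1) : ℝ) : ℂ))
      * ((h l : ℝ) : ℂ) * ((l : ℂ) ^ 2)) := by
  simp_rw [integrand_eq]
  apply Continuous.integrable_of_hasCompactSupport
  · fun_prop
  · exact (hcs.comp_left (g := fun x : ℝ => (x : ℂ)) (by simp)).mul_right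

lemma Sprop_lower_s8 (h : ℝ → ℝ) (hc : Continuous h) (hcs : HasCompactSupport h)
    (h0 : ∀ l, 0 ≤ h l) {M : ℝ} (hM : 0 < M) (hz : ∀ l, M ≤ l → h l = 0) {s : ℝ} (hs : 0 < s)
    (hs2 : s ≤ 1 / 2) (hMs : M * s ≤ 1) :
    (∫ l in Set.Ioi (0 : ℝ), h l * l ^ 2) / 4
      ≤ ‖Sprop (fun l => ((h l : ℝ) : ℂ)) (1 / (M ^ 2 + 1)) s‖ := by
  refine le_trans ?_ (Complex.re_le_norm _)
  have hi := (integrand_integrable h hc hcs (1 / (M ^ 2 + 1)) s).integrableOn (s := Set.Ioi (0 : ℝ))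
  have hre := integral_re hi
  simp only [RCLike.re_to_complex] at hre
  unfold Sprop
  rw [← hre, ← integral_div]
  apply setIntegral_mono_on
  · apply Integrable.integrableOn
    apply Integrable.div_const
    apply Continuous.integrable_of_hasCompactSupport
    · fun_prop
    · exact hcs.mul_right
  · exact hi.re
  · exact measurableSet_Ioi
  · intro l hl
    have hl : 0 < l := hl
    by_cases hlM : M ≤ l
    · simp [hz l hlM]
    push Not at hlM
    have hk := ker_lower hl hs hs2 (le_trans (by gcongr) hMs)
    have hcos : 1 / 2 ≤ Real.cos (1 / (M ^ 2 + 1) * (l ^ 2 + 1)) := by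
      have h1 := Real.one_sub_sq_div_two_le_cos (x := 1 / (M ^ 2 + 1) * (l ^ 2 + 1))
      have h2 : 1 / (M ^ 2 + 1) * (l ^ 2 + 1) ≤ 1 := by
        rw [one_div, inv_mul_le_iff₀ (by positivity)]
        nlinarith
      have h3 : 0 ≤ 1 / (M ^ 2 + 1) * (l ^ 2 + 1) := by positivity
      nlinarith
    set k := Real.sin (l * s) / (l * Real.sinh s)
    set a := 1 / (M ^ 2 + 1) * (l ^ 2 + 1)
    have e : ((k : ℂ) * Complex.exp (Complex.I * (a : ℂ)) * (h l : ℂ) * (l : ℂ) ^ 2)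
        = ((k * h l * l ^ 2 : ℝ) : ℂ) * Complex.exp ((a : ℂ) * Complex.I) := by
      push_cast
      rw [mul_comm Complex.I]
      ring
    rw [e, Complex.re_ofReal_mul, Complex.exp_ofReal_mul_I_re]
    have h4 : 1 / 4 ≤ k * Real.cos a := by nlinarith
    have h5 : 0 ≤ h l * l ^ 2 := mul_nonneg (h0 l) (by positivity)
    nlinarith

lemma Sprop_bdd (h : ℝ → ℝ) (s : ℝ) :
    BddAbove (Set.range fun t : Set.Ioo (0 : ℝ) 1 => ‖Sprop (fun l => ((h l : ℝ) : ℂ)) (t : ℝ) s‖) := by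
  refine ⟨∫ l in Set.Ioi (0 : ℝ), ‖((Real.sin (l * s) / (l * Real.sinh s) : ℝ) : ℂ)
      * ((h l : ℝ) : ℂ) * ((l : ℂ) ^ 2)‖, ?_⟩
  rintro _ ⟨t, rfl⟩
  refine (norm_integral_le_integral_norm _).trans (le_of_eq ?_)
  congr 1
  ext l
  simp only [norm_mul]
  rw [mul_comm Complex.I, Complex.norm_exp_ofReal_mul_I, mul_one]

lemma key (R : ℝ) (hR : 0 < R) (h : ℝ → ℝ) (hc : Continuous h) (hcs : HasCompactSupport h)
    (h0 : ∀ l, 0 ≤ h l) {M : ℝ} (hM : 0 < M) (hz : ∀ l, M ≤ l → h l = 0) (K : ℝ) (hK : 0 ≤ K)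
    (hle : eLpNorm (Sstar (fun l => ((h l : ℝ) : ℂ))) ⊤ (ballMeasure R) ≤ ENNReal.ofReal K) :
    (∫ l in Set.Ioi (0 : ℝ), h l * l ^ 2) / 4 ≤ K := by
  rw [eLpNorm_exponent_top] at hle
  have hae := ae_le_eLpNormEssSup (f := Sstar (fun l => ((h l : ℝ) : ℂ))) (μ := ballMeasure R)
  have hme : Measurable (fun s => ENNReal.ofReal (Real.sinh s ^ 2)) := by fun_prop
  rw [ballMeasure, ae_withDensity_iff hme, ae_restrict_iff' measurableSet_Ioo] at hae
  set δ := min R (min (1 / 2) (1 / M))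
  have hδ : 0 < δ := by positivity
  have hpos : ¬ (∀ᵐ s : ℝ, s ∉ Set.Ioo 0 δ) := by
    intro hh
    have : volume (Set.Ioo 0 δ) = 0 := by
      rw [measure_eq_zero_iff_ae_notMem]; exact hh
    simp at this
    linarith
  by_contra hcon
  push Not at hcon
  apply hpos
  filter_upwards [hae] with s hs hsm
  obtain ⟨hs0, hsδ⟩ := hsm
  have hsR : s < R := lt_of_lt_of_le hsδ (min_le_left _ _)
  have hs2 : s ≤ 1 / 2 := hsδ.le.trans ((min_le_right _ _).trans (min_le_left _ _))
  have hsM : s ≤ 1 / M := hsδ.le.trans ((min_le_right _ _).trans (min_le_right _ _))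
  have hsh : 0 < Real.sinh s := Real.sinh_pos_iff.2 hs0
  have h1 := (hs ⟨hs0, hsR⟩ (by simp; positivity)).trans hle
  have hMs : M * s ≤ 1 := by
    rw [le_div_iff₀ hM] at hsM; linarith
  have h2 := Sprop_lower_s8 h hc hcs h0 hM hz hs0 hs2 hMs
  have ht : 1 / (M ^ 2 + 1) ∈ Set.Ioo (0 : ℝ) 1 := by
    refine ⟨by positivity, ?_⟩
    rw [div_lt_one (by positivity)]
    nlinarith
  have h3 := le_ciSup (Sprop_bdd h s) ⟨_, ht⟩
  have h4 : (∫ l in Set.Ioi (0 : ℝ), h l * l ^ 2) / 4 ≤ Sstar (fun l => ((h l : ℝ) : ℂ)) s :=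
    h2.trans h3
  rw [← ofReal_norm, ENNReal.ofReal_le_ofReal_iff hK] at h1
  have := Real.le_norm_self (Sstar (fun l => ((h l : ℝ) : ℂ)) s)
  linarith

/-- Theorem 1.1(iii) on `ℍ³`, failure at `q = ∞`: at `α = 3/2` the local
`L^∞` maximal estimate fails on every ball. -/
theorem schrodinger_maximal_fails_critical_Linfty (R : ℝ) (hR : 0 < R) :
    ¬ ∃ C : ℝ, 0 < C ∧ ∀ g : SchwartzMap ℝ ℂ, (∀ x, g (-x) = g x) →
      eLpNorm (Sstar ⇑g) ⊤ (ballMeasure R) ≤ ENNReal.ofReal (C * sobNorm (3 / 2) ⇑g) := by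
  rintro ⟨C, hC, H⟩
  obtain ⟨N, hN1, hN⟩ : ∃ N : ℝ, 1 < N ∧ 64 * C ^ 2 < Real.log N :=
    ((eventually_gt_atTop 1).and (Real.tendsto_log_atTop.eventually_gt_atTop (64 * C ^ 2))).exists
  let f : ContDiffBump (0 : ℝ) := ⟨N, N + 1, by linarith, by linarith⟩
  set w : ℝ → ℝ := fun l => (l ^ 2 + 1) ^ (-(3 / 2) : ℝ) with hw
  have hwd : ContDiff ℝ (⊤ : ℕ∞) w := by
    apply ContDiff.rpow_const_of_ne
    · fun_prop
    · intro x; positivity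
  set h : ℝ → ℝ := fun l => f l * w l with hh
  have hd : ContDiff ℝ (⊤ : ℕ∞) h := f.contDiff.mul hwd
  have hc : Continuous h := hd.continuous
  have hcs : HasCompactSupport h := f.hasCompactSupport.mul_right
  have hw0 : ∀ l, 0 < w l := fun l => by simp only [hw]; positivity
  have h0 : ∀ l, 0 ≤ h l := fun l => mul_nonneg f.nonneg (hw0 l).le
  have hz : ∀ l, N + 1 ≤ l → h l = 0 := by
    intro l hl
    simp only [hh]
    rw [f.zero_of_le_dist, zero_mul]
    rw [Real.dist_eq, sub_zero]
    exact hl.trans (le_abs_self l)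
  have hgcs : HasCompactSupport (fun l => ((h l : ℝ) : ℂ)) :=
    hcs.comp_left (g := fun x : ℝ => (x : ℂ)) (by simp)
  let g : SchwartzMap ℝ ℂ := hgcs.toSchwartzMap (Complex.ofRealCLM.contDiff.comp hd)
  have hg : (⇑g : ℝ → ℂ) = fun l => ((h l : ℝ) : ℂ) := rfl
  have hH := H g (by
    intro x
    simp only [hg, hh, hw, f.neg, neg_sq])
  rw [hg] at hH
  set A := ∫ l in Set.Ioi (0 : ℝ), h l * l ^ 2 with hA
  have hint : Integrable (fun l => h l * l ^ 2) :=
    Continuous.integrable_of_hasCompactSupport (by fun_prop) hcs.mul_right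
  have hA0 : 0 ≤ A := integral_nonneg fun l => mul_nonneg (h0 l) (by positivity)
  have hsob : sobNorm (3 / 2) (fun l => ((h l : ℝ) : ℂ)) ≤ A ^ ((1 : ℝ) / 2) := by
    unfold sobNorm
    apply Real.rpow_le_rpow _ _ (by norm_num)
    · apply integral_nonneg
      intro l
      positivity
    · apply integral_mono_of_nonneg
      · exact Eventually.of_forall fun l => by positivity
      · exact hint.integrableOn
      · refine Eventually.of_forall fun l => ?_
        show (l ^ 2 + 1) ^ ((3 : ℝ) / 2) * ‖((h l : ℝ) : ℂ)‖ ^ 2 * l ^ 2 ≤ h l * l ^ 2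
        have e : (l ^ 2 + 1) ^ ((3 : ℝ) / 2) * w l = 1 := by
          simp only [hw]
          rw [← Real.rpow_add (by positivity)]
          norm_num
        rw [Complex.norm_real, Real.norm_eq_abs, sq_abs]
        have e2 : (l ^ 2 + 1) ^ ((3 : ℝ) / 2) * h l ^ 2 = f l * h l := by
          simp only [hh]
          linear_combination (f l) ^ 2 * w l * e
        rw [e2]
        have := f.le_one (x := l)
        have := h0 l
        gcongr
        nlinarith
  have hs0 : 0 ≤ sobNorm (3 / 2) (fun l => ((h l : ℝ) : ℂ)) := by
    unfold sobNorm
    apply Real.rpow_nonneg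
    apply integral_nonneg
    intro l
    positivity
  have hk := key R hR h hc hcs h0 (M := N + 1) (by linarith) hz _ (mul_nonneg hC.le hs0) hH
  have hk2 : A / 4 ≤ C * Real.sqrt A := by
    rw [Real.sqrt_eq_rpow]
    exact hk.trans (mul_le_mul_of_nonneg_left hsob hC.le)
  have hAlog : Real.log N / 4 ≤ A := by
    have h1 : ∫ l in (1 : ℝ)..N, (1 / 4) * l⁻¹ = Real.log N / 4 := by
      rw [intervalIntegral.integral_const_mul, integral_inv_of_pos one_pos (by linarith)]
      simp; ring
    rw [← h1, intervalIntegral.integral_of_le hN1.le]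
    have h2 : ∫ l in Set.Ioc 1 N, h l * l ^ 2 ≤ A := by
      apply setIntegral_mono_set hint.integrableOn
      · exact Eventually.of_forall fun l => mul_nonneg (h0 l) (by positivity)
      · apply HasSubset.Subset.eventuallyLE
        intro l hl
        exact lt_trans one_pos hl.1
    refine le_trans ?_ h2
    apply setIntegral_mono_on
    · apply IntegrableOn.mono_set _ Set.Ioc_subset_Icc_self
      apply ContinuousOn.integrableOn_Icc
      apply ContinuousOn.mul continuousOn_const
      apply ContinuousOn.inv₀ continuousOn_id
      intro l hl
      have : (1 : ℝ) ≤ l := hl.1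
      exact (by linarith : (0 : ℝ) < l).ne'
    · exact hint.integrableOn
    · exact measurableSet_Ioc
    · intro l hl
      obtain ⟨hl1, hl2⟩ := hl
      have hl0 : 0 < l := by linarith
      have hf1 : f l = 1 := by
        apply f.one_of_mem_closedBall
        rw [mem_closedBall_zero_iff, Real.norm_eq_abs, abs_of_pos hl0]
        exact hl2
      simp only [hh, hf1, one_mul, hw]
      have h3 : (4 * l ^ 2) ^ (-(3 / 2) : ℝ) * 2 = (1 / 4) * l⁻¹ * (l ^ 2)⁻¹ := by
        have : (4 * l ^ 2 : ℝ) = (2 * l) ^ (2 : ℝ) := by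
          rw [Real.rpow_two]; ring
        rw [this, ← Real.rpow_mul (by positivity)]
        have e : (2 : ℝ) * (-(3 / 2)) = -((3 : ℕ) : ℝ) := by norm_num
        rw [e, Real.rpow_neg (by positivity), Real.rpow_natCast]
        field_simp
        norm_num
      have h4 : (2 * l ^ 2) ^ (-(3 / 2) : ℝ) ≤ (l ^ 2 + 1) ^ (-(3 / 2) : ℝ) :=
        Real.rpow_le_rpow_of_nonpos (by positivity) (by nlinarith) (by norm_num)
      have h5 : (4 * l ^ 2) ^ (-(3 / 2) : ℝ) * 2 ≤ (2 * l ^ 2) ^ (-(3 / 2) : ℝ) := by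
        have : (4 * l ^ 2 : ℝ) = 2 * (2 * l ^ 2) := by ring
        rw [this, Real.mul_rpow (by norm_num) (by positivity)]
        have h6 : (2 : ℝ) ^ (-(3 / 2) : ℝ) ≤ 2 ^ (-1 : ℝ) :=
          Real.rpow_le_rpow_of_exponent_le (by norm_num) (by norm_num)
        rw [Real.rpow_neg_one] at h6
        have h7 : 0 ≤ (2 * l ^ 2) ^ (-(3 / 2) : ℝ) := by positivity
        nlinarith
      have h8 : (1 / 4) * l⁻¹ * (l ^ 2)⁻¹ ≤ (l ^ 2 + 1) ^ (-(3 / 2) : ℝ) :=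
        h3 ▸ h5.trans h4
      rwa [← div_eq_mul_inv, div_le_iff₀ (by positivity)] at h8
  have hsq := Real.sq_sqrt hA0
  have hsn := Real.sqrt_nonneg A
  have hApos : 0 < A := by nlinarith [sq_nonneg C]
  have hsp := Real.sqrt_pos.2 hApos
  have h9 : Real.sqrt A ≤ 4 * C := by
    by_contra hcon
    push Not at hcon
    nlinarith
  have h10 : A ≤ 16 * C ^ 2 := by nlinarith
  linarith
end
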